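/- Let p be an odd prime, q = p^m a power of p, and let SU(4, q) be the subgroup of SL(4, F_{q²}) consisting of all matrices g such that σ(g)ᵀ · g = 1, where σ is the q-th power Frobenius map applied entrywise and F_{q²} is the field with q² elements. Let L = PSU(4, q) be the quotient of SU(4, q) by its center. Suppose L acts by linear automorphisms on a nonzero vector space W over a field of characteristic p. Then ω(W ⋊ L) ≠ ω(L). -/

import Mathlib

open Matrix

/-- The spectrum of a group: the set of orders of its elements. -/
def elementOrders (G : Type*) [Monoid G] : Set ℕ := Set.range (orderOf : G → ℕ)

/-- A linear automorphism of `W` gives a multiplicative automorphism of `Multiplicative W`. -/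
def linToMulAut {K W : Type*} [Field K] [AddCommGroup W] [Module K W] :
    (W ≃ₗ[K] W) →* MulAut (Multiplicative W) where
  toFun e := AddEquiv.toMultiplicative e.toAddEquiv
  map_one' := rfl
  map_mul' _ _ := rfl

/-- The special unitary group `SU(4, q)` inside `SL(4, F_{q²})`:
matrices `g` with `σ(g)ᵀ * g = 1`, where `σ` is the `q`-th power Frobenius. -/
def SU4 (p m : ℕ) [Fact p.Prime] (F : Type*) [Field F] [Fintype F] [CharP F p]
    (hF : Fintype.card F = (p ^ m) ^ 2) :
    Subgroup (SpecialLinearGroup (Fin 4) F) where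
  carrier := { g | ((g : Matrix (Fin 4) (Fin 4) F).map (iterateFrobenius F p m))ᵀ * g = 1 }
  one_mem' := by
    simp [Matrix.map_one]
  mul_mem' := by
    intro a b ha hb
    simp only [Set.mem_setOf_eq] at *
    have : ((a * b : SpecialLinearGroup (Fin 4) F) : Matrix (Fin 4) (Fin 4) F)
        = (a : Matrix (Fin 4) (Fin 4) F) * b := rfl
    rw [this, Matrix.map_mul, transpose_mul, mul_assoc,
      ← mul_assoc ((a : Matrix (Fin 4) (Fin 4) F).map _)ᵀ, ha, one_mul, hb]
  inv_mem' := by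
    intro a ha
    simp only [Set.mem_setOf_eq] at *
    set σ := iterateFrobenius F p m with hσ
    set A := (a : Matrix (Fin 4) (Fin 4) F) with hA
    have hdet : det ((A.map σ)ᵀ) = 1 := by
      rw [det_transpose, ← RingHom.mapMatrix_apply, ← RingHom.map_det, hA, a.det_coe,
        _root_.map_one]
    let M : SpecialLinearGroup (Fin 4) F := ⟨(A.map σ)ᵀ, hdet⟩
    have h1 : M * a = 1 := Subtype.ext ha
    have h2 : ((a⁻¹ : SpecialLinearGroup (Fin 4) F) : Matrix (Fin 4) (Fin 4) F)
        = (A.map σ)ᵀ := by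
      rw [← eq_inv_of_mul_eq_one_left h1]
    rw [h2]
    have hσσ : ∀ x : F, σ (σ x) = x := by
      intro x
      rw [hσ, iterateFrobenius_def, iterateFrobenius_def, ← pow_mul, ← pow_two,
        ← hF, FiniteField.pow_card]
    have h3 : ((A.map σ)ᵀ.map σ)ᵀ = A := by
      rw [← Matrix.transpose_map, transpose_transpose, Matrix.map_map]
      have : (⇑σ ∘ ⇑σ) = id := funext fun x => hσσ x
      rw [this, Matrix.map_id]
    rw [h3]
    exact mul_eq_one_comm.mp ha

/-- The sum of the base `p` digits. -/
def digitSum (p n : ℕ) : ℕ := (Nat.digits p n).sum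

section DigitSum

variable {p : ℕ}

@[simp] lemma digitSum_zero : digitSum p 0 = 0 := by simp [digitSum]

lemma digitSum_div_mod (hp : 1 < p) (n : ℕ) :
    digitSum p n = n % p + digitSum p (n / p) := by
  rcases Nat.eq_zero_or_pos n with rfl | hn
  · simp
  · simp [digitSum, Nat.digits_def' hp hn]

lemma digitSum_mul (hp : 1 < p) (n : ℕ) : digitSum p (p * n) = digitSum p n := by
  rw [digitSum_div_mod hp, Nat.mul_mod_right, Nat.mul_div_cancel_left _ (by omega), zero_add]

lemma digitSum_pow_mul (hp : 1 < p) (k n : ℕ) : digitSum p (p ^ k * n) = digitSum p n := by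
  induction k with
  | zero => simp
  | succ k ih => rw [pow_succ', mul_assoc, digitSum_mul hp, ih]

lemma digitSum_of_lt {n : ℕ} (h : n < p) : digitSum p n = n := by
  rcases Nat.eq_zero_or_pos n with rfl | hn
  · simp
  · rw [digitSum_div_mod (by omega), Nat.mod_eq_of_lt h, Nat.div_eq_of_lt h, digitSum_zero,
      add_zero]

lemma digitSum_pos (hp : 1 < p) {n : ℕ} (hn : 0 < n) : 0 < digitSum p n := by
  induction n using Nat.strong_induction_on with
  | _ n ih =>
    rw [digitSum_div_mod hp]
    by_cases h : n % p = 0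
    · have := ih (n / p) (Nat.div_lt_self hn hp)
        (Nat.div_pos (Nat.le_of_dvd hn (Nat.dvd_of_mod_eq_zero h)) (by omega))
      omega
    · omega

lemma digitSum_modEq (hp : 1 < p) (n : ℕ) : n ≡ digitSum p n [MOD p - 1] := by
  rcases Nat.lt_or_ge 2 p with h | h
  · refine Nat.modEq_digits_sum (p - 1) p ?_ n
    obtain ⟨r, rfl⟩ : ∃ r, p = 1 + r := ⟨p - 1, by omega⟩
    rw [Nat.add_sub_cancel_left, Nat.add_mod_right, Nat.mod_eq_of_lt (by omega)]
  · obtain rfl : p = 2 := by omega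
    exact Nat.modEq_one

lemma le_digitSum_mul (hp : 1 < p) (f n : ℕ) (h : n < p ^ (f + 1)) :
    n ≤ digitSum p n * p ^ f := by
  induction f generalizing n with
  | zero => rw [zero_add, pow_one] at h; simp [digitSum_of_lt h]
  | succ f ih =>
    have h1 := ih (n / p) (Nat.div_lt_of_lt_mul (by rwa [← pow_succ']))
    rw [digitSum_div_mod hp]
    calc n = p * (n / p) + n % p := (Nat.div_add_mod n p).symm
      _ ≤ p * (digitSum p (n / p) * p ^ f) + n % p * p ^ (f + 1) := by
        gcongr
        exact Nat.le_mul_of_pos_right _ (by positivity)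
      _ = _ := by ring

lemma digitSum_pow_sub_one (hp : 1 < p) (f : ℕ) : digitSum p (p ^ f - 1) = f * (p - 1) := by
  induction f with
  | zero => simp
  | succ f ih =>
    have h1 : p ^ (f + 1) - 1 = (p - 1) + p * (p ^ f - 1) := by
      have := Nat.one_le_pow f p (by omega)
      rw [Nat.mul_sub, pow_succ', mul_one]
      have : p ≤ p * p ^ f := Nat.le_mul_of_pos_right _ (by omega)
      omega
    rw [digitSum_div_mod hp, h1, Nat.add_mul_mod_self_left, Nat.mod_eq_of_lt (by omega),
      Nat.add_mul_div_left _ _ (by omega), Nat.div_eq_of_lt (by omega), zero_add, ih]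
    ring

lemma exists_digitSum_pred (hp : 1 < p) (n : ℕ) (hn : 0 < n) :
    ∃ a k, n = a + k ∧ digitSum p n = digitSum p a + 1 ∧ digitSum p k = 1 := by
  induction n using Nat.strong_induction_on with
  | _ n ih =>
    by_cases h : n % p = 0
    · obtain ⟨b, rfl⟩ := Nat.dvd_of_mod_eq_zero h
      have hb : 0 < b := Nat.pos_of_mul_pos_left hn
      obtain ⟨a, k, h1, h2, h3⟩ := ih b (by nlinarith) hb
      refine ⟨p * a, p * k, by rw [h1]; ring, ?_, ?_⟩ <;> simp only [digitSum_mul hp, h2, h3]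
    · refine ⟨n - 1, 1, by omega, ?_, digitSum_of_lt hp⟩
      have h1 : n - 1 = (n % p - 1) + p * (n / p) := by
        have := Nat.div_add_mod n p
        omega
      have h2 := Nat.mod_lt n (show 0 < p by omega)
      have h3 : n % p - 1 < p := by omega
      rw [digitSum_div_mod hp n, digitSum_div_mod hp (n - 1), h1, Nat.add_mul_mod_self_left,
        Nat.mod_eq_of_lt h3, Nat.add_mul_div_left _ _ (by omega), Nat.div_eq_of_lt h3, zero_add]
      omega

/-- Kummer's theorem, in additive form. -/
lemma digitSum_add_eq [Fact p.Prime] (n k : ℕ) :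
    digitSum p n + digitSum p k
      = digitSum p (n + k) + (p - 1) * padicValNat p ((n + k).choose n) := by
  have h1 : (p - 1) * padicValNat p (n + k).factorial = n + k - digitSum p (n + k) :=
    sub_one_mul_padicValNat_factorial _
  have h2 : (p - 1) * padicValNat p n.factorial = n - digitSum p n :=
    sub_one_mul_padicValNat_factorial _
  have h3 : (p - 1) * padicValNat p k.factorial = k - digitSum p k :=
    sub_one_mul_padicValNat_factorial _
  have h4 : digitSum p (n + k) ≤ n + k := Nat.digit_sum_le p _
  have h5 : digitSum p n ≤ n := Nat.digit_sum_le p _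
  have h6 : digitSum p k ≤ k := Nat.digit_sum_le p _
  rw [Nat.choose_symm_add]
  have h7 := congrArg (padicValNat p) (Nat.add_choose_mul_factorial_mul_factorial n k)
  rw [padicValNat.mul (mul_ne_zero (Nat.choose_pos (by omega)).ne' (Nat.factorial_ne_zero _))
      (Nat.factorial_ne_zero _),
    padicValNat.mul (Nat.choose_pos (by omega)).ne' (Nat.factorial_ne_zero _)] at h7
  rw [← h7, mul_add, mul_add, h2, h3] at h1
  omega

lemma digitSum_add_le [Fact p.Prime] (n k : ℕ) :
    digitSum p (n + k) ≤ digitSum p n + digitSum p k := by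
  rw [digitSum_add_eq n k]; omega

lemma not_dvd_choose_of_digitSum_lt [Fact p.Prime] (n k : ℕ)
    (h : digitSum p n + digitSum p k < digitSum p (n + k) + (p - 1)) :
    ¬ p ∣ (n + k).choose n := by
  intro hd
  have h1 := digitSum_add_eq (p := p) n k
  have h2 : 1 ≤ padicValNat p ((n + k).choose n) :=
    one_le_padicValNat_of_dvd (Nat.choose_pos (by omega)).ne' hd
  have h3 := Nat.mul_le_mul_left (p - 1) h2
  omega

end DigitSum

section FamilyCoeff

open Polynomial in
/-- The indicator polynomial of `d` on the finite field `k`. -/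
noncomputable def indicatorPoly {k : Type*} [Field k] [Fintype k] (d : k) : k[X] :=
  1 - (X - C d) ^ (Fintype.card k - 1)

/-- The coefficient at `X ^ n` of the reduced polynomial function interpolating `φ`. -/
noncomputable def familyCoeff {k K M : Type*} [Field k] [Fintype k] [Field K] [AddCommGroup M]
    [Module K M] (ι : k →+* K) (φ : k → M) (n : ℕ) : M :=
  ∑ d, ι ((indicatorPoly d).coeff n) • φ d

variable {k K M : Type*} [Field k] [Fintype k] [Field K] [AddCommGroup M] [Module K M]

lemma natDegree_indicatorPoly_lt (d : k) : (indicatorPoly d).natDegree < Fintype.card k := by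
  have h1 : 1 < Fintype.card k := Fintype.one_lt_card
  refine lt_of_le_of_lt (Polynomial.natDegree_sub_le _ _) ?_
  rw [Polynomial.natDegree_one, Polynomial.natDegree_pow, Polynomial.natDegree_X_sub_C]
  omega

lemma eval_indicatorPoly [DecidableEq k] (d c : k) :
    (indicatorPoly d).eval c = if d = c then 1 else 0 := by
  have h1 : 1 < Fintype.card k := Fintype.one_lt_card
  simp only [indicatorPoly, Polynomial.eval_sub, Polynomial.eval_one, Polynomial.eval_pow,
    Polynomial.eval_X, Polynomial.eval_C]
  split_ifs with h
  · rw [h, sub_self, zero_pow (by omega), sub_zero]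
  · rw [FiniteField.pow_card_sub_one_eq_one _ (sub_ne_zero.mpr (Ne.symm h)), sub_self]

variable (ι : k →+* K)

lemma familyCoeff_of_le (φ : k → M) {n : ℕ} (hn : Fintype.card k ≤ n) :
    familyCoeff ι φ n = 0 := by
  refine Finset.sum_eq_zero fun d _ => ?_
  rw [Polynomial.coeff_eq_zero_of_natDegree_lt ((natDegree_indicatorPoly_lt d).trans_le hn),
    map_zero, zero_smul]

lemma sum_familyCoeff (φ : k → M) (c : k) :
    ∑ n ∈ Finset.range (Fintype.card k), ι c ^ n • familyCoeff ι φ n = φ c := by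
  classical
  simp only [familyCoeff, Finset.smul_sum, smul_smul]
  rw [Finset.sum_comm]
  have h : ∀ d : k, ∑ n ∈ Finset.range (Fintype.card k),
      (ι c ^ n * ι ((indicatorPoly d).coeff n)) • φ d = (if d = c then (1 : K) else 0) • φ d := by
    intro d
    rw [← Finset.sum_smul]
    congr 1
    have := eval_indicatorPoly d c
    rw [Polynomial.eval_eq_sum_range' (natDegree_indicatorPoly_lt d)] at this
    rw [← map_one ι, ← map_zero ι, ← apply_ite ι, ← this, map_sum]
    exact Finset.sum_congr rfl fun n _ => by rw [map_mul, map_pow, mul_comm]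
  simp [h]

open Polynomial in
lemma sum_pow_mul_indicatorPoly {j : ℕ} (hj : j < Fintype.card k) :
    ∑ d : k, C (d ^ j) * indicatorPoly d = X ^ j := by
  classical
  refine Polynomial.eq_of_natDegree_lt_card_of_eval_eq _ _ Function.injective_id ?_ ?_
  · intro c
    simp [Polynomial.eval_finsetSum, eval_indicatorPoly]
  · rw [max_lt_iff]
    refine ⟨?_, by simpa using hj⟩
    refine lt_of_le_of_lt (Polynomial.natDegree_sum_le_of_forall_le (n := Fintype.card k - 1)
      _ _ fun d _ => ?_) (Nat.sub_lt Fintype.card_pos one_pos)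
    have := natDegree_indicatorPoly_lt d
    exact (Polynomial.natDegree_C_mul_le _ _).trans (by omega)

lemma sum_coeff_indicatorPoly_mul_pow {j : ℕ} (hj : j < Fintype.card k) (n : ℕ) :
    ∑ d : k, ι ((indicatorPoly d).coeff n) * ι d ^ j = if n = j then 1 else 0 := by
  have := congrArg (fun f => ι (Polynomial.coeff f n)) (sum_pow_mul_indicatorPoly hj)
  simp only [Polynomial.finsetSum_coeff, Polynomial.coeff_C_mul, map_sum, map_mul,
    Polynomial.coeff_X_pow, apply_ite ι, map_one, map_zero] at this
  rw [← this]
  exact Finset.sum_congr rfl fun d _ => by rw [map_pow, mul_comm]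

lemma familyCoeff_unique {φ : k → M} {u : ℕ → M}
    (h : ∀ c, φ c = ∑ n ∈ Finset.range (Fintype.card k), ι c ^ n • u n) {n : ℕ}
    (hn : n < Fintype.card k) : familyCoeff ι φ n = u n := by
  simp only [familyCoeff, h, Finset.smul_sum, smul_smul]
  rw [Finset.sum_comm, Finset.sum_eq_single n]
  · rw [← Finset.sum_smul, sum_coeff_indicatorPoly_mul_pow ι hn, if_pos rfl, one_smul]
  · intro j hj hjn
    rw [← Finset.sum_smul, sum_coeff_indicatorPoly_mul_pow ι (Finset.mem_range.mp hj),
      if_neg (Ne.symm hjn), zero_smul]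
  · intro h; exact absurd (Finset.mem_range.mpr hn) h

lemma eq_zero_of_sum_pow_smul {u : ℕ → M}
    (h : ∀ c : k, ∑ n ∈ Finset.range (Fintype.card k), ι c ^ n • u n = 0) {n : ℕ}
    (hn : n < Fintype.card k) : u n = 0 := by
  rw [← familyCoeff_unique ι (φ := fun _ => 0) (fun c => (h c).symm) hn]
  simp [familyCoeff]

lemma map_familyCoeff {N : Type*} [AddCommGroup N] [Module K N] (f : M →ₗ[K] N) (φ : k → M)
    (n : ℕ) : f (familyCoeff ι φ n) = familyCoeff ι (fun c => f (φ c)) n := by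
  simp [familyCoeff]

lemma familyCoeff_scale (φ : k → M) (μ : k) (n : ℕ) :
    familyCoeff ι (fun c => φ (μ * c)) n = ι μ ^ n • familyCoeff ι φ n := by
  rcases lt_or_ge n (Fintype.card k) with hn | hn
  · refine familyCoeff_unique ι (u := fun n => ι μ ^ n • familyCoeff ι φ n) (fun c => ?_) hn
    conv_lhs => rw [← sum_familyCoeff ι φ (μ * c)]
    refine Finset.sum_congr rfl fun j _ => ?_
    rw [map_mul, mul_pow, smul_smul, mul_comm]
  · rw [familyCoeff_of_le ι _ hn, familyCoeff_of_le ι _ hn, smul_zero]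

lemma familyCoeff_zero (φ : k → M) : familyCoeff ι φ 0 = φ 0 := by
  rw [← sum_familyCoeff ι φ 0, Finset.sum_eq_single 0]
  · simp
  · intro n _ hn; simp [hn]
  · intro h; exact absurd (Finset.mem_range.mpr Fintype.card_pos) h

variable {R : Type*} [Ring R] [Algebra K R]

lemma familyCoeff_mul (y : k → R) (hy : ∀ c d, y (c + d) = y c * y d) (n l : ℕ) :
    familyCoeff ι y n * familyCoeff ι y l
      = ((n + l).choose n : K) • familyCoeff ι y (n + l) := by
  set f := familyCoeff ι y with hf
  have hf0 : ∀ j, Fintype.card k ≤ j → f j = 0 := fun j hj => familyCoeff_of_le ι y hj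
  rcases lt_or_ge n (Fintype.card k) with hn | hn
  swap
  · rw [hf0 n hn, zero_mul, hf0 (n + l) (by omega), smul_zero]
  rcases lt_or_ge l (Fintype.card k) with hl | hl
  swap
  · rw [hf0 l hl, mul_zero, hf0 (n + l) (by omega), smul_zero]
  have h1 : ∀ d, f n * y d = ∑ N ∈ Finset.range (Fintype.card k),
      ((N.choose n : K) * ι d ^ (N - n)) • f N := by
    intro d
    have e1 : f n * y d = familyCoeff ι (fun c => y (c + d)) n := by
      have := map_familyCoeff ι (LinearMap.mulRight K (y d)) y n
      simpa [hy] using this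
    rw [e1]
    refine familyCoeff_unique ι (u := fun n => ∑ N ∈ Finset.range (Fintype.card k),
      ((N.choose n : K) * ι d ^ (N - n)) • f N) (fun c => ?_) hn
    rw [← sum_familyCoeff ι y (c + d)]
    simp only [Finset.smul_sum, smul_smul]
    rw [Finset.sum_comm]
    refine Finset.sum_congr rfl fun N hN => ?_
    rw [← Finset.sum_smul]
    congr 1
    rw [map_add, add_pow]
    rw [Finset.mem_range] at hN
    rw [Finset.sum_subset (Finset.range_subset_range.mpr (Nat.succ_le_of_lt hN))]
    · exact Finset.sum_congr rfl fun j _ => by ring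
    · intro j _ hj
      rw [Finset.mem_range, not_lt] at hj
      rw [Nat.choose_eq_zero_of_lt (by omega), Nat.cast_zero, mul_zero]
  have e2 : f n * f l = familyCoeff ι (fun d => f n * y d) l :=
    map_familyCoeff ι (LinearMap.mulLeft K (f n)) y l
  rw [e2]
  refine familyCoeff_unique ι (u := fun l => ((n + l).choose n : K) • f (n + l)) (fun d => ?_) hl
  rw [h1 d]
  conv_lhs => rw [show Fintype.card k = n + (Fintype.card k - n) by omega]
  rw [Finset.sum_range_add, Finset.sum_eq_zero, zero_add]
  · rw [← Finset.sum_subset (Finset.range_subset_range.mpr (Nat.sub_le (Fintype.card k) n))]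
    · refine Finset.sum_congr rfl fun j _ => ?_
      rw [Nat.add_sub_cancel_left, smul_smul, mul_comm]
    · intro j _ hj
      rw [Finset.mem_range, not_lt] at hj
      rw [hf0 (n + j) (by omega), smul_zero, smul_zero]
  · intro j hj
    rw [Nat.choose_eq_zero_of_lt (Finset.mem_range.mp hj), Nat.cast_zero, zero_mul, zero_smul]

end FamilyCoeff

section TripleFamily

variable {k K M N : Type*} [Field k] [Fintype k] [Field K] [AddCommGroup M] [Module K M]
  [AddCommGroup N] [Module K N] (ι : k →+* K)

lemma sum_pow_smul_familyCoeff_eq_zero (y : k → M) (T : ℕ → M →ₗ[K] N) (s : Finset ℕ)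
    (h : ∀ c, ∑ i ∈ s, T i (y (i * c)) = 0) (n : ℕ) :
    ∑ i ∈ s, (i : K) ^ n • T i (familyCoeff ι y n) = 0 := by
  have h1 : familyCoeff ι (fun c => ∑ i ∈ s, T i (y (i * c))) n = 0 := by
    simp [h, familyCoeff]
  rw [← h1]
  have h2 : familyCoeff ι (fun c => ∑ i ∈ s, T i (y (i * c))) n
      = ∑ i ∈ s, familyCoeff ι (fun c => T i (y (i * c))) n := by
    simp only [familyCoeff, Finset.smul_sum]
    exact Finset.sum_comm
  rw [h2]
  refine Finset.sum_congr rfl fun i _ => ?_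
  have h3 := familyCoeff_scale ι (fun c => T i (y c)) (i : k) n
  rw [h3, map_natCast, map_familyCoeff]

lemma sum_range_natCast_pow {p : ℕ} [Fact p.Prime] [CharP K p] {n : ℕ} (hn : 0 < n)
    (hd : p - 1 ∣ n) : ∑ i ∈ Finset.range p, (i : K) ^ n = -1 := by
  have hp : 0 < p := (Fact.out : p.Prime).pos
  obtain ⟨r, rfl⟩ : ∃ r, p = r + 1 := ⟨p - 1, by omega⟩
  have h1 : ∀ i ∈ Finset.range r, ((i + 1 : ℕ) : K) ^ n = 1 := by
    intro i hi
    rw [Finset.mem_range] at hi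
    have h0 : ((i + 1 : ℕ) : ZMod (r + 1)) ≠ 0 := by
      rw [Ne, ZMod.natCast_eq_zero_iff]
      exact Nat.not_dvd_of_pos_of_lt (by omega) (by omega)
    obtain ⟨e, rfl⟩ := hd
    have h2 := ZMod.pow_card_sub_one_eq_one h0
    have h3 := congrArg (ZMod.castHom (dvd_refl (r + 1)) K) h2
    rw [map_pow, map_natCast, map_one] at h3
    rw [pow_mul, h3, one_pow]
  rw [Finset.sum_range_succ', Finset.sum_congr rfl h1, Nat.cast_zero, zero_pow (by omega)]
  have h4 : ((r + 1 : ℕ) : K) = 0 := CharP.cast_eq_zero K (r + 1)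
  push_cast at h4
  simp
  linear_combination h4

variable {p : ℕ} [Fact p.Prime] [CharP K p] {R : Type*} [Ring R] [Algebra K R]

lemma exists_familyCoeff_eq_mul (y : k → R) (hy : ∀ c d, y (c + d) = y c * y d) {n : ℕ}
    (hn : 0 < n) : ∃ (a l : ℕ) (r : K), digitSum p n = digitSum p a + 1 ∧
      familyCoeff ι y n = r • (familyCoeff ι y a * familyCoeff ι y l) ∧
      familyCoeff ι y n = r • (familyCoeff ι y l * familyCoeff ι y a) := by
  have hp : 1 < p := (Fact.out : p.Prime).one_lt
  obtain ⟨a, l, rfl, h1, h2⟩ := exists_digitSum_pred hp n hn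
  have h3 : ¬ p ∣ (a + l).choose a := not_dvd_choose_of_digitSum_lt a l (by omega)
  have h4 : ((a + l).choose a : K) ≠ 0 := by rwa [Ne, CharP.cast_eq_zero_iff K p]
  refine ⟨a, l, ((a + l).choose a : K)⁻¹, h1, ?_, ?_⟩
  · rw [familyCoeff_mul ι y hy, smul_smul, inv_mul_cancel₀ h4, one_smul]
  · rw [familyCoeff_mul ι y hy, add_comm l a, ← Nat.choose_symm_add (a := a), smul_smul,
      inv_mul_cancel₀ h4, one_smul]

lemma commute_familyCoeff {k' : Type*} [Field k'] [Fintype k'] (ι' : k' →+* K) {y : k → R}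
    {z : k' → R} (h : ∀ c d, Commute (y c) (z d)) (n l : ℕ) :
    Commute (familyCoeff ι y n) (familyCoeff ι' z l) :=
  Commute.sum_left _ _ _ fun _ _ => Commute.sum_right _ _ _ fun _ _ =>
    ((h _ _).smul_left _).smul_right _

variable {k₁ k₂ k₃ : Type*} [Field k₁] [Fintype k₁] [Field k₂] [Fintype k₂] [Field k₃] [Fintype k₃]
  (ι₁ : k₁ →+* K) (ι₂ : k₂ →+* K) (ι₃ : k₃ →+* K) {y₁ : k₁ → R} {y₂ : k₂ → R} {y₃ : k₃ → R}

/-- If the products `y₁(c₁) y₂(c₂) y₃(c₃)` of additive families have vanishing norm, then products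
of coefficients with large total digit sum vanish. -/
lemma familyCoeff_mul_mul_eq_zero (hp2 : 2 < p)
    (h1 : ∀ c d, y₁ (c + d) = y₁ c * y₁ d) (h2 : ∀ c d, y₂ (c + d) = y₂ c * y₂ d)
    (h3 : ∀ c d, y₃ (c + d) = y₃ c * y₃ d) (h23 : ∀ c d, Commute (y₂ c) (y₃ d))
    (h : ∀ c₁ c₂ c₃, ∑ i ∈ Finset.range p, y₁ (i * c₁) * y₂ (i * c₂) * y₃ (i * c₃) = 0)
    (n₁ n₂ n₃ : ℕ) (hn : p - 1 ≤ digitSum p n₁ + digitSum p n₂ + digitSum p n₃) :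
    familyCoeff ι₁ y₁ n₁ * familyCoeff ι₂ y₂ n₂ * familyCoeff ι₃ y₃ n₃ = 0 := by
  have hp : 1 < p := by omega
  generalize hS : digitSum p n₁ + digitSum p n₂ + digitSum p n₃ = S at hn
  induction S, hn using Nat.le_induction generalizing n₁ n₂ n₃ with
  | base =>
    have hN : p - 1 ∣ n₁ + n₂ + n₃ := by
      have := ((digitSum_modEq hp n₁).add (digitSum_modEq hp n₂)).add (digitSum_modEq hp n₃)
      rw [hS] at this
      exact (Nat.modEq_zero_iff_dvd.mp (this.trans (by simp [Nat.ModEq])))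
    have hpos : 0 < n₁ + n₂ + n₃ := by
      by_contra h0
      obtain ⟨⟨rfl, rfl⟩, rfl⟩ : (n₁ = 0 ∧ n₂ = 0) ∧ n₃ = 0 := by omega
      simp at hS
      omega
    have e1 : ∀ c₂ c₃, ∑ i ∈ Finset.range p,
        (i : K) ^ n₁ • (familyCoeff ι₁ y₁ n₁ * y₂ (i * c₂) * y₃ (i * c₃)) = 0 := by
      intro c₂ c₃
      simpa [mul_assoc] using sum_pow_smul_familyCoeff_eq_zero ι₁ y₁
        (fun i => LinearMap.mulRight K (y₂ (i * c₂) * y₃ (i * c₃))) (Finset.range p)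
        (fun c => by simpa [mul_assoc] using h c c₂ c₃) n₁
    have e2 : ∀ c₃, ∑ i ∈ Finset.range p, (i : K) ^ n₂ • (i : K) ^ n₁ •
        (familyCoeff ι₁ y₁ n₁ * familyCoeff ι₂ y₂ n₂ * y₃ (i * c₃)) = 0 := by
      intro c₃
      exact sum_pow_smul_familyCoeff_eq_zero ι₂ y₂
        (fun i => (i : K) ^ n₁ • (LinearMap.mulRight K (y₃ (i * c₃))).comp
          (LinearMap.mulLeft K (familyCoeff ι₁ y₁ n₁))) (Finset.range p)
        (fun c => e1 c c₃) n₂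
    have e3 : ∑ i ∈ Finset.range p, (i : K) ^ n₃ • (i : K) ^ n₂ • (i : K) ^ n₁ •
        (familyCoeff ι₁ y₁ n₁ * familyCoeff ι₂ y₂ n₂ * familyCoeff ι₃ y₃ n₃) = 0 :=
      sum_pow_smul_familyCoeff_eq_zero ι₃ y₃
        (fun i => (i : K) ^ n₂ • (i : K) ^ n₁ •
          LinearMap.mulLeft K (familyCoeff ι₁ y₁ n₁ * familyCoeff ι₂ y₂ n₂)) (Finset.range p)
        (fun c => e2 c) n₃
    simp only [smul_smul, ← pow_add, ← Finset.sum_smul] at e3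
    rw [show n₃ + (n₂ + n₁) = n₁ + n₂ + n₃ by ring, sum_range_natCast_pow hpos hN] at e3
    simpa using e3
  | succ S hle ih =>
    rcases Nat.eq_zero_or_pos n₁ with h01 | h01
    · rcases Nat.eq_zero_or_pos n₂ with h02 | h02
      · have h03 : 0 < n₃ := by
          by_contra h0
          obtain rfl : n₃ = 0 := by omega
          simp [h01, h02] at hS
        obtain ⟨a, l, r, e1, e2, -⟩ := exists_familyCoeff_eq_mul (p := p) ι₃ y₃ h3 h03
        rw [e2, mul_smul_comm, ← mul_assoc, ih n₁ n₂ a (by omega), zero_mul, smul_zero]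
      · obtain ⟨a, l, r, e1, e2, -⟩ := exists_familyCoeff_eq_mul (p := p) ι₂ y₂ h2 h02
        rw [e2, mul_smul_comm, smul_mul_assoc, mul_assoc, mul_assoc,
          (commute_familyCoeff ι₂ ι₃ h23 l n₃).eq, ← mul_assoc, ← mul_assoc,
          ih n₁ a n₃ (by omega), zero_mul, smul_zero]
    · obtain ⟨a, l, r, e1, -, e2⟩ := exists_familyCoeff_eq_mul (p := p) ι₁ y₁ h1 h01
      rw [e2, smul_mul_assoc, smul_mul_assoc, mul_assoc, mul_assoc,
        ← mul_assoc _ _ (familyCoeff _ _ _), ih a n₂ n₃ (by omega), mul_zero, smul_zero]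

end TripleFamily

section RankOne

variable {k : Type*} [Field k]

/-- Upper unitriangular elements of `SL₂`. -/
def slX (a : k) : SpecialLinearGroup (Fin 2) k := ⟨!![1, a; 0, 1], by simp⟩

/-- Lower unitriangular elements of `SL₂`. -/
def slY (c : k) : SpecialLinearGroup (Fin 2) k := ⟨!![1, 0; c, 1], by simp⟩

/-- The Weyl element of `SL₂`. -/
def slW : SpecialLinearGroup (Fin 2) k := ⟨!![0, -1; 1, 0], by simp⟩

/-- Diagonal elements of `SL₂`. -/
def slH (t : kˣ) : SpecialLinearGroup (Fin 2) k := ⟨!![(t : k), 0; 0, (t⁻¹ : kˣ)], by simp⟩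

lemma coe_slX (a : k) : (slX a : Matrix (Fin 2) (Fin 2) k) = !![1, a; 0, 1] := rfl

lemma coe_slY (c : k) : (slY c : Matrix (Fin 2) (Fin 2) k) = !![1, 0; c, 1] := rfl

lemma coe_slW : ((slW : SpecialLinearGroup (Fin 2) k) : Matrix (Fin 2) (Fin 2) k)
    = !![0, -1; 1, 0] := rfl

lemma coe_slH (t : kˣ) : (slH t : Matrix (Fin 2) (Fin 2) k)
    = !![(t : k), 0; 0, (t : k)⁻¹] := by simp [slH]

lemma slX_add (a b : k) : slX (a + b) = slX a * slX b := by
  refine Subtype.ext ?_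
  simp [coe_slX, add_comm]

lemma slY_add (a b : k) : slY (a + b) = slY a * slY b := by
  refine Subtype.ext ?_
  simp [coe_slY]

lemma slX_zero : slX (0 : k) = 1 := by
  refine Subtype.ext ?_
  simp [coe_slX, Matrix.one_fin_two]

lemma slY_zero : slY (0 : k) = 1 := by
  refine Subtype.ext ?_
  simp [coe_slY, Matrix.one_fin_two]

lemma slH_mul (s t : kˣ) : slH (s * t) = slH s * slH t := by
  refine Subtype.ext ?_
  simp [coe_slH, mul_comm]

lemma slH_one : slH (1 : kˣ) = 1 := by
  refine Subtype.ext ?_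
  simp [coe_slH, Matrix.one_fin_two]

lemma slX_mul_slW (a : k) : slX a * slW = slW * slY (-a) := by
  refine Subtype.ext ?_
  simp [coe_slX, coe_slY, coe_slW]

lemma slW_mul_slX (a : k) : slW * slX a = slY (-a) * slW := by
  refine Subtype.ext ?_
  simp [coe_slX, coe_slY, coe_slW]

lemma slX_mul_slY_mul_slX (t : kˣ) :
    slX (-(t⁻¹ : kˣ) : k) * slY (t : k) * slX (-(t⁻¹ : kˣ) : k) = slW * slH t := by
  refine Subtype.ext ?_
  simp [coe_slX, coe_slY, coe_slW, coe_slH]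

lemma slH_mul_slX (t : kˣ) (c : k) : slH t * slX c = slX (t * t * c) * slH t := by
  refine Subtype.ext ?_
  simp [coe_slX, coe_slH]
  field_simp

variable [Fintype k] {K V : Type*} [Field K] [AddCommGroup V] [Module K V] (ι : k →+* K)

/-- Reversal of exponents modulo `Q - 1`. -/
def revExp (Q A n : ℕ) : ℕ := if n ≤ A then A - n else A + (Q - 1) - n

/-- A highest weight vector of weight `A` for `SL₂`: coefficients of the lower unipotent family
are exchanged by the Weyl element. -/
lemma rankOne_reflection (π : SpecialLinearGroup (Fin 2) k →* Module.End K V) (v : V) (A : ℕ)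
    (hA : A < Fintype.card k - 1)
    (hF : familyCoeff ι (fun c => π (slY c)) (Fintype.card k - 1) = 0)
    (hx : ∀ a, π (slX a) v = v) (hh : ∀ t : kˣ, π (slH t) v = ι t ^ A • v) {n : ℕ}
    (hn : n < Fintype.card k - 1) :
    familyCoeff ι (fun c => π (slY c)) n v = (-1 : K) ^ (revExp (Fintype.card k) A n) •
      π slW (familyCoeff ι (fun c => π (slY c)) (revExp (Fintype.card k) A n) v) := by
  set Q := Fintype.card k with hQ
  set f := familyCoeff ι (fun c => π (slY c)) with hf
  have hsum : ∀ c : k, π (slY c) v = ∑ n ∈ Finset.range (Q - 1), ι c ^ n • f n v := by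
    intro c
    have h1 := sum_familyCoeff ι (fun c => π (slY c)) c
    rw [← hQ, ← hf, show Q = (Q - 1) + 1 by omega, Finset.sum_range_succ, hF, smul_zero,
      add_zero] at h1
    rw [← h1]
    simp
  have hrel : ∀ t : kˣ, π (slY (t : k)) v
      = ι t ^ A • π slW (π (slY (-(t⁻¹ : kˣ) : k)) v) := by
    intro t
    have h1 := congrArg (fun g => π (slX ((t⁻¹ : kˣ) : k)) (π g v)) (slX_mul_slY_mul_slX t)
    simp only [map_mul, Module.End.mul_apply, hx, hh, map_smul] at h1
    rw [← Module.End.mul_apply, ← map_mul, ← slX_add, add_neg_cancel, slX_zero, map_one,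
      Module.End.one_apply, ← Module.End.mul_apply (π (slX _)), ← map_mul, slX_mul_slW, map_mul,
      Module.End.mul_apply] at h1
    exact h1
  have hcomp : ∀ t : kˣ, ∑ n ∈ Finset.range (Q - 1), ι t ^ n •
      (f n v - (-1 : K) ^ (revExp Q A n) • π slW (f (revExp Q A n) v)) = 0 := by
    intro t
    simp only [smul_sub, Finset.sum_sub_distrib]
    rw [← hsum, hrel, hsum, map_sum, Finset.smul_sum, sub_eq_zero]
    have ht : ι t ≠ 0 := by simp
    have ht1 : ι t ^ (Q - 1) = 1 := by
      rw [← map_pow, hQ, FiniteField.pow_card_sub_one_eq_one _ t.ne_zero, map_one]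
    refine Finset.sum_bij' (fun n _ => revExp Q A n) (fun n _ => revExp Q A n) ?_ ?_ ?_ ?_ ?_
    · intro n hn; rw [Finset.mem_range] at hn ⊢; unfold revExp; split_ifs <;> omega
    · intro n hn; rw [Finset.mem_range] at hn ⊢; unfold revExp; split_ifs <;> omega
    · intro n hn; rw [Finset.mem_range] at hn; unfold revExp; split_ifs <;> omega
    · intro n hn; rw [Finset.mem_range] at hn; unfold revExp; split_ifs <;> omega
    · intro n hn
      rw [Finset.mem_range] at hn
      have h1 : revExp Q A (revExp Q A n) = n := by unfold revExp; split_ifs <;> omega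
      have h2 : ι t ^ A = ι t ^ revExp Q A n * ι t ^ n := by
        rw [← pow_add]
        unfold revExp
        split_ifs with h
        · congr 1; omega
        · rw [show A + (Q - 1) - n + n = A + (Q - 1) by omega, pow_add, ht1, mul_one]
      rw [h1, map_smul, smul_smul, smul_smul, h2]
      congr 1
      rw [map_neg, Units.val_inv_eq_inv_val, map_inv₀, neg_pow, inv_pow]
      field_simp
  have hzero := eq_zero_of_sum_pow_smul ι (u := fun j => if j = 0 then 0 else
    (f (j - 1) v - (-1 : K) ^ (revExp Q A (j - 1)) • π slW (f (revExp Q A (j - 1)) v)))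
    (fun c => by
      rw [← hQ, show Finset.range Q = Finset.range ((Q - 1) + 1) by congr 1; omega,
        Finset.sum_range_succ']
      rcases eq_or_ne c 0 with rfl | hc
      · simp
      · have := hcomp (Units.mk0 c hc)
        simp only [Units.val_mk0] at this
        simp only [Nat.add_sub_cancel, if_true, smul_zero, add_zero, Nat.add_eq_zero_iff,
          one_ne_zero, and_false, if_false, pow_succ', mul_smul]
        rw [← Finset.smul_sum, this, smul_zero]) (n := n + 1) (by omega)
  simpa [sub_eq_zero] using hzero

lemma rankOne_highest (π : SpecialLinearGroup (Fin 2) k →* Module.End K V) (v : V) (A : ℕ)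
    (hA : A < Fintype.card k - 1)
    (hF : familyCoeff ι (fun c => π (slY c)) (Fintype.card k - 1) = 0)
    (hx : ∀ a, π (slX a) v = v) (hh : ∀ t : kˣ, π (slH t) v = ι t ^ A • v) :
    familyCoeff ι (fun c => π (slY c)) A v = π slW v := by
  rw [rankOne_reflection ι π v A hA hF hx hh hA]
  simp [revExp, familyCoeff_zero, slY_zero]

end RankOne

section IsotropicModel

/-- The Gram matrix of a skew-Hermitian form with an isotropic basis. -/
def gramJ {F : Type*} [Field F] (κ : F) : Matrix (Fin 4) (Fin 4) F :=
  !![0, 0, 0, κ; 0, 0, κ, 0; 0, -κ, 0, 0; -κ, 0, 0, 0]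

/-- The special isometry group of `gramJ κ`. -/
def isoU (p m : ℕ) [Fact p.Prime] {F : Type*} [Field F] [CharP F p] (κ : F) :
    Subgroup (SpecialLinearGroup (Fin 4) F) where
  carrier := { g | ((g : Matrix (Fin 4) (Fin 4) F).map (iterateFrobenius F p m))ᵀ * gramJ κ * g
    = gramJ κ }
  one_mem' := by
    change ((1 : Matrix (Fin 4) (Fin 4) F).map _)ᵀ * _ * (1 : Matrix (Fin 4) (Fin 4) F) = _
    simp [Matrix.map_one]
  mul_mem' := by
    intro a b ha hb
    change ((a * b : Matrix (Fin 4) (Fin 4) F).map _)ᵀ * _ * (a * b : Matrix (Fin 4) (Fin 4) F) = _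
    change ((a : Matrix (Fin 4) (Fin 4) F).map _)ᵀ * _ * (a : Matrix (Fin 4) (Fin 4) F) = _ at ha
    change ((b : Matrix (Fin 4) (Fin 4) F).map _)ᵀ * _ * (b : Matrix (Fin 4) (Fin 4) F) = _ at hb
    rw [Matrix.map_mul, transpose_mul]
    calc _ = ((b : Matrix (Fin 4) (Fin 4) F).map (iterateFrobenius F p m))ᵀ *
          (((a : Matrix (Fin 4) (Fin 4) F).map (iterateFrobenius F p m))ᵀ * gramJ κ *
            (a : Matrix (Fin 4) (Fin 4) F)) * b := by simp only [mul_assoc]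
      _ = _ := by rw [ha, hb]
  inv_mem' := by
    intro a ha
    change ((a : Matrix (Fin 4) (Fin 4) F).map _)ᵀ * _ * (a : Matrix (Fin 4) (Fin 4) F) = _ at ha
    change (((a⁻¹ : SpecialLinearGroup (Fin 4) F) : Matrix (Fin 4) (Fin 4) F).map _)ᵀ * _ *
      ((a⁻¹ : SpecialLinearGroup (Fin 4) F) : Matrix (Fin 4) (Fin 4) F) = _
    have h1 : (a : Matrix (Fin 4) (Fin 4) F) *
        ((a⁻¹ : SpecialLinearGroup (Fin 4) F) : Matrix (Fin 4) (Fin 4) F) = 1 := by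
      exact congrArg Subtype.val (mul_inv_cancel a)
    have h2 : (((a⁻¹ : SpecialLinearGroup (Fin 4) F) : Matrix (Fin 4) (Fin 4) F).map
        (iterateFrobenius F p m))ᵀ *
        ((a : Matrix (Fin 4) (Fin 4) F).map (iterateFrobenius F p m))ᵀ = 1 := by
      rw [← transpose_mul, ← Matrix.map_mul, h1]
      simp [Matrix.map_one]
    conv_lhs => rw [← ha]
    calc _ = ((((a⁻¹ : SpecialLinearGroup (Fin 4) F) : Matrix (Fin 4) (Fin 4) F).map
        (iterateFrobenius F p m))ᵀ *
        ((a : Matrix (Fin 4) (Fin 4) F).map (iterateFrobenius F p m))ᵀ) * gramJ κ *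
        ((a : Matrix (Fin 4) (Fin 4) F) *
        ((a⁻¹ : SpecialLinearGroup (Fin 4) F) : Matrix (Fin 4) (Fin 4) F)) := by
          simp only [mul_assoc]
      _ = _ := by rw [h1, h2, one_mul, mul_one]

variable {p m : ℕ} [Fact p.Prime] {F : Type*} [Field F] [CharP F p] {κ : F}

/-- The underlying matrix of an element of `isoU`. -/
def isoMat (g : isoU p m κ) : Matrix (Fin 4) (Fin 4) F := g.1.1

lemma isoMat_mul (g h : isoU p m κ) : isoMat (g * h) = isoMat g * isoMat h := rfl

lemma isoMat_one : isoMat (1 : isoU p m κ) = 1 := rfl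

lemma isoMat_pow (g : isoU p m κ) (n : ℕ) : isoMat (g ^ n) = isoMat g ^ n := by
  induction n with
  | zero => rfl
  | succ n ih => rw [pow_succ, isoMat_mul, ih, pow_succ]

lemma isoMat_injective : Function.Injective (isoMat : isoU p m κ → _) :=
  fun _ _ h => Subtype.ext (Subtype.ext h)

/-- Constructor for elements of `isoU`. -/
def isoMk (M : Matrix (Fin 4) (Fin 4) F) (h1 : M.det = 1)
    (h2 : (M.map (iterateFrobenius F p m))ᵀ * gramJ κ * M = gramJ κ) : isoU p m κ := ⟨⟨M, h1⟩, h2⟩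

lemma isoMat_mk (M : Matrix (Fin 4) (Fin 4) F) (h1 h2) :
    isoMat (isoMk M h1 h2 : isoU p m κ) = M := rfl

/-- A `2 × 2` matrix acting on the first and last coordinates. -/
def outerMat (M : Matrix (Fin 2) (Fin 2) F) : Matrix (Fin 4) (Fin 4) F :=
  !![M 0 0, 0, 0, M 0 1; 0, 1, 0, 0; 0, 0, 1, 0; M 1 0, 0, 0, M 1 1]

/-- A `2 × 2` matrix acting on the two middle coordinates. -/
def innerMat (M : Matrix (Fin 2) (Fin 2) F) : Matrix (Fin 4) (Fin 4) F :=
  !![1, 0, 0, 0; 0, M 0 0, M 0 1, 0; 0, M 1 0, M 1 1, 0; 0, 0, 0, 1]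

variable (p m) in
/-- A `2 × 2` matrix acting on the first two coordinates and dually on the last two. -/
def leviMat (M : Matrix (Fin 2) (Fin 2) F) : Matrix (Fin 4) (Fin 4) F :=
  !![M 0 0, M 0 1, 0, 0; M 1 0, M 1 1, 0, 0;
    0, 0, iterateFrobenius F p m (M 0 0), -iterateFrobenius F p m (M 0 1);
    0, 0, -iterateFrobenius F p m (M 1 0), iterateFrobenius F p m (M 1 1)]

lemma outerMat_mul (M N : Matrix (Fin 2) (Fin 2) F) :
    outerMat (M * N) = outerMat M * outerMat N := by
  ext i j; fin_cases i <;> fin_cases j <;>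
    simp [outerMat, Matrix.mul_apply, Fin.sum_univ_four, Fin.sum_univ_two]

lemma innerMat_mul (M N : Matrix (Fin 2) (Fin 2) F) :
    innerMat (M * N) = innerMat M * innerMat N := by
  ext i j; fin_cases i <;> fin_cases j <;>
    simp [innerMat, Matrix.mul_apply, Fin.sum_univ_four, Fin.sum_univ_two]

lemma leviMat_mul (M N : Matrix (Fin 2) (Fin 2) F) :
    leviMat p m (M * N) = leviMat p m M * leviMat p m N := by
  ext i j; fin_cases i <;> fin_cases j <;>
    simp [leviMat, Matrix.mul_apply, Fin.sum_univ_four, Fin.sum_univ_two] <;> ring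

lemma outerMat_one : outerMat (1 : Matrix (Fin 2) (Fin 2) F) = 1 := by
  ext i j; fin_cases i <;> fin_cases j <;> simp [outerMat]

lemma innerMat_one : innerMat (1 : Matrix (Fin 2) (Fin 2) F) = 1 := by
  ext i j; fin_cases i <;> fin_cases j <;> simp [innerMat]

lemma leviMat_one : leviMat p m (1 : Matrix (Fin 2) (Fin 2) F) = 1 := by
  ext i j; fin_cases i <;> fin_cases j <;> simp [leviMat]

lemma det_outerMat (M : Matrix (Fin 2) (Fin 2) F) : (outerMat M).det = M.det := by
  simp [outerMat, Matrix.det_succ_row_zero, Fin.sum_univ_succ, Fin.succAbove]; ring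

lemma det_innerMat (M : Matrix (Fin 2) (Fin 2) F) : (innerMat M).det = M.det := by
  simp [innerMat, Matrix.det_succ_row_zero, Fin.sum_univ_succ, Fin.succAbove]

lemma det_leviMat (M : Matrix (Fin 2) (Fin 2) F) :
    (leviMat p m M).det = M.det * iterateFrobenius F p m M.det := by
  simp [leviMat, Matrix.det_succ_row_zero, Fin.sum_univ_succ, Fin.succAbove]; ring

variable {k : Type*} [Field k] (j : k →+* F)

variable (p m κ) in
/-- `SL₂` over the fixed field acting on the outer hyperbolic plane. -/
def outerHom (hj : ∀ a, iterateFrobenius F p m (j a) = j a) :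
    SpecialLinearGroup (Fin 2) k →* isoU p m κ where
  toFun g := isoMk (outerMat ((g : Matrix (Fin 2) (Fin 2) k).map j)) (by
      rw [det_outerMat, ← RingHom.mapMatrix_apply, ← RingHom.map_det, g.det_coe, map_one]) (by
      have h := congrArg j g.det_coe
      rw [Matrix.det_fin_two, map_sub, map_mul, map_mul, map_one] at h
      ext i l; fin_cases i <;> fin_cases l <;>
        simp [outerMat, gramJ, Matrix.mul_apply, Fin.sum_univ_four, hj] <;>
        first | ring1 | linear_combination κ * h | linear_combination -κ * h)
  map_one' := isoMat_injective (by
    simp [isoMat_mk, isoMat_one, outerMat_one, Matrix.map_one])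
  map_mul' g h := isoMat_injective (by
    change outerMat (((g : Matrix (Fin 2) (Fin 2) k) * (h : Matrix (Fin 2) (Fin 2) k)).map j) = _
    rw [Matrix.map_mul, outerMat_mul]
    rfl)

variable (p m κ) in
/-- `SL₂` over the fixed field acting on the inner hyperbolic plane. -/
def innerHom (hj : ∀ a, iterateFrobenius F p m (j a) = j a) :
    SpecialLinearGroup (Fin 2) k →* isoU p m κ where
  toFun g := isoMk (innerMat ((g : Matrix (Fin 2) (Fin 2) k).map j)) (by
      rw [det_innerMat, ← RingHom.mapMatrix_apply, ← RingHom.map_det, g.det_coe, map_one]) (by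
      have h := congrArg j g.det_coe
      rw [Matrix.det_fin_two, map_sub, map_mul, map_mul, map_one] at h
      ext i l; fin_cases i <;> fin_cases l <;>
        simp [innerMat, gramJ, Matrix.mul_apply, Fin.sum_univ_four, hj] <;>
        first | ring1 | linear_combination κ * h | linear_combination -κ * h)
  map_one' := isoMat_injective (by
    simp [isoMat_mk, isoMat_one, innerMat_one, Matrix.map_one])
  map_mul' g h := isoMat_injective (by
    change innerMat (((g : Matrix (Fin 2) (Fin 2) k) * (h : Matrix (Fin 2) (Fin 2) k)).map j) = _
    rw [Matrix.map_mul, innerMat_mul]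
    rfl)

variable (p m κ) in
/-- `SL₂(F)` as a Levi subgroup of `isoU`. -/
def leviHom (hσ : ∀ a : F, iterateFrobenius F p m (iterateFrobenius F p m a) = a) :
    SpecialLinearGroup (Fin 2) F →* isoU p m κ where
  toFun g := isoMk (leviMat p m (g : Matrix (Fin 2) (Fin 2) F)) (by
      rw [det_leviMat, g.det_coe, map_one, mul_one]) (by
      have h := g.det_coe
      rw [Matrix.det_fin_two] at h
      have h' := congrArg (iterateFrobenius F p m) h
      rw [map_sub, map_mul, map_mul, map_one] at h'
      ext i l; fin_cases i <;> fin_cases l <;>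
        simp [leviMat, gramJ, Matrix.mul_apply, Fin.sum_univ_four, hσ] <;>
        first | ring1 | linear_combination κ * h | linear_combination -κ * h |
          linear_combination κ * h')
  map_one' := isoMat_injective (by
    simp [isoMat_mk, isoMat_one, leviMat_one])
  map_mul' g h := isoMat_injective (by
    change leviMat p m ((g : Matrix (Fin 2) (Fin 2) F) * (h : Matrix (Fin 2) (Fin 2) F)) = _
    rw [leviMat_mul]
    rfl)

lemma mat_outerHom (hj : ∀ a, iterateFrobenius F p m (j a) = j a) (g) :
    isoMat (outerHom p m κ j hj g) = outerMat ((g : Matrix (Fin 2) (Fin 2) k).map j) := rfl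

lemma mat_innerHom (hj : ∀ a, iterateFrobenius F p m (j a) = j a) (g) :
    isoMat (innerHom p m κ j hj g) = innerMat ((g : Matrix (Fin 2) (Fin 2) k).map j) := rfl

lemma mat_leviHom (hσ : ∀ a : F, iterateFrobenius F p m (iterateFrobenius F p m a) = a) (g) :
    isoMat (leviHom p m κ hσ g) = leviMat p m (g : Matrix (Fin 2) (Fin 2) F) := rfl

end IsotropicModel

section Projection

variable {p m : ℕ} [Fact p.Prime] {F : Type*} [Field F] [CharP F p]

/-- Transition matrix between an isotropic and an orthonormal basis. -/
def transP (κ ε : F) : Matrix (Fin 4) (Fin 4) F :=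
  !![1, 0, 0, κ / 2; 0, 1, κ / 2, 0; 0, ε, -(ε * κ / 2), 0; ε, 0, 0, -(ε * κ / 2)]

lemma transP_gram (h2 : (2 : F) ≠ 0) {κ ε : F} (hκ : iterateFrobenius F p m κ = -κ)
    (hε : iterateFrobenius F p m ε * ε = -1) :
    ((transP κ ε).map (iterateFrobenius F p m))ᵀ * transP κ ε = gramJ κ := by
  have h3 : iterateFrobenius F p m 2 = 2 := map_ofNat _ 2
  ext i l; fin_cases i <;> fin_cases l <;>
    simp [transP, gramJ, Matrix.mul_apply, Fin.sum_univ_four, hκ, h3] <;> field_simp <;>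
    first
    | linear_combination hε | linear_combination -hε | linear_combination κ * hε
    | linear_combination κ ^ 2 * hε | linear_combination (-κ ^ 2) * hε
    | linear_combination (-κ) * hε

lemma det_gramJ (κ : F) : (gramJ κ).det = κ ^ 4 := by
  simp [gramJ, Matrix.det_succ_row_zero, Fin.sum_univ_succ, Fin.succAbove]; ring

lemma isUnit_det_transP (h2 : (2 : F) ≠ 0) {κ ε : F} (hκ0 : κ ≠ 0)
    (hκ : iterateFrobenius F p m κ = -κ) (hε : iterateFrobenius F p m ε * ε = -1) :
    IsUnit (transP κ ε).det := by
  have := congrArg Matrix.det (transP_gram h2 hκ hε)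
  rw [det_mul, det_gramJ] at this
  exact isUnit_iff_ne_zero.mpr fun h => pow_ne_zero 4 hκ0 (by rw [← this, h, mul_zero])

variable [Fintype F] (hF : Fintype.card F = (p ^ m) ^ 2)

/-- Change of basis from the isotropic model to `SU4`. -/
noncomputable def toSU4 (h2 : (2 : F) ≠ 0) {κ ε : F} (hκ0 : κ ≠ 0)
    (hκ : iterateFrobenius F p m κ = -κ) (hε : iterateFrobenius F p m ε * ε = -1) :
    isoU p m κ →* SU4 p m F hF where
  toFun g := ⟨⟨transP κ ε * isoMat g * (transP κ ε)⁻¹, by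
      rw [det_mul, det_mul, mul_comm, ← mul_assoc, ← det_mul,
        Matrix.nonsing_inv_mul _ (isUnit_det_transP h2 hκ0 hκ hε), det_one, one_mul]
      exact g.1.2⟩, by
      have hP := Matrix.mul_nonsing_inv _ (isUnit_det_transP h2 hκ0 hκ hε)
      have hg : ((isoMat g).map (iterateFrobenius F p m))ᵀ * gramJ κ * isoMat g = gramJ κ := g.2
      have hσ : (((transP κ ε)⁻¹).map (iterateFrobenius F p m))ᵀ *
          ((transP κ ε).map (iterateFrobenius F p m))ᵀ = 1 := by
        rw [← transpose_mul, ← Matrix.map_mul, hP]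
        simp [Matrix.map_one]
      change ((transP κ ε * isoMat g * (transP κ ε)⁻¹).map (iterateFrobenius F p m))ᵀ *
        (transP κ ε * isoMat g * (transP κ ε)⁻¹) = 1
      rw [Matrix.map_mul, Matrix.map_mul, transpose_mul, transpose_mul]
      calc _ = (((transP κ ε)⁻¹).map (iterateFrobenius F p m))ᵀ *
            (((isoMat g).map (iterateFrobenius F p m))ᵀ *
            (((transP κ ε).map (iterateFrobenius F p m))ᵀ * transP κ ε) * isoMat g) *
            (transP κ ε)⁻¹ := by simp only [mul_assoc]
        _ = 1 := by
          rw [transP_gram h2 hκ hε, hg, ← transP_gram h2 hκ hε, ← mul_assoc, hσ, one_mul, hP]⟩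
  map_one' := Subtype.ext (Subtype.ext (by
    change transP κ ε * 1 * (transP κ ε)⁻¹ = 1
    rw [mul_one, Matrix.mul_nonsing_inv _ (isUnit_det_transP h2 hκ0 hκ hε)]))
  map_mul' g h := Subtype.ext (Subtype.ext (by
    change transP κ ε * (isoMat g * isoMat h) * (transP κ ε)⁻¹ =
      transP κ ε * isoMat g * (transP κ ε)⁻¹ * (transP κ ε * isoMat h * (transP κ ε)⁻¹)
    calc _ = transP κ ε * isoMat g * 1 * isoMat h * (transP κ ε)⁻¹ := by
            simp only [mul_assoc, one_mul]
      _ = _ := by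
        rw [← Matrix.nonsing_inv_mul _ (isUnit_det_transP h2 hκ0 hκ hε)]
        simp only [mul_assoc]))

lemma coe_toSU4 (h2 : (2 : F) ≠ 0) {κ ε : F} (hκ0 : κ ≠ 0)
    (hκ : iterateFrobenius F p m κ = -κ) (hε : iterateFrobenius F p m ε * ε = -1)
    (g : isoU p m κ) : (toSU4 hF h2 hκ0 hκ hε g).1.1
      = transP κ ε * isoMat g * (transP κ ε)⁻¹ := rfl

lemma toSU4_injective (h2 : (2 : F) ≠ 0) {κ ε : F} (hκ0 : κ ≠ 0)
    (hκ : iterateFrobenius F p m κ = -κ) (hε : iterateFrobenius F p m ε * ε = -1) :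
    Function.Injective (toSU4 hF h2 hκ0 hκ hε) := by
  intro g h e
  have hP := Matrix.nonsing_inv_mul _ (isUnit_det_transP h2 hκ0 hκ hε)
  have e' := congrArg (fun x : SU4 p m F hF => (transP κ ε)⁻¹ * x.1.1 * transP κ ε) e
  simp only [coe_toSU4] at e'
  refine isoMat_injective ?_
  have key : ∀ M : Matrix (Fin 4) (Fin 4) F,
      (transP κ ε)⁻¹ * (transP κ ε * M * (transP κ ε)⁻¹) * transP κ ε = M := by
    intro M
    calc _ = ((transP κ ε)⁻¹ * transP κ ε) * M * ((transP κ ε)⁻¹ * transP κ ε) := by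
          simp only [mul_assoc]
      _ = M := by rw [hP, one_mul, mul_one]
  rwa [key, key] at e'

variable {k : Type*} [Field k] (j : k →+* F)

lemma eq_smul_one_of_commute {κ : F} (hj : ∀ a, iterateFrobenius F p m (j a) = j a)
    (hσ : ∀ a : F, iterateFrobenius F p m (iterateFrobenius F p m a) = a) (g : isoU p m κ)
    (hg : ∀ h : isoU p m κ, g * h = h * g) : isoMat g = isoMat g 0 0 • 1 := by
  have h1 : isoMat g * !![1, 0, 0, 1; 0, 1, 0, 0; 0, 0, 1, 0; 0, 0, 0, 1]
      = !![1, 0, 0, 1; 0, 1, 0, 0; 0, 0, 1, 0; 0, 0, 0, 1] * isoMat g := by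
    simpa [isoMat_mul, mat_outerHom, coe_slX, outerMat]
      using congrArg isoMat (hg (outerHom p m κ j hj (slX 1)))
  have h2 : isoMat g * !![1, 0, 0, 0; 0, 1, 0, 0; 0, 0, 1, 0; 1, 0, 0, 1]
      = !![1, 0, 0, 0; 0, 1, 0, 0; 0, 0, 1, 0; 1, 0, 0, 1] * isoMat g := by
    simpa [isoMat_mul, mat_outerHom, coe_slY, outerMat]
      using congrArg isoMat (hg (outerHom p m κ j hj (slY 1)))
  have h3 : isoMat g * !![1, 0, 0, 0; 0, 1, 1, 0; 0, 0, 1, 0; 0, 0, 0, 1]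
      = !![1, 0, 0, 0; 0, 1, 1, 0; 0, 0, 1, 0; 0, 0, 0, 1] * isoMat g := by
    simpa [isoMat_mul, mat_innerHom, coe_slX, innerMat]
      using congrArg isoMat (hg (innerHom p m κ j hj (slX 1)))
  have h4 : isoMat g * !![1, 0, 0, 0; 0, 1, 0, 0; 0, 1, 1, 0; 0, 0, 0, 1]
      = !![1, 0, 0, 0; 0, 1, 0, 0; 0, 1, 1, 0; 0, 0, 0, 1] * isoMat g := by
    simpa [isoMat_mul, mat_innerHom, coe_slY, innerMat]
      using congrArg isoMat (hg (innerHom p m κ j hj (slY 1)))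
  have h5 : isoMat g * !![1, 1, 0, 0; 0, 1, 0, 0; 0, 0, 1, -1; 0, 0, 0, 1]
      = !![1, 1, 0, 0; 0, 1, 0, 0; 0, 0, 1, -1; 0, 0, 0, 1] * isoMat g := by
    simpa [isoMat_mul, mat_leviHom, coe_slX, leviMat]
      using congrArg isoMat (hg (leviHom p m κ hσ (slX 1)))
  simp only [← Matrix.ext_iff, Fin.forall_fin_succ, Matrix.mul_apply, Fin.sum_univ_four]
    at h1 h2 h3 h4 h5
  simp at h1 h2 h3 h4 h5
  generalize isoMat g = M at *
  ext i l; fin_cases i <;> fin_cases l <;> simp <;> grind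

lemma mk_toSU4_eq_one_iff (h2 : (2 : F) ≠ 0) {κ ε : F} (hκ0 : κ ≠ 0)
    (hκ : iterateFrobenius F p m κ = -κ) (hε : iterateFrobenius F p m ε * ε = -1)
    (hj : ∀ a, iterateFrobenius F p m (j a) = j a)
    (hσ : ∀ a : F, iterateFrobenius F p m (iterateFrobenius F p m a) = a) (g : isoU p m κ) :
    QuotientGroup.mk' (Subgroup.center (SU4 p m F hF)) (toSU4 hF h2 hκ0 hκ hε g) = 1 ↔
      ∃ c : F, isoMat g = c • 1 := by
  rw [QuotientGroup.mk'_apply, QuotientGroup.eq_one_iff, Subgroup.mem_center_iff]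
  constructor
  · intro h
    refine ⟨_, eq_smul_one_of_commute j hj hσ g fun x => ?_⟩
    refine toSU4_injective hF h2 hκ0 hκ hε ?_
    rw [map_mul, map_mul, h]
  · rintro ⟨c, hc⟩ x
    refine Subtype.ext (Subtype.ext ?_)
    change x.1.1 * (toSU4 hF h2 hκ0 hκ hε g).1.1 = (toSU4 hF h2 hκ0 hκ hε g).1.1 * x.1.1
    rw [coe_toSU4, hc, Matrix.mul_smul, mul_one, Matrix.smul_mul,
      Matrix.mul_nonsing_inv _ (isUnit_det_transP h2 hκ0 hκ hε), Matrix.mul_smul, mul_one,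
      Matrix.smul_mul, one_mul]

end Projection

section UnitarySpectrum

open Polynomial

variable {E : Type*} [Field E]

lemma roots_pow_eq_one {B : Matrix (Fin 4) (Fin 4) E} {n : ℕ} (h : B ^ n = 1) {x : E}
    (hx : x ∈ B.charpoly.roots) : x ^ n = 1 := by
  have h1 : x ∈ spectrum E B :=
    mem_spectrum_iff_isRoot_charpoly.mpr (isRoot_of_mem_roots hx)
  have h2 := spectrum.pow_mem_pow B n h1
  rw [h, spectrum.one_eq] at h2
  exact h2

/-- The exponent of the torus part of a unitary element with a repeated eigenvalue. -/
lemma exists_exponent_of_not_nodup {q : ℕ} (hq : Odd q) {s : Multiset E} (hcard : s.card = 4)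
    (hprod : s.prod = 1) (hs0 : ∀ x ∈ s, x ≠ 0) (hf : s.map (fun x => (x ^ q)⁻¹) = s)
    (hdup : ¬ s.Nodup) : ∃ n c, (∀ x ∈ s, x ^ n = c) ∧
      (n = q + 1 ∨ n = (q ^ 2 - 1) / (if q % 4 = 1 then 2 else 4)) := by
  classical
  rw [Multiset.nodup_iff_ne_cons_cons] at hdup
  push Not at hdup
  obtain ⟨l, t, rfl⟩ := hdup
  obtain ⟨a, b, rfl⟩ := Multiset.card_eq_two.mp (by simpa using hcard)
  have hl0 : l ≠ 0 := hs0 l (by simp)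
  have ha0 : a ≠ 0 := hs0 a (by simp)
  have hb0 : b ≠ 0 := hs0 b (by simp)
  have hprod' : l * (l * (a * b)) = 1 := by simpa using hprod
  set f : E → E := fun x => (x ^ q)⁻¹ with hfdef
  have hf' : f l ::ₘ f l ::ₘ {f a, f b} = l ::ₘ l ::ₘ {a, b} := by simpa using hf
  have hqpos : 0 < q := hq.pos
  by_cases hl : f l = l
  · have hl1 : l ^ q = l⁻¹ := by rw [← _root_.inv_inj]; simpa [hfdef] using hl
    have hl2 : l ^ (q + 1) = 1 := by rw [pow_succ, hl1, inv_mul_cancel₀ hl0]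
    rw [hl, Multiset.cons_inj_right, Multiset.cons_inj_right] at hf'
    have hcase : (f a = a ∧ f b = b) ∨ (f a = b ∧ f b = a) := by
      have h1 : f a ∈ ({a, b} : Multiset E) := by rw [← hf']; simp
      have h2 : f b ∈ ({a, b} : Multiset E) := by rw [← hf']; simp
      have h3 : a ∈ ({f a, f b} : Multiset E) := by rw [hf']; simp
      have h4 : b ∈ ({f a, f b} : Multiset E) := by rw [hf']; simp
      simp at h1 h2 h3 h4
      grind
    rcases hcase with ⟨h1, h2⟩ | ⟨h1, -⟩
    · refine ⟨q + 1, 1, ?_, Or.inl rfl⟩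
      have key : ∀ x : E, x ≠ 0 → f x = x → x ^ (q + 1) = 1 := by
        intro x hx h
        have : x ^ q = x⁻¹ := by rw [← _root_.inv_inj]; simpa [hfdef] using h
        rw [pow_succ, this, inv_mul_cancel₀ hx]
      intro x hx
      simp at hx
      rcases hx with rfl | rfl | rfl
      exacts [hl2, key _ ha0 h1, key _ hb0 h2]
    · set n := (q ^ 2 - 1) / (if q % 4 = 1 then 2 else 4) with hn
      refine ⟨n, l ^ n, ?_, Or.inr rfl⟩
      have hb1 : b = (a ^ q)⁻¹ := h1.symm
      have hk1 : (a / l) ^ (q - 1) = l ^ 4 := by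
        have e1 : a ^ (q - 1) * a = a ^ q := by rw [← pow_succ]; congr 1; omega
        have e2 : l ^ (q - 1) * l = l⁻¹ := by rw [← pow_succ, ← hl1]; congr 1; omega
        have e3 : l ^ (q - 1) = l⁻¹ * l⁻¹ := by
          rw [eq_mul_inv_iff_mul_eq₀ hl0, e2]
        rw [hb1] at hprod'
        rw [div_pow, e3]
        have e4 : a ^ q ≠ 0 := pow_ne_zero _ ha0
        field_simp at hprod'
        have e5 : a ^ (q - 1) * a = l ^ 2 * a := by rw [e1, ← hprod']
        rw [mul_right_cancel₀ ha0 e5]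
        field_simp
      have hk2 : (a / l) ^ n = 1 := by
        obtain ⟨r, hr⟩ := hq
        rw [hn]
        split_ifs with h4
        · have : (q ^ 2 - 1) / 2 = (q - 1) * (r + 1) := by
            subst hr
            rw [show (2 * r + 1) ^ 2 - 1 = 2 * (2 * r * (r + 1)) by
              rw [Nat.sub_eq_iff_eq_add (Nat.one_le_pow _ _ (by omega))]; ring]
            simp
          rw [this, pow_mul, hk1, ← pow_mul, show 4 * (r + 1) = (q + 1) * 2 by omega, pow_mul, hl2,
            one_pow]
        · obtain ⟨w, hw⟩ : ∃ w, q = 4 * w + 3 := ⟨q / 4, by omega⟩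
          have : (q ^ 2 - 1) / 4 = (q - 1) * (w + 1) := by
            subst hw
            rw [show (4 * w + 3) ^ 2 - 1 = 4 * ((4 * w + 2) * (w + 1)) by
              rw [Nat.sub_eq_iff_eq_add (Nat.one_le_pow _ _ (by omega))]; ring]
            simp
          rw [this, pow_mul, hk1, ← pow_mul, show 4 * (w + 1) = q + 1 by omega, hl2]
      have hk3 : b / l = ((a / l) ^ q)⁻¹ := by
        rw [hb1, div_pow, hl1]
        field_simp
      have ha2 : a ^ n = l ^ n := by
        rwa [div_pow, div_eq_one_iff_eq (pow_ne_zero _ hl0)] at hk2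
      have hb2 : b ^ n = l ^ n := by
        have : (b / l) ^ n = 1 := by
          rw [hk3, inv_pow, ← pow_mul, mul_comm, pow_mul, hk2, one_pow, inv_one]
        rwa [div_pow, div_eq_one_iff_eq (pow_ne_zero _ hl0)] at this
      intro x hx
      simp at hx
      rcases hx with rfl | rfl | rfl
      exacts [rfl, ha2, hb2]
  · have hab : a = f l ∧ b = f l := by
      have h1 := congrArg (Multiset.count (f l)) hf'
      simp only [Multiset.insert_eq_cons, Multiset.count_cons, if_true,
        Multiset.count_singleton, if_neg hl] at h1
      by_cases ha : f l = a
      · by_cases hb : f l = b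
        · exact ⟨ha.symm, hb.symm⟩
        · rw [if_neg hb] at h1
          split_ifs at h1 <;> omega
      · rw [if_neg ha] at h1
        split_ifs at h1 <;> omega
    set n := (q ^ 2 - 1) / (if q % 4 = 1 then 2 else 4) with hn
    refine ⟨n, l ^ n, ?_, Or.inr rfl⟩
    have h1 : l ^ (2 * (q - 1)) = 1 := by
      rw [hab.1, hab.2] at hprod'
      have e1 : l ^ q = l ^ (q - 1) * l := by rw [← pow_succ]; congr 1; omega
      simp only [hfdef, e1] at hprod'
      have e2 : l ^ (q - 1) ≠ 0 := pow_ne_zero _ hl0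
      field_simp at hprod'
      rw [mul_comm, pow_mul]
      exact hprod'.symm
    have h2 : l ^ ((q + 1) * n) = 1 := by
      obtain ⟨r, hr⟩ := hq
      suffices 2 * (q - 1) ∣ (q + 1) * n by
        obtain ⟨w, hw⟩ := this
        rw [hw, pow_mul, h1, one_pow]
      rw [hn]
      split_ifs with h4
      · refine ⟨(r + 1) * (r + 1), ?_⟩
        subst hr
        rw [show (2 * r + 1) ^ 2 - 1 = 2 * (2 * r * (r + 1)) by
          rw [Nat.sub_eq_iff_eq_add (Nat.one_le_pow _ _ (by omega))]; ring]
        simp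
        ring
      · obtain ⟨w, hw⟩ : ∃ w, q = 4 * w + 3 := ⟨q / 4, by omega⟩
        refine ⟨2 * (w + 1) * (w + 1), ?_⟩
        subst hw
        rw [show (4 * w + 3) ^ 2 - 1 = 4 * ((4 * w + 2) * (w + 1)) by
          rw [Nat.sub_eq_iff_eq_add (Nat.one_le_pow _ _ (by omega))]; ring]
        simp
        ring
    have h3 : (f l) ^ n = l ^ n := by
      rw [add_mul, one_mul, pow_add] at h2
      simp only [hfdef]
      rw [inv_pow, ← pow_mul]
      exact inv_eq_of_mul_eq_one_right h2
    intro x hx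
    simp [hab.1, hab.2] at hx
    rcases hx with rfl | rfl
    exacts [rfl, h3]

variable [IsAlgClosed E]

lemma charpoly_eq_prod_roots (B : Matrix (Fin 4) (Fin 4) E) :
    B.charpoly = (B.charpoly.roots.map fun x => X - C x).prod :=
  (IsAlgClosed.splits _).eq_prod_roots_of_monic B.charpoly_monic

lemma card_roots_charpoly (B : Matrix (Fin 4) (Fin 4) E) : B.charpoly.roots.card = 4 := by
  rw [IsAlgClosed.card_roots_eq_natDegree, charpoly_natDegree_eq_dim, Fintype.card_fin]

lemma roots_ne_zero {B : Matrix (Fin 4) (Fin 4) E} (hdet : B.det = 1) {x : E}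
    (hx : x ∈ B.charpoly.roots) : x ≠ 0 := by
  rintro rfl
  have := Matrix.det_eq_prod_roots_charpoly (A := B)
  rw [hdet, Multiset.prod_eq_zero hx] at this
  exact one_ne_zero this

lemma roots_map_unitary {p m : ℕ} [Fact p.Prime] [CharP E p] {B : Matrix (Fin 4) (Fin 4) E}
    (hB : (B.map (iterateFrobenius E p m))ᵀ * B = 1) (hdet : B.det = 1) :
    B.charpoly.roots.map (fun x => (x ^ p ^ m)⁻¹) = B.charpoly.roots := by
  set s := B.charpoly.roots with hs
  have hs0 : ∀ x ∈ s, x ≠ 0 := fun x hx => roots_ne_zero hdet hx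
  have hprod : s.prod = 1 := by rw [← hdet, Matrix.det_eq_prod_roots_charpoly]
  have hpoly : (s.map fun x => X - C (x ^ p ^ m)).prod = (s.map fun x => X - C x⁻¹).prod := by
    have h1 : (s.map fun x => X - C (x ^ p ^ m)).prod
        = ((B.map (iterateFrobenius E p m))ᵀ).charpoly := by
      have e := charpoly_eq_prod_roots B
      rw [charpoly_transpose, charpoly_map]
      rw [e, Polynomial.map_multiset_prod, Multiset.map_map, ← hs]
      congr 1
      refine Multiset.map_congr rfl fun x _ => ?_
      simp [iterateFrobenius_def]
    rw [h1]
    refine Polynomial.eq_of_infinite_eval_eq _ _ ((Set.finite_singleton (0 : E)).infinite_compl.mono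
      fun z hz => ?_)
    have hz0 : z ≠ 0 := hz
    change eval z _ = eval z _
    rw [eval_charpoly]
    have h2 : (scalar (Fin 4) z - (B.map (iterateFrobenius E p m))ᵀ) * B
        = (-z) • (scalar (Fin 4) z⁻¹ - B) := by
      rw [sub_mul, hB, smul_sub]
      ext i l
      by_cases hil : i = l <;> simp [hil, hz0]
      ring
    have h3 := congrArg Matrix.det h2
    rw [det_mul, hdet, mul_one, det_smul, ← eval_charpoly B z⁻¹, Fintype.card_fin] at h3
    rw [h3, charpoly_eq_prod_roots B, ← hs, eval_multiset_prod, eval_multiset_prod,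
      Multiset.map_map, Multiset.map_map]
    have h4 : (s.map fun x => -z * (z⁻¹ - x)).prod = (s.map fun x => x * (z - x⁻¹)).prod := by
      congr 1
      refine Multiset.map_congr rfl fun x hx => ?_
      have := hs0 x hx
      field_simp
      ring
    rw [Multiset.prod_map_mul, Multiset.prod_map_mul, Multiset.map_const', Multiset.prod_replicate,
      hs, card_roots_charpoly, ← hs, Multiset.map_id', hprod, one_mul] at h4
    simpa using h4
  have h5 : s.map (fun x => x ^ p ^ m) = s.map fun x => x⁻¹ := by
    have := congrArg Polynomial.roots hpoly
    have e : ∀ f : E → E, s.map (fun x => X - C (f x)) = (s.map f).map fun x => X - C x :=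
      fun f => by rw [Multiset.map_map]; rfl
    rwa [e (fun x => x ^ p ^ m), e (fun x => x⁻¹),
      roots_multiset_prod_X_sub_C, roots_multiset_prod_X_sub_C] at this
  calc s.map (fun x => (x ^ p ^ m)⁻¹) = (s.map fun x => x ^ p ^ m).map fun x => x⁻¹ := by
        rw [Multiset.map_map]; rfl
    _ = s := by rw [h5, Multiset.map_map]; simp

lemma pow_pow_eq_smul_one {p e : ℕ} [Fact p.Prime] [CharP E p] (he : 4 ≤ p ^ e)
    {B : Matrix (Fin 4) (Fin 4) E} {n : ℕ} {c : E} (h : ∀ x ∈ B.charpoly.roots, x ^ n = c) :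
    B ^ (n * p ^ e) = c ^ p ^ e • 1 := by
  have h1 : B.charpoly ∣ (X ^ n - C c) ^ 4 := by
    rw [charpoly_eq_prod_roots B]
    conv_rhs => rw [← card_roots_charpoly B, ← Multiset.prod_replicate, ← Multiset.map_const']
    refine Multiset.prod_dvd_prod_of_dvd _ _ fun x hx => ?_
    rw [dvd_iff_isRoot]
    simp [h x hx]
  have h2 := aeval_eq_zero_of_dvd_aeval_eq_zero h1 (aeval_self_charpoly B)
  simp only [map_pow, map_sub, aeval_X, aeval_C, Algebra.algebraMap_eq_smul_one] at h2
  have h3 : (B ^ n - c • 1) ^ p ^ e = 0 := pow_eq_zero_of_le he h2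
  rw [sub_pow_char_pow_of_commute p e ((Commute.one_right _).smul_right c), sub_eq_zero, ← pow_mul,
    _root_.smul_pow, one_pow] at h3
  exact h3

lemma pow_eq_one_of_nodup {B : Matrix (Fin 4) (Fin 4) E} {n : ℕ} (hn : 0 < n)
    (h : ∀ x ∈ B.charpoly.roots, x ^ n = 1) (hs : B.charpoly.roots.Nodup) : B ^ n = 1 := by
  have h0 : (X ^ n - C (1 : E)) ≠ 0 := X_pow_sub_C_ne_zero hn 1
  have h1 : B.charpoly ∣ X ^ n - C 1 := by
    rw [charpoly_eq_prod_roots B, Multiset.prod_X_sub_C_dvd_iff_le_roots h0,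
      Multiset.le_iff_subset hs]
    intro x hx
    exact (mem_roots h0).mpr (by simp [h x hx])
  have h2 := aeval_eq_zero_of_dvd_aeval_eq_zero h1 (aeval_self_charpoly B)
  simpa only [map_sub, map_pow, aeval_X, map_one, sub_eq_zero] using h2

lemma cube_pow_eq_one {B : Matrix (Fin 4) (Fin 4) E} [CharP E 3] {n : ℕ} {a b : E}
    (hn : 0 < n) (h : ∀ x ∈ B.charpoly.roots, x ^ n = 1) (ha : a ∈ B.charpoly.roots)
    (hb : b ∈ B.charpoly.roots) (hab : a ≠ b) : B ^ (n * 3) = 1 := by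
  have h0 : (X ^ n - C (1 : E)) ≠ 0 := X_pow_sub_C_ne_zero hn 1
  obtain ⟨t, ht⟩ := Multiset.exists_cons_of_mem ha
  have hb' : b ∈ t := by
    rw [ht, Multiset.mem_cons] at hb
    exact hb.resolve_left hab.symm
  obtain ⟨u, rfl⟩ := Multiset.exists_cons_of_mem hb'
  have hu : u.card = 2 := by
    have := card_roots_charpoly B
    rw [ht] at this
    simpa using this
  have h1 : B.charpoly ∣ (X ^ n - C 1) ^ 3 := by
    have e1 : B.charpoly = (({a, b} : Multiset E).map fun x => X - C x).prod *
        (u.map fun x => X - C x).prod := by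
      conv_lhs => rw [charpoly_eq_prod_roots B, ht]
      simp [mul_assoc]
    rw [e1, pow_succ' _ 2]
    refine mul_dvd_mul ?_ ?_
    · rw [Multiset.prod_X_sub_C_dvd_iff_le_roots h0]
      refine (Multiset.le_iff_subset (Multiset.nodup_cons.mpr
        ⟨by simpa using hab, Multiset.nodup_singleton b⟩)).mpr ?_
      intro x hx
      have : x ∈ B.charpoly.roots := by
        rw [ht]
        rw [Multiset.mem_cons, Multiset.mem_singleton] at hx
        rcases hx with rfl | rfl <;> simp
      exact (mem_roots h0).mpr (by simp [h x this])
    · rw [← hu, ← Multiset.prod_replicate, ← Multiset.map_const']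
      refine Multiset.prod_dvd_prod_of_dvd _ _ fun x hx => ?_
      have : x ∈ B.charpoly.roots := by
        rw [ht]; simp [hx]
      rw [dvd_iff_isRoot]
      simp [h x this]
  have h2 := aeval_eq_zero_of_dvd_aeval_eq_zero h1 (aeval_self_charpoly B)
  simp only [map_pow, map_sub, aeval_X, map_one] at h2
  have : Fact (Nat.Prime 3) := ⟨Nat.prime_three⟩
  rw [sub_pow_char_of_commute 3 (Commute.one_right _), sub_eq_zero, ← pow_mul, one_pow] at h2
  exact h2

end UnitarySpectrum

section ElementOrders

variable {p m : ℕ} [Fact p.Prime] {F : Type*} [Field F] [Fintype F] [CharP F p]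
  {hF : Fintype.card F = (p ^ m) ^ 2}

/-- The matrix of an element of `SU4` over an algebraic closure. -/
noncomputable def closureMat (g : SU4 p m F hF) : Matrix (Fin 4) (Fin 4) (AlgebraicClosure F) :=
  g.1.1.map (algebraMap F (AlgebraicClosure F))

lemma closureMat_mul (g h : SU4 p m F hF) :
    closureMat (g * h) = closureMat g * closureMat h :=
  Matrix.map_mul (f := algebraMap F (AlgebraicClosure F)) (L := g.1.1) (M := h.1.1)

lemma closureMat_one : closureMat (1 : SU4 p m F hF) = 1 := by
  change (1 : Matrix (Fin 4) (Fin 4) F).map _ = 1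
  exact Matrix.map_one _ (map_zero _) (map_one _)

lemma closureMat_pow (g : SU4 p m F hF) (n : ℕ) : closureMat (g ^ n) = closureMat g ^ n := by
  induction n with
  | zero => rw [pow_zero, pow_zero, closureMat_one]
  | succ n ih => rw [pow_succ, closureMat_mul, ih, pow_succ]

lemma closureMat_injective : Function.Injective (closureMat : SU4 p m F hF → _) := by
  intro g h hgh
  refine Subtype.ext (Subtype.ext ?_)
  exact Matrix.map_injective (algebraMap F (AlgebraicClosure F)).injective hgh

lemma det_closureMat (g : SU4 p m F hF) : (closureMat g).det = 1 := by
  rw [closureMat, ← RingHom.mapMatrix_apply, ← RingHom.map_det, g.1.2, map_one]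

lemma closureMat_unitary [CharP (AlgebraicClosure F) p] (g : SU4 p m F hF) :
    ((closureMat g).map (iterateFrobenius (AlgebraicClosure F) p m))ᵀ * closureMat g = 1 := by
  have h : (g.1.1.map (iterateFrobenius F p m))ᵀ * g.1.1 = 1 := g.2
  have h2 := congrArg (fun M => M.map (algebraMap F (AlgebraicClosure F))) h
  rw [Matrix.map_mul, Matrix.map_one _ (map_zero _) (map_one _)] at h2
  rw [← h2]
  congr 1
  ext i l
  simp [closureMat, iterateFrobenius_def]

lemma mk_pow_eq_one {g : SU4 p m F hF} {n : ℕ} {c : AlgebraicClosure F}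
    (h : closureMat g ^ n = c • 1) :
    (QuotientGroup.mk g : SU4 p m F hF ⧸ Subgroup.center (SU4 p m F hF)) ^ n = 1 := by
  rw [← QuotientGroup.mk_pow, QuotientGroup.eq_one_iff, Subgroup.mem_center_iff]
  intro x
  refine closureMat_injective ?_
  rw [closureMat_mul, closureMat_mul, closureMat_pow, h]
  simp

lemma exists_coprime_exponent (g : SU4 p m F hF) : ∃ n, 0 < n ∧ ¬ p ∣ n ∧
    ∀ x ∈ (closureMat g).charpoly.roots, x ^ n = 1 := by
  have : CharP (AlgebraicClosure F) p :=
    charP_of_injective_algebraMap (algebraMap F (AlgebraicClosure F)).injective p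
  have : Finite (SpecialLinearGroup (Fin 4) F) := Subtype.finite
  have h0 : 0 < orderOf g := orderOf_pos g
  obtain ⟨e, n, hn, he⟩ := Nat.exists_eq_pow_mul_and_not_dvd h0.ne' p (Fact.out : p.Prime).ne_one
  refine ⟨n, Nat.pos_of_ne_zero fun h => ?_, hn, fun x hx => ?_⟩
  · rw [h, mul_zero] at he; omega
  · have h1 : closureMat g ^ orderOf g = 1 := by
      rw [← closureMat_pow, pow_orderOf_eq_one, closureMat_one]
    have h2 := roots_pow_eq_one h1 hx
    rw [he, mul_comm, pow_mul] at h2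
    refine iterateFrobenius_inj (AlgebraicClosure F) p e ?_
    rw [iterateFrobenius_def, h2, map_one]

/-- For `p ≥ 5` the Sylow `p`-subgroups of `PSU₄` have exponent `p`. -/
lemma not_sq_dvd_orderOf (hp : 5 ≤ p) (y : SU4 p m F hF ⧸ Subgroup.center (SU4 p m F hF)) :
    ¬ p ^ 2 ∣ orderOf y := by
  have : CharP (AlgebraicClosure F) p :=
    charP_of_injective_algebraMap (algebraMap F (AlgebraicClosure F)).injective p
  obtain ⟨g, rfl⟩ := QuotientGroup.mk_surjective y
  obtain ⟨n, hn0, hn, hr⟩ := exists_coprime_exponent g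
  have h := mk_pow_eq_one (pow_pow_eq_smul_one (e := 1) (by rw [pow_one]; omega) hr)
  intro hd
  have h2 := hd.trans (orderOf_dvd_of_pow_eq_one h)
  rw [pow_one, pow_two] at h2
  exact hn (Nat.dvd_of_mul_dvd_mul_right (by omega) h2)

/-- Orders divisible by `p` of elements of `PSU₄`. -/
lemma orderOf_dvd_of_dvd (hp : Odd p) (y : SU4 p m F hF ⧸ Subgroup.center (SU4 p m F hF))
    (hy : p ∣ orderOf y) : orderOf y ∣ (p ^ m + 1) * p ^ 2 ∨
      orderOf y ∣ (((p ^ m) ^ 2 - 1) / (if p ^ m % 4 = 1 then 2 else 4)) * p ^ 2 := by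
  have : CharP (AlgebraicClosure F) p :=
    charP_of_injective_algebraMap (algebraMap F (AlgebraicClosure F)).injective p
  obtain ⟨g, rfl⟩ := QuotientGroup.mk_surjective y
  obtain ⟨n, hn0, hn, hr⟩ := exists_coprime_exponent g
  have hp3 : 3 ≤ p := by
    have := (Fact.out : p.Prime).two_le
    obtain ⟨w, hw⟩ := hp
    omega
  by_cases hs : (closureMat g).charpoly.roots.Nodup
  · have h := mk_pow_eq_one (c := 1) (by rw [pow_eq_one_of_nodup hn0 hr hs, one_smul])
    exact absurd (hy.trans (orderOf_dvd_of_pow_eq_one h)) hn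
  · obtain ⟨e, c, hc, he⟩ := exists_exponent_of_not_nodup (q := p ^ m) hp.pow
      (card_roots_charpoly _)
      (by rw [← Matrix.det_eq_prod_roots_charpoly, det_closureMat])
      (fun x hx => roots_ne_zero (det_closureMat g) hx)
      (roots_map_unitary (closureMat_unitary g) (det_closureMat g)) hs
    have h := orderOf_dvd_of_pow_eq_one
      (mk_pow_eq_one (pow_pow_eq_smul_one (p := p) (e := 2) (by nlinarith) hc))
    rcases he with rfl | rfl
    exacts [Or.inl h, Or.inr h]

lemma orderOf_ne_eighteen (hp : p = 3) (y : SU4 p m F hF ⧸ Subgroup.center (SU4 p m F hF)) :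
    orderOf y ≠ 18 := by
  subst hp
  have : CharP (AlgebraicClosure F) 3 :=
    charP_of_injective_algebraMap (algebraMap F (AlgebraicClosure F)).injective 3
  obtain ⟨g, rfl⟩ := QuotientGroup.mk_surjective y
  obtain ⟨n, hn0, hn, hr⟩ := exists_coprime_exponent g
  intro hy
  by_cases hs : ∃ a ∈ (closureMat g).charpoly.roots, ∃ b ∈ (closureMat g).charpoly.roots, a ≠ b
  · obtain ⟨a, ha, b, hb, hab⟩ := hs
    have h := orderOf_dvd_of_pow_eq_one (mk_pow_eq_one (c := 1)
      (by rw [cube_pow_eq_one hn0 hr ha hb hab, one_smul]))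
    rw [hy] at h
    omega
  · push Not at hs
    obtain ⟨a, ha⟩ : ∃ a, a ∈ (closureMat g).charpoly.roots :=
      Multiset.card_pos_iff_exists_mem.mp (by rw [card_roots_charpoly]; omega)
    have h := orderOf_dvd_of_pow_eq_one (mk_pow_eq_one
      (pow_pow_eq_smul_one (p := 3) (e := 2) (n := 1) (c := a) (by omega)
      fun x hx => by rw [pow_one, hs x hx a ha]))
    rw [hy] at h
    omega

end ElementOrders

section SemidirectOrders

variable {L K W : Type*} [Group L] [Field K] [AddCommGroup W] [Module K W]
  (ρ : L →* (W ≃ₗ[K] W))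

/-- The element `(w, x)` of the semidirect product `W ⋊ L`. -/
def semiMk (w : W) (x : L) : SemidirectProduct (Multiplicative W) L (linToMulAut.comp ρ) :=
  ⟨Multiplicative.ofAdd w, x⟩

lemma semiMk_mul (w v : W) (x y : L) :
    semiMk ρ w x * semiMk ρ v y = semiMk ρ (w + ρ x v) (x * y) := rfl

lemma semiMk_pow (w : W) (x : L) (n : ℕ) :
    semiMk ρ w x ^ n = semiMk ρ (∑ i ∈ Finset.range n, ρ (x ^ i) w) (x ^ n) := by
  induction n with
  | zero => rw [pow_zero, pow_zero, Finset.sum_range_zero]; rfl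
  | succ n ih => rw [pow_succ, ih, semiMk_mul, Finset.sum_range_succ, pow_succ]

lemma semiMk_eq_one_iff (w : W) (x : L) : semiMk ρ w x = 1 ↔ w = 0 ∧ x = 1 := by
  rw [SemidirectProduct.ext_iff]
  rfl

lemma apply_pow_eq_self {ρ : L →* (W ≃ₗ[K] W)} {x : L} {w : W} (h : ρ x w = w) (i : ℕ) :
    ρ (x ^ i) w = w := by
  induction i with
  | zero => simp
  | succ i ih =>
    rw [pow_succ, map_mul]
    change ρ (x ^ i) (ρ x w) = w
    rw [h, ih]

variable {ρ}

/-- A fixed vector of `x` forces an element of order `lcm p |x|`. -/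
lemma exists_orderOf_eq_lcm
    (hω : elementOrders (SemidirectProduct (Multiplicative W) L (linToMulAut.comp ρ)) =
      elementOrders L)
    {p : ℕ} [CharP K p] {x : L} {w : W} (hw : w ≠ 0) (h : ρ x w = w) :
    ∃ y : L, orderOf y = p.lcm (orderOf x) := by
  suffices orderOf (semiMk ρ w x) = p.lcm (orderOf x) by
    rw [← this]
    exact hω.subset ⟨_, rfl⟩
  have key : ∀ n, semiMk ρ w x ^ n = 1 ↔ p.lcm (orderOf x) ∣ n := by
    intro n
    rw [semiMk_pow, semiMk_eq_one_iff, Finset.sum_congr rfl fun i _ => apply_pow_eq_self h i,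
      Finset.sum_const, Finset.card_range, ← Nat.cast_smul_eq_nsmul K, smul_eq_zero,
      or_iff_left hw, CharP.cast_eq_zero_iff K p, ← orderOf_dvd_iff_pow_eq_one, Nat.lcm_dvd_iff]
  refine Nat.dvd_antisymm (orderOf_dvd_of_pow_eq_one ((key _).mpr dvd_rfl)) ?_
  exact (key _).mp (pow_orderOf_eq_one _)

/-- If no element has order `p²`, then norms of elements of order `p` vanish. -/
lemma sum_range_eq_zero
    (hω : elementOrders (SemidirectProduct (Multiplicative W) L (linToMulAut.comp ρ)) =
      elementOrders L)
    {p : ℕ} [Fact p.Prime] [CharP K p] (hp : ∀ y : L, orderOf y ≠ p ^ 2)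
    {x : L} (hx : x ^ p = 1) (w : W) : ∑ i ∈ Finset.range p, ρ (x ^ i) w = 0 := by
  by_contra hS
  have h : orderOf (semiMk ρ w x) = p ^ 2 := by
    have h1 := semiMk_pow ρ w x p
    rw [hx] at h1
    refine orderOf_eq_prime_pow (n := 1) ?_ ?_
    · rw [pow_one, h1, semiMk_eq_one_iff]
      exact fun h => hS h.1
    · rw [pow_two, pow_mul, h1, semiMk_pow, semiMk_eq_one_iff]
      refine ⟨?_, one_pow p⟩
      simp only [one_pow, map_one]
      change ∑ _i ∈ Finset.range p, (∑ i ∈ Finset.range p, ρ (x ^ i) w) = 0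
      rw [Finset.sum_const, Finset.card_range, ← Nat.cast_smul_eq_nsmul K, CharP.cast_eq_zero,
        zero_smul]
  obtain ⟨y, hy⟩ : p ^ 2 ∈ elementOrders L := hω.subset ⟨_, h⟩
  exact hp y hy

lemma sum_range_three_eq_zero
    (hω : elementOrders (SemidirectProduct (Multiplicative W) L (linToMulAut.comp ρ)) =
      elementOrders L)
    [CharP K 3] (hL : ∀ y : L, orderOf y ≠ 18)
    {x j : L} (hx : x ^ 3 = 1) (hj : j ^ 2 = 1) (hj1 : j ≠ 1) (hc : Commute x j) {w : W}
    (hw : ρ j w = w) : ∑ i ∈ Finset.range 3, ρ (x ^ i) w = 0 := by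
  by_contra hS
  have hpow : ∀ n, semiMk ρ w (x * j) ^ n =
      semiMk ρ (∑ i ∈ Finset.range n, ρ (x ^ i) w) (x ^ n * j ^ n) := by
    intro n
    rw [semiMk_pow, hc.mul_pow]
    congr 1
    refine Finset.sum_congr rfl fun i _ => ?_
    rw [hc.mul_pow, map_mul]
    change ρ (x ^ i) (ρ (j ^ i) w) = _
    rw [apply_pow_eq_self hw]
  have hmul : ∀ n, ∑ i ∈ Finset.range (3 * n), ρ (x ^ i) w =
      n • ∑ i ∈ Finset.range 3, ρ (x ^ i) w := by
    intro n
    induction n with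
    | zero => simp
    | succ n ih =>
      rw [mul_add, mul_one, Finset.sum_range_add, ih, succ_nsmul]
      congr 1
      refine Finset.sum_congr rfl fun i _ => ?_
      rw [pow_add, pow_mul, hx, one_pow, one_mul]
  have h : orderOf (semiMk ρ w (x * j)) = 18 := by
    refine orderOf_eq_of_pow_and_pow_div_prime (by norm_num) ?_ ?_
    · rw [hpow, semiMk_eq_one_iff, show (18 : ℕ) = 3 * 6 from rfl, hmul, pow_mul x, hx]
      refine ⟨?_, by rw [show 3 * 6 = 2 * 9 from rfl, pow_mul, hj]; simp⟩
      rw [← Nat.cast_smul_eq_nsmul K, (CharP.cast_eq_zero_iff K 3 6).mpr (by norm_num), zero_smul]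
    · intro r hr hr18
      have : r = 2 ∨ r = 3 := by
        have : r ∣ 2 * 3 ^ 2 := by simpa using hr18
        rcases (Nat.Prime.dvd_mul hr).mp this with h | h
        · exact Or.inl ((Nat.prime_dvd_prime_iff_eq hr Nat.prime_two).mp h)
        · exact Or.inr ((Nat.prime_dvd_prime_iff_eq hr Nat.prime_three).mp
            (hr.dvd_of_dvd_pow h))
      rcases this with rfl | rfl
      · rw [hpow, Ne, semiMk_eq_one_iff]
        rintro ⟨-, h⟩
        apply hj1
        rwa [show 18 / 2 = 3 * 3 from rfl, pow_mul x, hx, one_pow, one_mul,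
          show 3 * 3 = 2 * 4 + 1 from rfl, pow_succ, pow_mul, hj, one_pow, one_mul] at h
      · rw [hpow, Ne, semiMk_eq_one_iff]
        rintro ⟨h, -⟩
        rw [show 18 / 3 = 3 * 2 from rfl, hmul, ← Nat.cast_smul_eq_nsmul K, smul_eq_zero] at h
        refine h.elim (fun h => ?_) hS
        rw [CharP.cast_eq_zero_iff K 3 2] at h
        omega
  obtain ⟨y, hy⟩ : 18 ∈ elementOrders L := hω.subset ⟨_, h⟩
  exact hL y hy

end SemidirectOrders

section RegularElement

lemma coe_sl_injective {n R : Type*} [DecidableEq n] [Fintype n] [CommRing R] :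
    Function.Injective fun A : SpecialLinearGroup n R => (A : Matrix n n R) :=
  fun _ _ h => Subtype.ext h

lemma mul_self_eq_of_det_eq_one {F : Type*} [Field F] (M : Matrix (Fin 2) (Fin 2) F)
    (h : M.det = 1) : M * M = M.trace • M - 1 := by
  rw [Matrix.det_fin_two] at h
  ext i l
  fin_cases i <;> fin_cases l <;>
    simp [Matrix.mul_apply, Fin.sum_univ_two, Matrix.trace_fin_two] <;>
    first | ring1 | linear_combination -h

/-- Powers of a unimodular `2 × 2` matrix are linear in it, with coefficients depending only on
the trace. -/
lemma exists_pow_eq_linear {F : Type*} [Field F] (θ : F) (n : ℕ) : ∃ a b : F,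
    ∀ M : Matrix (Fin 2) (Fin 2) F, M * M = θ • M - 1 → M ^ n = a • M + b • 1 := by
  induction n with
  | zero => exact ⟨0, 1, fun M _ => by simp⟩
  | succ n ih =>
    obtain ⟨a, b, h⟩ := ih
    refine ⟨a * θ + b, -a, fun M hM => ?_⟩
    rw [pow_succ, h M hM, add_mul, smul_mul_assoc, hM, smul_mul_assoc, one_mul]
    module

lemma exists_odd_prime_dvd_sq_add_one {q : ℕ} (hq : Odd q) (hq1 : 1 < q) :
    ∃ r, r.Prime ∧ r ∣ q ^ 2 + 1 ∧ r ≠ 2 := by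
  obtain ⟨w, rfl⟩ := hq
  refine ⟨(2 * w * (w + 1) + 1).minFac, Nat.minFac_prime (by
    have hw : 0 < w := by omega
    have : 0 < 2 * w * (w + 1) := by positivity
    omega), ?_, ?_⟩
  · exact (Nat.minFac_dvd _).trans ⟨2, by ring⟩
  · intro h
    have := h ▸ Nat.minFac_dvd (2 * w * (w + 1) + 1)
    rw [mul_assoc] at this
    omega

/-- An element of prime order `r ∣ |F| + 1` in `SL₂(F)` inverted by `slW`. -/
lemma exists_regular {p : ℕ} [Fact p.Prime] {F : Type*} [Field F] [Fintype F] [CharP F p]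
    {r : ℕ} (hr : r.Prime) (hr2 : r ≠ 2) (hrF : r ∣ Fintype.card F + 1) (hodd : Odd p) :
    ∃ t : SpecialLinearGroup (Fin 2) F, t ^ r = 1 ∧ t ≠ 1 ∧ slW * t = t⁻¹ * slW := by
  classical
  have : Fact r.Prime := ⟨hr⟩
  set Q := Fintype.card F with hQ
  have hQ1 : 1 < Q := Fintype.one_lt_card
  have hpQ : p ∣ Q := by
    obtain ⟨n, hn, h⟩ := FiniteField.card F p
    rw [hQ, h]
    exact dvd_pow_self p n.ne_zero
  have hrp : r ≠ p := by
    rintro rfl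
    exact hr.one_lt.ne' (Nat.dvd_one.mp ((Nat.dvd_add_right hpQ).mp hrF))
  have hcard : r ∣ Nat.card (GL (Fin 2) F) := by
    rw [Matrix.card_GL_field]
    simp only [Fin.prod_univ_two]
    refine Dvd.dvd.mul_right (hrF.trans ⟨Q - 1, ?_⟩) _
    simp only [Fin.val_zero, pow_zero]
    rw [← hQ, ← Nat.sq_sub_sq, one_pow]
  obtain ⟨g, hg⟩ := exists_prime_orderOf_dvd_card' r hcard
  have hgr : g ^ r = 1 := by rw [← hg]; exact pow_orderOf_eq_one g
  have hg1 : g ≠ 1 := by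
    rintro rfl
    rw [orderOf_one] at hg
    exact hr.one_lt.ne hg
  set M : Matrix (Fin 2) (Fin 2) F := g.1 with hM
  have hMr : M ^ r = 1 := by
    have := congrArg Units.val hgr
    simpa using this
  have hdet : M.det = 1 := by
    have h1 : M.det ^ r = 1 := by rw [← det_pow, hMr, det_one]
    have h2 : M.det ^ (Q - 1) = 1 := FiniteField.pow_card_sub_one_eq_one _ (by
      intro h
      rw [h, zero_pow hr.ne_zero] at h1
      exact zero_ne_one h1)
    have hc : Nat.Coprime r (Q - 1) := by
      rw [hr.coprime_iff_not_dvd]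
      intro h
      have : r ∣ 2 := by
        have := Nat.dvd_sub hrF h
        rwa [show Q + 1 - (Q - 1) = 2 by omega] at this
      exact hr2 ((Nat.prime_dvd_prime_iff_eq hr Nat.prime_two).mp this)
    have := pow_gcd_eq_one.mpr ⟨h1, h2⟩
    rwa [hc, pow_one] at this
  set θ := M.trace with hθ
  have hMM : M * M = θ • M - 1 := mul_self_eq_of_det_eq_one M hdet
  obtain ⟨α, β, hαβ⟩ := exists_pow_eq_linear θ r
  have hα : α = 0 := by
    by_contra hα
    have h3 := (hαβ M hMM).symm.trans hMr
    have h4 : M = ((1 - β) / α) • 1 := by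
      have : α • M = (1 - β) • (1 : Matrix (Fin 2) (Fin 2) F) := by
        rw [sub_smul, one_smul, eq_sub_iff_add_eq]; exact h3
      rw [div_eq_inv_mul, mul_smul, ← this, smul_smul, inv_mul_cancel₀ hα, one_smul]
    set s := (1 - β) / α
    have h5 : s ^ 2 = 1 := by
      rw [h4, det_smul, det_one, mul_one, Fintype.card_fin] at hdet
      exact hdet
    have h6 : s ^ r = 1 := by
      rw [h4, smul_pow, one_pow] at hMr
      simpa using congrFun (congrFun hMr 0) 0
    have hc : Nat.Coprime 2 r := (Nat.coprime_primes Nat.prime_two hr).mpr hr2.symm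
    have h7 := pow_gcd_eq_one.mpr ⟨h5, h6⟩
    rw [hc, pow_one] at h7
    rw [h7, one_smul] at h4
    exact hg1 (Units.ext h4)
  have hβ : β = 1 := by
    have h3 := (hαβ M hMM).symm.trans hMr
    rw [hα, zero_smul, zero_add] at h3
    simpa using congrFun (congrFun h3 0) 0
  have hθ2 : θ ≠ 2 := by
    intro h
    have h3 : (M - 1) ^ 2 = 0 := by
      rw [pow_two, sub_mul, mul_sub, hMM, h, mul_one, one_mul, two_smul]
      abel
    have h4 : (M - 1) ^ p = 0 := pow_eq_zero_of_le (Fact.out : p.Prime).two_le h3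
    rw [sub_pow_char_of_commute p (Commute.one_right _), one_pow, sub_eq_zero] at h4
    have hc : Nat.Coprime r p := (Nat.coprime_primes hr Fact.out).mpr hrp
    have h5 : g ^ p = 1 := Units.ext (by simpa using h4)
    have h7 := pow_gcd_eq_one.mpr ⟨hgr, h5⟩
    rw [hc, pow_one] at h7
    exact hg1 h7
  obtain ⟨a, b, hab⟩ := FiniteField.exists_root_sum_quadratic
    (f := Polynomial.X ^ 2 - Polynomial.C θ * Polynomial.X + 1) (g := Polynomial.X ^ 2)
    (by compute_degree!) (by compute_degree!)
    (by
      rw [FiniteField.card F p |>.choose_spec.2]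
      exact Nat.odd_iff.mp hodd.pow)
  simp only [Polynomial.eval_add, Polynomial.eval_sub, Polynomial.eval_mul, Polynomial.eval_pow,
    Polynomial.eval_X, Polynomial.eval_C, Polynomial.eval_one] at hab
  have htdet : (!![a, b; b, θ - a] : Matrix (Fin 2) (Fin 2) F).det = 1 := by
    rw [Matrix.det_fin_two_of]
    linear_combination -hab
  obtain ⟨t, ht⟩ : ∃ t : SpecialLinearGroup (Fin 2) F,
      (t : Matrix (Fin 2) (Fin 2) F) = !![a, b; b, θ - a] := ⟨⟨_, htdet⟩, rfl⟩
  refine ⟨t, ?_, ?_, ?_⟩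
  · have h3 := mul_self_eq_of_det_eq_one _ htdet
    rw [Matrix.trace_fin_two_of, add_sub_cancel] at h3
    have h4 := hαβ _ h3
    rw [hα, hβ, zero_smul, zero_add, one_smul, ← ht] at h4
    refine coe_sl_injective ?_
    exact (Matrix.SpecialLinearGroup.coe_pow t r).trans h4
  · intro h
    have h3 : (1 : Matrix (Fin 2) (Fin 2) F).trace = _ := congrArg Matrix.trace (h ▸ ht)
    rw [Matrix.trace_fin_two_of, Matrix.trace_one, Fintype.card_fin, add_sub_cancel] at h3
    exact hθ2 (by simpa using h3.symm)
  · rw [eq_inv_mul_iff_mul_eq]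
    refine coe_sl_injective ?_
    change (t : Matrix (Fin 2) (Fin 2) F) * ((slW : SpecialLinearGroup (Fin 2) F) * t) =
      (slW : SpecialLinearGroup (Fin 2) F)
    rw [ht, coe_slW]
    ext i l
    fin_cases i <;> fin_cases l <;> simp [Matrix.mul_apply, Fin.sum_univ_two] <;>
      first | ring1 | linear_combination hab | linear_combination -hab

end RegularElement

section Generation

variable {k : Type*} [Field k]

lemma slX_mul_slY_mul_slX_eq (g : SpecialLinearGroup (Fin 2) k)
    (hc : (g : Matrix (Fin 2) (Fin 2) k) 1 0 ≠ 0) :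
    slX (((g : Matrix (Fin 2) (Fin 2) k) 0 0 - 1) / (g : Matrix (Fin 2) (Fin 2) k) 1 0) *
      slY ((g : Matrix (Fin 2) (Fin 2) k) 1 0) *
      slX (((g : Matrix (Fin 2) (Fin 2) k) 1 1 - 1) / (g : Matrix (Fin 2) (Fin 2) k) 1 0) = g := by
  have hdet := g.det_coe
  rw [Matrix.det_fin_two] at hdet
  refine coe_sl_injective ?_
  change ((slX _ : SpecialLinearGroup (Fin 2) k) : Matrix (Fin 2) (Fin 2) k) *
    (slY _ : SpecialLinearGroup (Fin 2) k) * (slX _ : SpecialLinearGroup (Fin 2) k) = g.1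
  rw [coe_slX, coe_slY, coe_slX]
  ext i l
  fin_cases i <;> fin_cases l <;> simp [Matrix.mul_apply, Fin.sum_univ_two] <;> field_simp <;>
    first | ring1 | linear_combination hdet

/-- `SL₂` over a field is generated by its elementary unipotent matrices. -/
lemma sl_mem_of_slX_slY {S : Submonoid (SpecialLinearGroup (Fin 2) k)} (hx : ∀ a, slX a ∈ S)
    (hy : ∀ c, slY c ∈ S) (g : SpecialLinearGroup (Fin 2) k) : g ∈ S := by
  have key : ∀ g : SpecialLinearGroup (Fin 2) k, (g : Matrix (Fin 2) (Fin 2) k) 1 0 ≠ 0 → g ∈ S :=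
    fun g hg => slX_mul_slY_mul_slX_eq g hg ▸ S.mul_mem (S.mul_mem (hx _) (hy _)) (hx _)
  by_cases hc : (g : Matrix (Fin 2) (Fin 2) k) 1 0 = 0
  · have hdet := g.det_coe
    rw [Matrix.det_fin_two, hc, mul_zero, sub_zero] at hdet
    have h1 : slY 1 * g ∈ S := by
      refine key _ ?_
      change (((slY 1 : SpecialLinearGroup (Fin 2) k) : Matrix (Fin 2) (Fin 2) k) *
        (g : Matrix (Fin 2) (Fin 2) k)) 1 0 ≠ 0
      rw [coe_slY]
      simp [Matrix.mul_apply, Fin.sum_univ_two, hc]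
      exact left_ne_zero_of_mul_eq_one hdet
    have h2 : g = slY (-1) * (slY 1 * g) := by
      rw [← mul_assoc, ← slY_add, neg_add_cancel, slY_zero, one_mul]
    rw [h2]
    exact S.mul_mem (hy _) h1
  · exact key g hc

end Generation

section Restriction

/-- An element of `isoU` some power of which is scalar, with the exponent restricted as for
elements of `PSU₄` of order prime to `p` commuting with an element of order `p`. -/
def OrderRestricted {p m : ℕ} [Fact p.Prime] {F : Type*} [Field F] [CharP F p] {κ : F}
    (g : isoU p m κ) : Prop :=
  ∃ (N : ℕ) (c : F), 0 < N ∧ isoMat g ^ N = c • 1 ∧ (N ∣ (p ^ m + 1) * p ^ 2 ∨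
    N ∣ (((p ^ m) ^ 2 - 1) / (if p ^ m % 4 = 1 then 2 else 4)) * p ^ 2)

variable {p m : ℕ} [Fact p.Prime] {F : Type*} [Field F] [CharP F p] {κ : F}

lemma dvd_sq_sub_one_mul {q N P : ℕ} (hq : Odd q) (h : N ∣ (q + 1) * P ∨
    N ∣ ((q ^ 2 - 1) / (if q % 4 = 1 then 2 else 4)) * P) : N ∣ (q ^ 2 - 1) * P := by
  have h8 : 8 ∣ q ^ 2 - 1 := Nat.eight_dvd_sq_sub_one_of_odd hq
  rcases h with h | h
  · refine h.trans (Nat.mul_dvd_mul_right ⟨q - 1, ?_⟩ P)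
    rw [← Nat.sq_sub_sq, one_pow]
  · refine h.trans (Nat.mul_dvd_mul_right (Nat.div_dvd_of_dvd ?_) P)
    split_ifs <;> omega

/-- Levi elements of prime order dividing `q² + 1` have unrestricted order. -/
lemma not_orderRestricted_levi (hp : Odd p)
    (hσ : ∀ a : F, iterateFrobenius F p m (iterateFrobenius F p m a) = a)
    {r : ℕ} (hr : r.Prime) (hr2 : r ≠ 2) (hrq : r ∣ (p ^ m) ^ 2 + 1)
    {t : SpecialLinearGroup (Fin 2) F} (ht : t ^ r = 1) (ht1 : t ≠ 1) (hm : m ≠ 0) :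
    ¬ OrderRestricted (leviHom p m κ hσ t) := by
  rintro ⟨N, c, hN0, hN, hdvd⟩
  rw [← isoMat_pow, ← map_pow, mat_leviHom] at hN
  have hdet := (t ^ N).det_coe
  rw [Matrix.det_fin_two] at hdet
  have h00 : (t ^ N : SpecialLinearGroup (Fin 2) F) 0 0 = c := by
    simpa [leviMat] using congrFun (congrFun hN 0) 0
  have h01 : (t ^ N : SpecialLinearGroup (Fin 2) F) 0 1 = 0 := by
    simpa [leviMat] using congrFun (congrFun hN 0) 1
  have h10 : (t ^ N : SpecialLinearGroup (Fin 2) F) 1 0 = 0 := by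
    simpa [leviMat] using congrFun (congrFun hN 1) 0
  have h11 : (t ^ N : SpecialLinearGroup (Fin 2) F) 1 1 = c := by
    simpa [leviMat] using congrFun (congrFun hN 1) 1
  rw [h00, h01, h10, h11] at hdet
  have hc1 : ((t ^ N : SpecialLinearGroup (Fin 2) F) : Matrix (Fin 2) (Fin 2) F) = c • 1 := by
    ext i l
    fin_cases i <;> fin_cases l
    · simpa using h00
    · simpa using h01
    · simpa using h10
    · simpa using h11
  have h2 : t ^ (N * 2) = 1 := by
    rw [pow_mul, pow_two]
    refine coe_sl_injective ?_
    change ((t ^ N : SpecialLinearGroup (Fin 2) F) : Matrix (Fin 2) (Fin 2) F) *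
      ((t ^ N : SpecialLinearGroup (Fin 2) F) : Matrix (Fin 2) (Fin 2) F) = 1
    rw [hc1, smul_mul_smul_comm, one_mul, show c * c = 1 by linear_combination hdet, one_smul]
  have hrN : r ∣ N := by
    by_contra h
    have hc : Nat.Coprime r (N * 2) := by
      refine Nat.Coprime.mul_right ((hr.coprime_iff_not_dvd).mpr h) ?_
      exact (Nat.coprime_primes hr Nat.prime_two).mpr hr2
    have := pow_gcd_eq_one.mpr ⟨ht, h2⟩
    rw [hc, pow_one] at this
    exact ht1 this
  have h3 := hrN.trans (dvd_sq_sub_one_mul hp.pow hdvd)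
  have hq1 : 0 < (p ^ m) ^ 2 := by have := (Fact.out : p.Prime).pos; positivity
  rcases hr.dvd_mul.mp h3 with h | h
  · have : r ∣ 2 := by
      have := Nat.dvd_sub hrq h
      rwa [show (p ^ m) ^ 2 + 1 - ((p ^ m) ^ 2 - 1) = 2 by omega] at this
    exact hr2 ((Nat.prime_dvd_prime_iff_eq hr Nat.prime_two).mp this)
  · have h4 := hr.dvd_of_dvd_pow h
    rw [(Nat.prime_dvd_prime_iff_eq hr Fact.out).mp h4] at hrq
    have h5 : p ∣ (p ^ m) ^ 2 := dvd_pow (dvd_pow_self p hm) two_ne_zero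
    exact (Fact.out : p.Prime).one_lt.ne' (Nat.dvd_one.mp ((Nat.dvd_add_right h5).mp hrq))

end Restriction

section CharThree

/-- Restriction of a representation to an invariant subspace. -/
def restrictRep {G K V : Type*} [Monoid G] [Field K] [AddCommGroup V] [Module K V]
    (π : G →* Module.End K V) (X : Submodule K V) (hX : ∀ g, ∀ v ∈ X, π g v ∈ X) :
    G →* Module.End K X where
  toFun g := (π g).restrict (hX g)
  map_one' := by ext v; simp
  map_mul' g h := by ext v; simp

lemma coe_restrictRep {G K V : Type*} [Monoid G] [Field K] [AddCommGroup V] [Module K V]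
    (π : G →* Module.End K V) (X : Submodule K V) (hX : ∀ g, ∀ v ∈ X, π g v ∈ X) (g : G) (v : X) :
    (restrictRep π X hX g v : V) = π g v := rfl

lemma add_self_eq_zero_of_quadratic {R : Type*} [Ring R] (h3 : ∀ x : R, x + x + x = 0) {e f : R}
    (he : e * e = 0) (hf : f * f = 0)
    (hd : (f - e - e * f) * (f - e - e * f) = 0)
    (hw : ((1 - e) * (1 + f) * (1 - e)) * ((1 - e) * (1 + f) * (1 - e)) = 1) :
    (1 - e) * (1 + f) * (1 - e) = 1 := by
  have hd' : e * f * e + e * f * e * f = e * f + f * e + f * e * f := by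
    have : (f - e - e * f) * (f - e - e * f) = f * f - f * e - f * e * f - e * f + e * e
        + e * e * f - e * (f * f) + e * f * e + e * f * e * f := by noncomm_ring
    rw [this, hf, he] at hd
    rw [← sub_eq_zero, ← hd]
    noncomm_ring
  have h1 : e * f * e * f = 0 := by
    have h2 : f * e * f = e * f * e * f := by
      have := congrArg (· * f) hd'
      simp only [add_mul, mul_assoc, hf, mul_zero, zero_add, add_zero] at this
      simp only [mul_assoc]
      exact this.symm
    have := congrArg (e * ·) h2
    simp only [← mul_assoc, he, zero_mul] at this
    exact this
  have h2 : f * e * f = 0 := by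
    have := congrArg (· * f) hd'
    simp only [add_mul, mul_assoc, hf, mul_zero, zero_add, add_zero] at this
    rw [mul_assoc, ← this]
    simpa only [mul_assoc] using h1
  have h4 : e * f * e = 0 := by
    have := congrArg (e * ·) hd'
    simp only [mul_add, ← mul_assoc, he, zero_mul, zero_add] at this
    rw [h1, add_zero] at this
    exact this.symm
  have h5 : e * f + f * e = 0 := by
    rw [h4, zero_mul, h2] at hd'
    simpa using hd'.symm
  have h6 : (1 - e) * (1 + f) * (1 - e) = 1 + (e + f) := by
    have : (1 - e) * (1 + f) * (1 - e) = 1 + (e + f) - (e + e + e) - (e * f + f * e) + e * e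
        + e * f * e := by noncomm_ring
    rw [this, h3, h5, he, h4]
    noncomm_ring
  rw [h6] at hw ⊢
  have h7 : (1 + (e + f)) * (1 + (e + f)) = 1 + (e + f) + (e + f) + (e * e + f * f
      + (e * f + f * e)) := by noncomm_ring
  rw [h7, he, hf, h5, add_zero, add_zero, add_zero, add_assoc, add_eq_left] at hw
  have h8 := h3 (e + f)
  rw [hw, zero_add] at h8
  rw [h8, add_zero]

/-- If elements of order three act quadratically and `-1` acts trivially then `slW` acts
trivially. -/
lemma slW_eq_one_of_quadratic {K V : Type*} [Field K] [CharP K 3] [AddCommGroup V] [Module K V]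
    (π : SpecialLinearGroup (Fin 2) (ZMod 3) →* Module.End K V)
    (h : ∀ a, a ^ 3 = 1 → 1 + π a + π a * π a = 0) (hm : π (-1) = 1) : π slW = 1 := by
  have h3 : ∀ x : Module.End K V, x + x + x = 0 := by
    intro x
    have : (3 : K) • x = 0 := by
      rw [show (3 : K) = ((3 : ℕ) : K) by norm_num, CharP.cast_eq_zero, zero_smul]
    rw [← this]
    module
  have hq : ∀ a, a ^ 3 = 1 → (π a - 1) * (π a - 1) = 0 := by
    intro a ha
    have e : (π a - 1) * (π a - 1) = (1 + π a + π a * π a) - (π a + π a + π a) := by noncomm_ring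
    rw [e, h a ha, h3, sub_zero]
  set e := π (slX 1) - 1 with he
  set f := π (slY 1) - 1 with hf
  have he2 : e * e = 0 := hq _ (by decide)
  have hf2 : f * f = 0 := hq _ (by decide)
  have hX : π (slX (-1)) = 1 - e := by
    have h1 : π (slX (-1)) = π (slX 1) * π (slX 1) := by
      rw [← map_mul]; congr 1; decide
    have h2 : π (slX 1) = 1 + e := by rw [he]; abel
    have h4 : (1 + e) * (1 + e) = 1 - e + (e + e + e) + e * e := by noncomm_ring
    rw [h1, h2, h4, h3, he2, add_zero, add_zero]
  have hY : π (slY 1) = 1 + f := by rw [hf]; abel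
  have hW : π slW = (1 - e) * (1 + f) * (1 - e) := by
    rw [← hX, ← hY, ← map_mul, ← map_mul]; congr 1; decide
  have hd : (f - e - e * f) * (f - e - e * f) = 0 := by
    have h1 := hq (-1 * (slX (-1) * slY 1)) (by decide)
    rw [map_mul, hm, one_mul, map_mul, hX, hY] at h1
    rw [← h1]
    noncomm_ring
  rw [hW]
  refine add_self_eq_zero_of_quadratic h3 he2 hf2 hd ?_
  rw [← hW, ← map_mul, ← hm]
  congr 1; decide

end CharThree

section CharThreeCase

/-- A dimension count: an involution `D` whose fixed space lies in that of `Y` has no fixed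
vectors, provided `T` swaps the two eigenspaces of `Y`, and `n` is a square root of `D`. -/
lemma eq_zero_of_anticommute {K V : Type*} [Field K] [AddCommGroup V] [Module K V]
    [FiniteDimensional K V] (h2 : (2 : K) ≠ 0) {D Y n T : Module.End K V} (hD : D * D = 1)
    (hDY : D * Y = Y * D) (hX : ∀ v, D v = v → Y v = v)
    (hn : n * n = D) (hnY : n * Y = D * Y * n) (hT : ∀ v, T v = 0 → v = 0)
    (hTY : T * Y = -(Y * T)) {v : V} (hv : D v = v) : v = 0 := by
  have dbl : ∀ x : V, x + x = 0 → x = 0 := fun x hx =>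
    (smul_eq_zero.mp (show (2 : K) • x = 0 by rw [two_smul, hx])).resolve_left h2
  have hDD : ∀ x, D (D x) = x := fun x => LinearMap.congr_fun hD x
  have hDY' : ∀ x, D (Y x) = Y (D x) := fun x => LinearMap.congr_fun hDY x
  have hnn : ∀ x, n (n x) = D x := fun x => LinearMap.congr_fun hn x
  have hnD : ∀ x, n (D x) = D (n x) := fun x => by rw [← hnn, hnn (n x)]
  have hnY' : ∀ x, n (Y x) = D (Y (n x)) := fun x => LinearMap.congr_fun hnY x
  have hTY' : ∀ x, T (Y x) = -Y (T x) := fun x => LinearMap.congr_fun hTY x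
  have hninj : ∀ x, n x = 0 → x = 0 := fun x hx => by
    rw [← hDD x, ← hnn x, hx, map_zero, map_zero]
  set X := LinearMap.ker (D - 1)
  set P := LinearMap.ker (Y - 1)
  set M := LinearMap.ker (Y + 1)
  have memX : ∀ x, x ∈ X ↔ D x = x := fun x => by
    rw [LinearMap.mem_ker, LinearMap.sub_apply, sub_eq_zero]; rfl
  have memP : ∀ x, x ∈ P ↔ Y x = x := fun x => by
    rw [LinearMap.mem_ker, LinearMap.sub_apply, sub_eq_zero]; rfl
  have memM : ∀ x, x ∈ M ↔ Y x = -x := fun x => by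
    rw [LinearMap.mem_ker, LinearMap.add_apply, add_eq_zero_iff_eq_neg]; rfl
  have hMD : ∀ x ∈ M, D x = -x := by
    intro x hx
    rw [memM] at hx
    have h1 := hX (x + D x) (by rw [map_add, hDD, add_comm])
    rw [map_add, ← hDY', hx, map_neg, ← neg_add] at h1
    have h3 := dbl (x + D x) (by nth_rw 1 [← h1]; exact neg_add_cancel _)
    exact eq_neg_of_add_eq_zero_right h3
  have hMP : ∀ x ∈ M, n x ∈ P := by
    intro x hx
    have h1 := hnY' x
    rw [(memM x).mp hx, map_neg] at h1
    rw [memP, ← hDD (Y (n x)), ← h1, map_neg, ← hnD, hMD x hx, map_neg, neg_neg]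
  have hXP : X ≤ P := fun x hx => (memP x).mpr (hX x ((memX x).mp hx))
  have hPM : ∀ x ∈ P, T x ∈ M := by
    intro x hx
    have h1 := hTY' x
    rw [(memP x).mp hx] at h1
    rw [memM, eq_comm, neg_eq_iff_eq_neg]
    exact h1
  let f : (X × M) →ₗ[K] P := LinearMap.coprod (Submodule.inclusion hXP) (n.restrict hMP)
  have hf : Function.Injective f := by
    rw [injective_iff_map_eq_zero]
    rintro ⟨⟨x, hx⟩, ⟨y, hy⟩⟩ h
    have h1 : x + n y = 0 := congrArg Subtype.val h
    have h3 := congrArg D h1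
    rw [map_add, (memX x).mp hx, ← hnD, hMD y hy, map_neg, map_zero] at h3
    have h4 : x = 0 := dbl x (by
      have : x + x = (x + n y) + (x + -n y) := by abel
      rw [this, h1, h3, add_zero])
    rw [h4, zero_add] at h1
    have h5 := hninj y h1
    subst h4 h5
    rfl
  let g : P →ₗ[K] M := T.restrict hPM
  have hg : Function.Injective g := by
    rw [injective_iff_map_eq_zero]
    rintro ⟨x, hx⟩ h
    exact Subtype.ext (hT x (congrArg Subtype.val h))
  have h1 := LinearMap.finrank_le_finrank_of_injective hf
  have h3 := LinearMap.finrank_le_finrank_of_injective hg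
  rw [Module.finrank_prod] at h1
  have h4 : Module.finrank K X = 0 := by omega
  rw [Submodule.finrank_eq_zero] at h4
  have h5 : v ∈ X := (memX v).mpr hv
  rwa [h4, Submodule.mem_bot] at h5

variable {m : ℕ} {F : Type*} [Field F] [CharP F 3] {κ : F}

/-- In characteristic three, an isometry conjugating a Levi element into the product of the outer
and inner subgroups. -/
def conjMat (F : Type*) [Field F] : Matrix (Fin 4) (Fin 4) F :=
  !![1, 1, 0, 0; 0, 0, -1, 1; 1, -1, 0, 0; 0, 0, -1, -1]

lemma three_eq_zero : (3 : F) = 0 := by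
  have := CharP.cast_eq_zero F 3
  exact_mod_cast this

lemma det_conjMat : (conjMat F).det = 1 := by
  have h3 := three_eq_zero (F := F)
  simp [conjMat, Matrix.det_succ_row_zero, Fin.sum_univ_succ, Fin.succAbove]
  linear_combination h3

lemma conjMat_form [Fact (Nat.Prime 3)] : ((conjMat F).map (iterateFrobenius F 3 m))ᵀ * gramJ κ *
    conjMat F = gramJ κ := by
  have h3 := three_eq_zero (F := F)
  ext i l; fin_cases i <;> fin_cases l <;>
    simp [conjMat, gramJ, Matrix.mul_apply, Fin.sum_univ_four] <;>
    first | ring1 | linear_combination κ * h3 | linear_combination -κ * h3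

/-- Commutation of the outer and inner subgroups. -/
lemma commute_outerHom_innerHom {p : ℕ} [Fact p.Prime] {F : Type*} [Field F] [CharP F p] {κ : F}
    {k : Type*} [Field k] (j : k →+* F)
    (hj : ∀ a, iterateFrobenius F p m (j a) = j a) (g h) :
    Commute (outerHom p m κ j hj g) (innerHom p m κ j hj h) := by
  refine isoMat_injective ?_
  rw [isoMat_mul, isoMat_mul, mat_outerHom, mat_innerHom]
  ext i l; fin_cases i <;> fin_cases l <;>
    simp [outerMat, innerMat, Matrix.mul_apply, Fin.sum_univ_four]

lemma outerHom_mul_innerHom_neg_one {p : ℕ} [Fact p.Prime] {F : Type*} [Field F] [CharP F p]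
    {κ : F} {k : Type*} [Field k] (j : k →+* F)
    (hj : ∀ a, iterateFrobenius F p m (j a) = j a) :
    isoMat (outerHom p m κ j hj (-1) * innerHom p m κ j hj (-1)) = (-1 : F) • 1 := by
  rw [isoMat_mul, mat_outerHom, mat_innerHom]
  ext i l; fin_cases i <;> fin_cases l <;>
    simp [outerMat, innerMat, Matrix.mul_apply, Fin.sum_univ_four]

lemma not_scalar_outerHom_neg_one {p : ℕ} [Fact p.Prime] {F : Type*} [Field F] [CharP F p]
    {κ : F} {k : Type*} [Field k] (j : k →+* F) (h2 : (2 : F) ≠ 0)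
    (hj : ∀ a, iterateFrobenius F p m (j a) = j a) :
    ¬ ∃ c : F, isoMat (outerHom p m κ j hj (-1)) = c • 1 := by
  rintro ⟨c, hc⟩
  rw [mat_outerHom] at hc
  have h00 := congrFun (congrFun hc 0) 0
  have h11 := congrFun (congrFun hc 1) 1
  simp [outerMat] at h00 h11
  exact h2 (by linear_combination h11 - h00)

lemma outerHom_neg_one_mul_leviHom_slX {p : ℕ} [Fact p.Prime] {F : Type*} [Field F] [CharP F p]
    {κ : F} {k : Type*} [Field k] (j : k →+* F)
    (hj : ∀ a, iterateFrobenius F p m (j a) = j a)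
    (hσ : ∀ a : F, iterateFrobenius F p m (iterateFrobenius F p m a) = a) (a : F) :
    outerHom p m κ j hj (-1) * leviHom p m κ hσ (slX a) =
      leviHom p m κ hσ (slX a)⁻¹ * outerHom p m κ j hj (-1) := by
  refine isoMat_injective ?_
  rw [isoMat_mul, isoMat_mul, mat_leviHom, mat_leviHom, mat_outerHom,
    Matrix.SpecialLinearGroup.coe_inv, coe_slX, adjugate_fin_two]
  ext i l; fin_cases i <;> fin_cases l <;>
    simp [leviMat, outerMat, Matrix.mul_apply, Fin.sum_univ_four]

lemma outerHom_neg_one_mul_leviHom_slY {p : ℕ} [Fact p.Prime] {F : Type*} [Field F] [CharP F p]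
    {κ : F} {k : Type*} [Field k] (j : k →+* F)
    (hj : ∀ a, iterateFrobenius F p m (j a) = j a)
    (hσ : ∀ a : F, iterateFrobenius F p m (iterateFrobenius F p m a) = a) (a : F) :
    outerHom p m κ j hj (-1) * leviHom p m κ hσ (slY a) =
      leviHom p m κ hσ (slY a)⁻¹ * outerHom p m κ j hj (-1) := by
  refine isoMat_injective ?_
  rw [isoMat_mul, isoMat_mul, mat_leviHom, mat_leviHom, mat_outerHom,
    Matrix.SpecialLinearGroup.coe_inv, coe_slY, adjugate_fin_two]
  ext i l; fin_cases i <;> fin_cases l <;>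
    simp [leviMat, outerMat, Matrix.mul_apply, Fin.sum_univ_four]

lemma leviHom_slW_mul_conjMat [Fact (Nat.Prime 3)] (j : ZMod 3 →+* F)
    (hj : ∀ a, iterateFrobenius F 3 m (j a) = j a)
    (hσ : ∀ a : F, iterateFrobenius F 3 m (iterateFrobenius F 3 m a) = a) :
    leviHom 3 m κ hσ slW * isoMk (conjMat F) det_conjMat conjMat_form =
      isoMk (conjMat F) det_conjMat conjMat_form *
        (outerHom 3 m κ j hj slW * innerHom 3 m κ j hj slW⁻¹) := by
  refine isoMat_injective ?_
  rw [isoMat_mul, isoMat_mul, isoMat_mul, mat_leviHom, mat_outerHom, mat_innerHom,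
    isoMat_mk, Matrix.SpecialLinearGroup.coe_inv, coe_slW, coe_slW, adjugate_fin_two]
  ext i l; fin_cases i <;> fin_cases l <;>
    simp [leviMat, outerMat, innerMat, conjMat, Matrix.mul_apply, Fin.sum_univ_four]

lemma exists_quaternion : ∃ n : SpecialLinearGroup (Fin 2) (ZMod 3),
    n * n = -1 ∧ n * slW = -1 * slW * n :=
  ⟨⟨!![1, 1; 1, -1], by decide⟩, by decide, by decide⟩

/-- There is no module in characteristic three satisfying the order restrictions. -/
lemma false_of_char_three [Fact (Nat.Prime 3)] [Fintype F] (hF : Fintype.card F = (3 ^ m) ^ 2)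
    (hm : m ≠ 0)
    (hσ : ∀ a : F, iterateFrobenius F 3 m (iterateFrobenius F 3 m a) = a)
    {K V : Type*} [Field K] [CharP K 3] [AddCommGroup V] [Module K V] [FiniteDimensional K V]
    [Nontrivial V] (π : isoU 3 m κ →* Module.End K V)
    (hscal : ∀ g (c : F), isoMat g = c • 1 → π g = 1)
    (hfix : ∀ g w, w ≠ 0 → π g w = w → OrderRestricted g)
    (hC : ∀ x s w, x ^ 3 = 1 → (∃ c : F, isoMat (s * s) = c • 1) →
      (¬ ∃ c : F, isoMat s = c • 1) → Commute x s → π s w = w →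
      w + π x w + π x (π x w) = 0) : False := by
  have h2K : (2 : K) ≠ 0 := by
    have h3 := three_eq_zero (F := K)
    exact fun h => one_ne_zero (show (1 : K) = 0 by linear_combination h3 - h)
  have h2F : (2 : F) ≠ 0 := by
    have h3 := three_eq_zero (F := F)
    exact fun h => one_ne_zero (show (1 : F) = 0 by linear_combination h3 - h)
  let j : ZMod 3 →+* F := ZMod.castHom dvd_rfl F
  have hj : ∀ a, iterateFrobenius F 3 m (j a) = j a := fun a =>
    RingHom.congr_fun (Subsingleton.elim ((iterateFrobenius F 3 m).comp j) j) a
  set S1 := outerHom 3 m κ j hj with hS1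
  set S2 := innerHom 3 m κ j hj with hS2
  set R := leviHom 3 m κ hσ with hR
  have hcomm : ∀ g h, Commute (S1 g) (S2 h) := commute_outerHom_innerHom j hj
  obtain ⟨r, hr, hrq, hr2⟩ := exists_odd_prime_dvd_sq_add_one (q := 3 ^ m)
    (Odd.pow (by decide)) (Nat.one_lt_pow hm (by norm_num))
  obtain ⟨t, htr, ht1, htw⟩ := exists_regular (p := 3) (F := F) hr hr2 (by rw [hF]; exact hrq)
    (by decide)
  have hlevi : ∀ t : SpecialLinearGroup (Fin 2) F, t ^ r = 1 → t ≠ 1 → ∀ w, π (R t) w = w →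
      w = 0 := fun t h1 h2 w hw => by
    by_contra hw0
    exact not_orderRestricted_levi (by decide) hσ hr hr2 hrq h1 h2 hm (hfix _ w hw0 hw)
  set d := S1 (-1) with hd
  have hd2 : d * d = 1 := by rw [hd, ← map_mul, neg_mul_neg, one_mul, map_one]
  have hS2m : π (S2 (-1)) = π d := by
    have h1 := hscal _ _ (outerHom_mul_innerHom_neg_one (κ := κ) j hj)
    have h3 : S2 (-1) = d * (d * S2 (-1)) := by rw [← mul_assoc, hd2, one_mul]
    rw [h3, map_mul, h1, mul_one]
  have hquad : ∀ x v, x ^ 3 = 1 → Commute x d → π d v = v → v + π x v + π x (π x v) = 0 :=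
    fun x v hx hc hv => hC x d v hx ⟨1, by rw [hd2, isoMat_one, one_smul]⟩
      (not_scalar_outerHom_neg_one j h2F hj) hc hv
  set X := LinearMap.ker (π d - 1) with hX
  have memX : ∀ x, x ∈ X ↔ π d x = x := fun x => by
    rw [LinearMap.mem_ker, LinearMap.sub_apply, sub_eq_zero]; rfl
  have stab : ∀ x, Commute x d → ∀ v ∈ X, π x v ∈ X := by
    intro x hx v hv
    rw [memX] at hv ⊢
    rw [← Module.End.mul_apply, ← map_mul, ← hx.eq, map_mul, Module.End.mul_apply, hv]
  have c1 : ∀ a, Commute (S1 a) d := fun a => by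
    rw [hd]
    exact Commute.map (Commute.neg_one_right a) S1
  have c2 : ∀ a, Commute (S2 a) d := fun a => (hcomm _ _).symm
  have trivX : ∀ S : SpecialLinearGroup (Fin 2) (ZMod 3) →* isoU 3 m κ,
      (∀ a, Commute (S a) d) → π (S (-1)) = π d → ∀ v ∈ X, π (S slW) v = v := by
    intro S hS hS1 v hv
    have := slW_eq_one_of_quadratic (restrictRep (π.comp S) X fun a => stab _ (hS a))
      (by
        intro a ha
        ext ⟨v, hv⟩
        exact hquad (S a) v (by rw [← map_pow, ha, map_one]) (hS a) ((memX v).mp hv))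
      (by
        ext ⟨v, hv⟩
        change π (S (-1)) v = v
        rw [hS1]
        exact (memX v).mp hv)
    exact congrArg Subtype.val (LinearMap.congr_fun this ⟨v, hv⟩)
  have hinv : ∀ g v, π g v = v → π g⁻¹ v = v := fun g v h => by
    nth_rw 1 [← h]
    rw [← Module.End.mul_apply, ← map_mul, inv_mul_cancel, map_one, Module.End.one_apply]
  set y := S1 slW * S2 slW⁻¹ with hy
  let Q : isoU 3 m κ := isoMk (conjMat F) det_conjMat conjMat_form
  have hQ : R slW * Q = Q * y := leviHom_slW_mul_conjMat j hj hσ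
  have hX0 : ∀ v, π d v = v → v = 0 := by
    intro v hv
    obtain ⟨n0, hn2, hnw⟩ := exists_quaternion
    let T : Module.End K V := π Q⁻¹ * (π (R t) - π (R t⁻¹)) * π Q
    have hQi : ∀ v, π Q⁻¹ (π Q v) = v := fun v => by
      rw [← Module.End.mul_apply, ← map_mul, inv_mul_cancel, map_one, Module.End.one_apply]
    have hQi' : ∀ v, π Q (π Q⁻¹ v) = v := fun v => by
      rw [← Module.End.mul_apply, ← map_mul, mul_inv_cancel, map_one, Module.End.one_apply]
    refine eq_zero_of_anticommute (D := π d) (Y := π y) (n := π (S1 n0)) (T := T) h2K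
      ?_ ?_ ?_ ?_ ?_ ?_ ?_ hv
    · rw [← map_mul, hd2, map_one]
    · rw [← map_mul, ← map_mul, hy]
      exact congrArg π ((c1 _).mul_left (c2 _)).eq.symm
    · intro x hx
      rw [hy, map_mul, Module.End.mul_apply, map_inv,
        hinv _ _ (trivX S2 c2 hS2m x ((memX x).mpr hx)),
        trivX S1 c1 rfl x ((memX x).mpr hx)]
    · rw [← map_mul, ← map_mul]
      exact congrArg (fun a => π (S1 a)) hn2
    · rw [← map_mul, ← map_mul, ← map_mul, hy]
      refine congrArg π ?_
      calc S1 n0 * (S1 slW * S2 slW⁻¹) = S1 (n0 * slW) * S2 slW⁻¹ := by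
            rw [map_mul, mul_assoc]
        _ = d * S1 slW * (S1 n0 * S2 slW⁻¹) := by
            rw [hnw, map_mul, map_mul, mul_assoc]
        _ = d * (S1 slW * S2 slW⁻¹) * S1 n0 := by
            rw [(hcomm _ _).eq]
            simp only [mul_assoc]
    · intro x hx
      have h1 := congrArg (π Q) hx
      change π Q (π Q⁻¹ (π (R t) (π Q x) - π (R t⁻¹) (π Q x))) = _ at h1
      rw [hQi', map_zero, sub_eq_zero] at h1
      have h3 : π (R (t * t)) (π Q x) = π Q x := by
        rw [map_mul, map_mul, Module.End.mul_apply, h1, ← Module.End.mul_apply, ← map_mul,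
          ← map_mul, mul_inv_cancel, map_one, map_one, Module.End.one_apply]
      have h4 : t * t ≠ 1 := fun h => by
        have h5 := pow_gcd_eq_one.mpr ⟨htr, (pow_two t).trans h⟩
        rw [(Nat.coprime_primes hr Nat.prime_two).mpr hr2, pow_one] at h5
        exact ht1 h5
      have h5 := hlevi (t * t) (by rw [(Commute.refl t).mul_pow, htr, one_mul]) h4 _ h3
      rw [← hQi x, h5, map_zero]
    · have e1 : π Q * π y = π (R slW) * π Q := by rw [← map_mul, ← map_mul, hQ]
      have e2 : π y * π Q⁻¹ = π Q⁻¹ * π (R slW) := by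
        rw [← map_mul, ← map_mul]
        refine congrArg π ?_
        rw [eq_inv_mul_iff_mul_eq, ← mul_assoc, ← hQ, mul_assoc, mul_inv_cancel, mul_one]
      have e3 : π (R slW) * π (R t) = π (R t⁻¹) * π (R slW) := by
        simp only [← map_mul, htw]
      have e4 : π (R slW) * π (R t⁻¹) = π (R t) * π (R slW) := by
        simp only [← map_mul]
        refine congrArg (fun a => π (R a)) ?_
        rw [mul_inv_eq_iff_eq_mul, mul_assoc, htw, ← mul_assoc, mul_inv_cancel, one_mul]
      calc π Q⁻¹ * (π (R t) - π (R t⁻¹)) * π Q * π y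
          = π Q⁻¹ * (π (R t) * π (R slW) - π (R t⁻¹) * π (R slW)) * π Q := by
            rw [mul_assoc, e1]; noncomm_ring
        _ = -((π Q⁻¹ * π (R slW)) * (π (R t) - π (R t⁻¹)) * π Q) := by
            rw [← e3, ← e4]; noncomm_ring
        _ = -(π y * (π Q⁻¹ * (π (R t) - π (R t⁻¹)) * π Q)) := by
            rw [← e2]; noncomm_ring
  have hdneg : π d = -1 := by
    ext v
    have h1 := hX0 (v + π d v) (by
      rw [map_add, ← Module.End.mul_apply, ← map_mul, hd2, map_one, Module.End.one_apply, add_comm])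
    exact eq_neg_of_add_eq_zero_right h1
  have triv : ∀ a b : SpecialLinearGroup (Fin 2) F, d * R a = R a⁻¹ * d → a * a = b →
      π (R b) = 1 := by
    intro a b hab hb
    have h1 : π d * π (R a) = π (R a⁻¹) * π d := by rw [← map_mul, ← map_mul, hab]
    rw [hdneg, neg_one_mul, mul_neg_one, neg_inj] at h1
    rw [← hb, map_mul, map_mul]
    nth_rw 1 [h1]
    rw [← map_mul, ← map_mul, inv_mul_cancel, map_one, map_one]
  have hall : ∀ g, g ∈ MonoidHom.mker (π.comp R) := by
    refine sl_mem_of_slX_slY ?_ ?_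
    · intro a
      refine triv (slX (2⁻¹ * a)) _ ?_ ?_
      · exact outerHom_neg_one_mul_leviHom_slX j hj hσ _
      · rw [← slX_add]; congr 1; field_simp; ring
    · intro a
      refine triv (slY (2⁻¹ * a)) _ ?_ ?_
      · exact outerHom_neg_one_mul_leviHom_slY j hj hσ _
      · rw [← slY_add]; congr 1; field_simp; ring
  obtain ⟨v, hv⟩ := exists_ne (0 : V)
  exact hv (hlevi t htr ht1 v (LinearMap.congr_fun (hall t) v))

end CharThreeCase

section Extraction

/-- A finite `p`-group acting linearly in characteristic `p` fixes a nonzero vector. -/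
lemma exists_fixed_of_isPGroup {p : ℕ} [Fact p.Prime] {U K V : Type*} [Group U] [Finite U]
    [Field K] [CharP K p] [AddCommGroup V] [Module K V] [Nontrivial V] (hU : IsPGroup p U)
    (π : U →* Module.End K V) : ∃ v, v ≠ 0 ∧ ∀ u, π u v = v := by
  classical
  have := Fintype.ofFinite U
  obtain ⟨w, hw⟩ := exists_ne (0 : V)
  let f : (U → ZMod p) →+ V :=
    { toFun := fun c => ∑ u, (ZMod.castHom dvd_rfl K (c u)) • π u w
      map_zero' := by simp
      map_add' := fun c d => by
        simp only [Pi.add_apply, map_add, add_smul, Finset.sum_add_distrib] }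
  have hf : ∀ c, f c = ∑ u, (ZMod.castHom dvd_rfl K (c u)) • π u w := fun _ => rfl
  let A := f.range
  have hwA : w ∈ A := ⟨Pi.single 1 1, by
    rw [hf, Finset.sum_eq_single 1]
    · simp
    · intro b _ hb
      rw [Pi.single_eq_of_ne hb, map_zero, zero_smul]
    · simp⟩
  have hstab : ∀ u, ∀ a ∈ A, π u a ∈ A := by
    rintro u _ ⟨c, rfl⟩
    refine ⟨fun x => c (u⁻¹ * x), ?_⟩
    rw [hf, hf, map_sum]
    refine Fintype.sum_equiv (Equiv.mulLeft u⁻¹) _ _ fun x => ?_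
    rw [map_smul, ← Module.End.mul_apply, ← map_mul, Equiv.coe_mulLeft, mul_inv_cancel_left]
  let act : MulAction U A :=
    { smul := fun u a => ⟨π u a, hstab u a a.2⟩
      one_smul := fun a => Subtype.ext (by
        change π 1 (a : V) = a
        rw [map_one, Module.End.one_apply])
      mul_smul := fun u v a => Subtype.ext (by
        change π (u * v) (a : V) = π u (π v a)
        rw [map_mul, Module.End.mul_apply]) }
  have hfin : Finite A := Set.finite_range f
  have hdvd : Nat.card A ∣ p ^ Fintype.card U := by
    have h := AddSubgroup.card_range_dvd f
    rwa [Nat.card_fun, Nat.card_zmod, Nat.card_eq_fintype_card (α := U)] at h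
  have hne : Nat.card A ≠ 1 := by
    intro h
    have h1 := (Nat.card_eq_one_iff_unique.mp h).1
    exact hw (congrArg Subtype.val (h1.elim (⟨w, hwA⟩ : A) 0))
  have hp : p ∣ Nat.card A := by
    obtain ⟨i, _, hi⟩ := (Nat.dvd_prime_pow Fact.out).mp hdvd
    rw [hi]
    refine dvd_pow_self p fun h => hne ?_
    rw [hi, h, pow_zero]
  obtain ⟨b, hb, hb0⟩ := hU.exists_fixed_point_of_prime_dvd_card_of_fixed_point A hp (a := 0)
    (fun u => Subtype.ext (map_zero (π u)))
  refine ⟨b, fun h => hb0 (Subtype.ext h.symm), fun u => congrArg Subtype.val (hb u)⟩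

/-- The group of units of a finite subfield acting linearly has weight vectors. -/
lemma exists_weight {k K V : Type*} [Field k] [Fintype k] [Field K] [AddCommGroup V] [Module K V]
    (ι : k →+* K) (π : kˣ →* Module.End K V) (X : Submodule K V)
    (hX : ∀ t, ∀ v ∈ X, π t v ∈ X) {v : V} (hv : v ∈ X) (hv0 : v ≠ 0) :
    ∃ A < Fintype.card k - 1, ∃ w ∈ X, w ≠ 0 ∧ ∀ t : kˣ, π t w = ι t ^ A • w := by
  classical
  let w : ℕ → V := fun A => ∑ s : kˣ, ι ((s⁻¹ : kˣ) : k) ^ A • π s v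
  have hw : ∀ A, ∀ t : kˣ, π t (w A) = ι t ^ A • w A := by
    intro A t
    simp only [w, map_sum, map_smul, Finset.smul_sum]
    refine Fintype.sum_equiv (Equiv.mulLeft t) _ _ fun s => ?_
    rw [← Module.End.mul_apply, ← map_mul, Equiv.coe_mulLeft, smul_smul, ← mul_pow, ← map_mul]
    congr 3
    rw [_root_.mul_inv_rev, Units.val_mul, mul_comm, mul_assoc, ← Units.val_mul]
    simp
  have hcard : Fintype.card kˣ = Fintype.card k - 1 := Fintype.card_units k
  have hQ : 1 < Fintype.card k := Fintype.one_lt_card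
  have hsum : ∑ A ∈ Finset.range (Fintype.card k - 1), w A = -v := by
    simp only [w]
    rw [Finset.sum_comm, Finset.sum_eq_single 1]
    · simp only [inv_one, Units.val_one, map_one, one_pow, one_smul, Module.End.one_apply]
      rw [Finset.sum_const, Finset.card_range, ← Nat.cast_smul_eq_nsmul K, Nat.cast_sub hQ.le,
        Nat.cast_one, ← map_natCast ι, FiniteField.cast_card_eq_zero, map_zero, zero_sub,
        neg_one_smul]
    · intro s _ hs
      rw [← Finset.sum_smul]
      have h1 : ι ((s⁻¹ : kˣ) : k) ≠ 1 := by
        rw [← map_one ι, Ne, ι.injective.eq_iff, Units.val_eq_one, inv_eq_one]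
        exact hs
      have h2 := mul_neg_geom_sum (ι ((s⁻¹ : kˣ) : k)) (Fintype.card k - 1)
      rw [← map_pow, ← hcard, ← Units.val_pow_eq_pow_val, pow_card_eq_one, Units.val_one, map_one,
        sub_self] at h2
      rw [← hcard, (mul_eq_zero.mp h2).resolve_left (sub_ne_zero.mpr h1.symm), zero_smul]
    · simp
  obtain ⟨A, hA, hA0⟩ : ∃ A ∈ Finset.range (Fintype.card k - 1), w A ≠ 0 := by
    by_contra! h
    rw [Finset.sum_eq_zero h, eq_comm, neg_eq_zero] at hsum
    exact hv0 hsum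
  exact ⟨A, Finset.mem_range.mp hA, w A,
    X.sum_mem fun s _ => X.smul_mem _ (hX s v hv), hA0, hw A⟩

end Extraction

section Unitriangular

variable {p m : ℕ} [Fact p.Prime] {F : Type*} [Field F] [CharP F p] {κ : F}

lemma pow_eq_one_of_unitriangular (hp : 5 ≤ p) {M : Matrix (Fin 4) (Fin 4) F}
    (h1 : ∀ i, M i i = 1) (h0 : ∀ i l, l < i → M i l = 0) : M ^ p = 1 := by
  have hc : M.charpoly = (Polynomial.X - 1) ^ 4 := by
    rw [Matrix.charpoly_of_isUpperTriangular M (fun i l h => h0 i l h)]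
    simp [h1]
  have h4 : (M - 1) ^ 4 = 0 := by
    have := Matrix.aeval_self_charpoly M
    rwa [hc, map_pow, map_sub, Polynomial.aeval_X, map_one] at this
  have h := sub_pow_char_of_commute p (Commute.one_right M)
  rw [one_pow, ← Nat.sub_add_cancel (show 4 ≤ p by omega), pow_add, h4, mul_zero,
    Nat.sub_add_cancel (show 4 ≤ p by omega)] at h
  exact (sub_eq_zero.mp h.symm)

variable (m κ) in
/-- The submonoid of upper unitriangular elements of `isoU`. -/
def uniMonoid : Submonoid (isoU p m κ) where
  carrier := {g | (∀ i, isoMat g i i = 1) ∧ ∀ i l, l < i → isoMat g i l = 0}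
  one_mem' := ⟨fun i => by rw [isoMat_one, Matrix.one_apply_eq],
    fun i l h => by rw [isoMat_one, Matrix.one_apply_ne h.ne']⟩
  mul_mem' := by
    rintro g h ⟨g1, g0⟩ ⟨h1, h0⟩
    refine ⟨fun i => ?_, fun i l hil => ?_⟩
    · rw [isoMat_mul, Matrix.mul_apply, Finset.sum_eq_single i, g1, h1, one_mul]
      · intro b _ hb
        rcases lt_or_gt_of_ne hb with hb | hb
        · rw [g0 i b hb, zero_mul]
        · rw [h0 b i hb, mul_zero]
      · simp
    · rw [isoMat_mul, Matrix.mul_apply]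
      refine Finset.sum_eq_zero fun b _ => ?_
      rcases lt_or_ge b i with hb | hb
      · rw [g0 i b hb, zero_mul]
      · rw [h0 b l (hil.trans_le hb), mul_zero]

variable (m κ) in
/-- The upper unitriangular subgroup of `isoU`. -/
def uniU (hp : 5 ≤ p) : Subgroup (isoU p m κ) where
  toSubmonoid := uniMonoid m κ
  inv_mem' := by
    rintro g ⟨g1, g0⟩
    have hg : g ^ p = 1 := isoMat_injective (by
      rw [isoMat_pow, pow_eq_one_of_unitriangular hp g1 g0, isoMat_one])
    have h : g⁻¹ = g ^ (p - 1) := inv_eq_of_mul_eq_one_right (by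
      rw [← pow_succ', Nat.sub_add_cancel (by omega), hg])
    rw [h]
    exact (uniMonoid m κ).pow_mem ⟨g1, g0⟩ _

lemma mem_uniU (hp : 5 ≤ p) (g : isoU p m κ) : g ∈ uniU m κ hp ↔
    (∀ i, isoMat g i i = 1) ∧ ∀ i l, l < i → isoMat g i l = 0 := Iff.rfl

lemma isPGroup_uniU (hp : 5 ≤ p) : IsPGroup p (uniU m κ hp) := fun g => ⟨1, Subtype.ext (by
  rw [pow_one]
  exact isoMat_injective (by
    change isoMat (g.1 ^ p) = 1
    rw [isoMat_pow, pow_eq_one_of_unitriangular hp g.2.1 g.2.2]))⟩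

end Unitriangular

section Relations

variable {p m : ℕ} [Fact p.Prime] {F : Type*} [Field F] [CharP F p] {κ : F}
  {k : Type*} [Field k] (j : k →+* F) (hj : ∀ a, iterateFrobenius F p m (j a) = j a)
  (hσ : ∀ a : F, iterateFrobenius F p m (iterateFrobenius F p m a) = a)

lemma slH_mul_slW (t : kˣ) : slH t * slW = slW * slH t⁻¹ := by
  refine Subtype.ext ?_
  simp [coe_slW, coe_slH]

lemma slW_mul_slW : slW * slW = slH (-1 : kˣ) := by
  refine Subtype.ext ?_
  simp [coe_slW, coe_slH]

lemma slX_natCast_mul (i : ℕ) (c : k) : slX (i * c) = slX c ^ i := by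
  induction i with
  | zero => simp [slX_zero]
  | succ n ih => rw [pow_succ, ← ih, ← slX_add]; congr 1; push_cast; ring

lemma slY_natCast_mul (i : ℕ) (c : k) : slY (i * c) = slY c ^ i := by
  induction i with
  | zero => simp [slY_zero]
  | succ n ih => rw [pow_succ, ← ih, ← slY_add]; congr 1; push_cast; ring

lemma leviHom_slW_mul_innerHom (c : k) : leviHom p m κ hσ slW * innerHom p m κ j hj (slY c) =
    outerHom p m κ j hj (slY c) * leviHom p m κ hσ slW := by
  refine isoMat_injective ?_
  rw [isoMat_mul, isoMat_mul, mat_leviHom, mat_innerHom, mat_outerHom, coe_slW, coe_slY]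
  ext i l; fin_cases i <;> fin_cases l <;>
    simp [leviMat, innerMat, outerMat, Matrix.mul_apply, Fin.sum_univ_four]

lemma commute_leviHom_innerHom (c : k) (d : F) :
    Commute (leviHom p m κ hσ (slY d)) (innerHom p m κ j hj (slX c)) := by
  refine isoMat_injective ?_
  rw [isoMat_mul, isoMat_mul, mat_leviHom, mat_innerHom, coe_slX, coe_slY]
  ext i l; fin_cases i <;> fin_cases l <;>
    simp [leviMat, innerMat, Matrix.mul_apply, Fin.sum_univ_four]

lemma commute_outerHom_leviHom (c : k) (d : F) :
    Commute (outerHom p m κ j hj (slY c)) (leviHom p m κ hσ (slY d)) := by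
  refine isoMat_injective ?_
  rw [isoMat_mul, isoMat_mul, mat_leviHom, mat_outerHom, coe_slY, coe_slY]
  ext i l; fin_cases i <;> fin_cases l <;>
    simp [leviMat, outerMat, Matrix.mul_apply, Fin.sum_univ_four]

lemma leviHom_slH_mul_innerHom_slW (t : Fˣ) (n : kˣ)
    (hn : j n = t * iterateFrobenius F p m t) :
    leviHom p m κ hσ (slH t) * innerHom p m κ j hj slW =
      innerHom p m κ j hj slW * (leviHom p m κ hσ (slH t) * innerHom p m κ j hj (slH n)) := by
  refine isoMat_injective ?_
  have ht : (t : F) ≠ 0 := t.ne_zero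
  have ht' : iterateFrobenius F p m (t : F) ≠ 0 := (map_ne_zero _).mpr ht
  rw [isoMat_mul, isoMat_mul, isoMat_mul, mat_leviHom, mat_innerHom, mat_innerHom, coe_slW,
    coe_slH, coe_slH]
  ext i l; fin_cases i <;> fin_cases l <;>
    simp [leviMat, innerMat, Matrix.mul_apply, Fin.sum_univ_four, hn]

lemma innerHom_slH_mul_leviHom (t : kˣ) (c : F) :
    innerHom p m κ j hj (slH t) * leviHom p m κ hσ (slY c) =
      leviHom p m κ hσ (slY (j t * c)) * innerHom p m κ j hj (slH t) := by
  refine isoMat_injective ?_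
  have ht : j (t : k) ≠ 0 := by simp
  rw [isoMat_mul, isoMat_mul, mat_leviHom, mat_leviHom, mat_innerHom, coe_slY, coe_slY, coe_slH]
  ext i l; fin_cases i <;> fin_cases l <;>
    simp [leviMat, innerMat, Matrix.mul_apply, Fin.sum_univ_four, hj]
  field_simp

lemma outerHom_slH_mul_leviHom (t : kˣ) (c : F) :
    outerHom p m κ j hj (slH t) * leviHom p m κ hσ (slY (j t * c)) =
      leviHom p m κ hσ (slY c) * outerHom p m κ j hj (slH t) := by
  refine isoMat_injective ?_
  have ht : j (t : k) ≠ 0 := by simp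
  rw [isoMat_mul, isoMat_mul, mat_leviHom, mat_leviHom, mat_outerHom, coe_slY, coe_slY, coe_slH]
  ext i l; fin_cases i <;> fin_cases l <;>
    simp [leviMat, outerMat, Matrix.mul_apply, Fin.sum_univ_four, hj]
  field_simp

lemma outerHom_slH_eq (t : kˣ) : outerHom p m κ j hj (slH t) =
    leviHom p m κ hσ (slH (Units.map j t)) * innerHom p m κ j hj (slH t) := by
  refine isoMat_injective ?_
  have ht : j (t : k) ≠ 0 := by simp
  rw [isoMat_mul, mat_leviHom, mat_innerHom, mat_outerHom, coe_slH, coe_slH]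
  ext i l; fin_cases i <;> fin_cases l <;>
    simp [leviMat, innerMat, outerMat, Matrix.mul_apply, Fin.sum_univ_four, hj]

lemma leviHom_slX_mem (hp : 5 ≤ p) (a : F) : leviHom p m κ hσ (slX a) ∈ uniU m κ hp := by
  rw [mem_uniU, mat_leviHom, coe_slX]
  refine ⟨fun i => ?_, fun i l h => ?_⟩
  · fin_cases i <;> simp [leviMat]
  · fin_cases i <;> fin_cases l <;> simp [leviMat] at h ⊢

lemma innerHom_slX_mem (hp : 5 ≤ p) (a : k) : innerHom p m κ j hj (slX a) ∈ uniU m κ hp := by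
  rw [mem_uniU, mat_innerHom, coe_slX]
  refine ⟨fun i => ?_, fun i l h => ?_⟩
  · fin_cases i <;> simp [innerMat]
  · fin_cases i <;> fin_cases l <;> simp [innerMat] at h ⊢

lemma conj_leviHom_slX_mem (hp : 5 ≤ p) (a : F) : (innerHom p m κ j hj slW)⁻¹ *
    (leviHom p m κ hσ (slX a) * innerHom p m κ j hj slW) ∈ uniU m κ hp := by
  rw [← map_inv, mem_uniU, isoMat_mul, isoMat_mul, mat_leviHom, mat_innerHom, mat_innerHom,
    coe_slX, Matrix.SpecialLinearGroup.coe_inv, coe_slW, adjugate_fin_two]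
  refine ⟨fun i => ?_, fun i l h => ?_⟩
  · fin_cases i <;> simp [innerMat, leviMat, Matrix.mul_apply, Fin.sum_univ_four]
  · fin_cases i <;> fin_cases l <;>
      first | (simp at h; done) |
        simp [innerMat, leviMat, Matrix.mul_apply, Fin.sum_univ_four]

lemma conj_mem_uniU (hp : 5 ≤ p) {g h : isoU p m κ} {d : Fin 4 → F}
    (hh : isoMat h = diagonal d) (hg : g ∈ uniU m κ hp) : h⁻¹ * (g * h) ∈ uniU m κ hp := by
  set g' := h⁻¹ * (g * h) with hg'
  have h1 : isoMat h * isoMat g' = isoMat g * isoMat h := by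
    rw [← isoMat_mul, ← isoMat_mul, hg', mul_inv_cancel_left]
  have h2 : isoMat h * isoMat h⁻¹ = 1 := by rw [← isoMat_mul, mul_inv_cancel, isoMat_one]
  rw [hh] at h1 h2
  have hd : ∀ i, d i ≠ 0 := fun i => by
    have := congrFun (congrFun h2 i) i
    rw [diagonal_mul, Matrix.one_apply_eq] at this
    exact left_ne_zero_of_mul_eq_one this
  have h3 : ∀ i l, d i * isoMat g' i l = isoMat g i l * d l := fun i l => by
    have := congrFun (congrFun h1 i) l
    rwa [diagonal_mul, mul_diagonal] at this
  refine ⟨fun i => ?_, fun i l hil => ?_⟩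
  · refine mul_left_cancel₀ (hd i) ?_
    rw [h3, hg.1, one_mul, mul_one]
  · refine mul_left_cancel₀ (hd i) ?_
    rw [h3, hg.2 i l hil, zero_mul, mul_zero]

lemma isoMat_leviHom_slH (t : Fˣ) : isoMat (leviHom p m κ hσ (slH t)) =
    diagonal ![(t : F), (t : F)⁻¹, iterateFrobenius F p m t, (iterateFrobenius F p m t)⁻¹] := by
  rw [mat_leviHom, coe_slH]
  ext i l; fin_cases i <;> fin_cases l <;> simp [leviMat]

lemma isoMat_innerHom_slH (t : kˣ) : isoMat (innerHom p m κ j hj (slH t)) =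
    diagonal ![1, j t, (j t)⁻¹, 1] := by
  rw [mat_innerHom, coe_slH]
  ext i l; fin_cases i <;> fin_cases l <;> simp [innerMat]

end Relations

section HighestWeight

variable {p m : ℕ} [Fact p.Prime] {F : Type*} [Field F] [Fintype F] [CharP F p] {κ : F}
  {k : Type*} [Field k] [Fintype k] (j : k →+* F)
  (hj : ∀ a, iterateFrobenius F p m (j a) = j a)
  (hσ : ∀ a : F, iterateFrobenius F p m (iterateFrobenius F p m a) = a)
  {K V : Type*} [Field K] [CharP K p] [AddCommGroup V] [Module K V]
  (ι : F →+* K) (π : isoU p m κ →* Module.End K V)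

/-- A weight vector fixed by the upper unitriangular subgroup. -/
structure IsHighestWeight (hp : 5 ≤ p) (v : V) (A B : ℕ) : Prop where
  ne_zero : v ≠ 0
  uni : ∀ g ∈ uniU m κ hp, π g v = v
  levi : ∀ t : Fˣ, π (leviHom p m κ hσ (slH t)) v = ι t ^ A • v
  inner : ∀ t : kˣ, π (innerHom p m κ j hj (slH t)) v = ι (j t) ^ B • v
  lt_levi : A < Fintype.card F - 1
  lt_inner : B < Fintype.card k - 1

lemma apply_mul (g h : isoU p m κ) (v : V) : π (g * h) v = π g (π h v) := by
  rw [map_mul, Module.End.mul_apply]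

lemma apply_ne_zero (g : isoU p m κ) {v : V} (hv : v ≠ 0) : π g v ≠ 0 := fun h => hv (by
  have h1 := apply_mul π g⁻¹ g v
  rwa [inv_mul_cancel, map_one, Module.End.one_apply, h, map_zero] at h1)

/-- The torus homomorphism into `SL₂`. -/
def slHHom (k : Type*) [Field k] : kˣ →* SpecialLinearGroup (Fin 2) k where
  toFun := slH
  map_one' := slH_one
  map_mul' := slH_mul

lemma exists_isHighestWeight [Nontrivial V] (hp : 5 ≤ p) :
    ∃ v A B, IsHighestWeight j hj hσ ι π hp v A B := by
  obtain ⟨v, hv0, hv⟩ := exists_fixed_of_isPGroup (isPGroup_uniU hp)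
    (π.comp (uniU m κ hp).subtype)
  let X : Submodule K V :=
    { carrier := {v | ∀ g ∈ uniU m κ hp, π g v = v}
      zero_mem' := fun g _ => map_zero _
      add_mem' := fun ha hb g hg => by rw [map_add, ha g hg, hb g hg]
      smul_mem' := fun c a ha g hg => by rw [map_smul, ha g hg] }
  have hconj : ∀ (h : isoU p m κ) (d : Fin 4 → F), isoMat h = diagonal d → ∀ v ∈ X,
      π h v ∈ X := by
    intro h d hd v hv g hg
    rw [← apply_mul, show g * h = h * (h⁻¹ * (g * h)) by group, apply_mul,
      hv _ (conj_mem_uniU hp hd hg)]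
  obtain ⟨B, hB, v1, hv1, hv10, hvB⟩ := exists_weight (ι.comp j)
    ((π.comp (innerHom p m κ j hj)).comp (slHHom k)) X
    (fun t v hv => hconj _ _ (isoMat_innerHom_slH j hj t) v hv)
    (v := v) (fun g hg => hv ⟨g, hg⟩) hv0
  let Y : Submodule K V :=
    { carrier := {v | ∀ t : kˣ, π (innerHom p m κ j hj (slH t)) v = ι (j t) ^ B • v}
      zero_mem' := fun t => by rw [map_zero, smul_zero]
      add_mem' := fun ha hb t => by rw [map_add, ha t, hb t, smul_add]
      smul_mem' := fun c a ha t => by rw [map_smul, ha t, smul_comm] }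
  obtain ⟨A, hA, v2, hv2, hv20, hvA⟩ := exists_weight ι
    ((π.comp (leviHom p m κ hσ)).comp (slHHom F)) (X ⊓ Y)
    (fun t v hv => ⟨hconj _ _ (isoMat_leviHom_slH hσ t) v hv.1, fun s => by
      change π _ (π (leviHom p m κ hσ (slH t)) v) = _ • π (leviHom p m κ hσ (slH t)) v
      have hc : innerHom p m κ j hj (slH s) * leviHom p m κ hσ (slH t) =
          leviHom p m κ hσ (slH t) * innerHom p m κ j hj (slH s) := by
        refine isoMat_injective ?_
        rw [isoMat_mul, isoMat_mul, isoMat_leviHom_slH, isoMat_innerHom_slH,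
          diagonal_mul_diagonal, diagonal_mul_diagonal]
        exact congrArg _ (funext fun i => mul_comm _ _)
      rw [← apply_mul, hc, apply_mul, hv.2 s, map_smul]⟩)
    (v := v1) ⟨hv1, hvB⟩ hv10
  exact ⟨v2, A, B, hv20, hv2.1, hvA, hv2.2, hA, hB⟩

/-- Vanishing of products of coefficients of three commuting unipotent families. -/
lemma coeff_mul_mul_eq_zero (hp : 5 ≤ p)
    (hB : ∀ g : isoU p m κ, g ^ p = 1 → ∑ i ∈ Finset.range p, π (g ^ i) = 0) {n₁ n₂ n₃ : ℕ}
    (hn : p - 1 ≤ digitSum p n₁ + digitSum p n₂ + digitSum p n₃) :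
    familyCoeff (ι.comp j) (fun c => π (outerHom p m κ j hj (slY c))) n₁ *
      familyCoeff ι (fun c => π (leviHom p m κ hσ (slY c))) n₂ *
      familyCoeff (ι.comp j) (fun c => π (innerHom p m κ j hj (slX c))) n₃ = 0 := by
  refine familyCoeff_mul_mul_eq_zero _ _ _ (by omega)
    (fun c d => by rw [slY_add, map_mul, map_mul]) (fun c d => by rw [slY_add, map_mul, map_mul])
    (fun c d => by rw [slX_add, map_mul, map_mul])
    (fun c d => (commute_leviHom_innerHom j hj hσ d c).map π) (fun c₁ c₂ c₃ => ?_) _ _ _ hn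
  set a := outerHom p m κ j hj (slY c₁) with ha
  set b := leviHom p m κ hσ (slY c₂) with hb
  set c := innerHom p m κ j hj (slX c₃) with hc
  have hpow : ∀ i : ℕ, (a * b * c) ^ i = a ^ i * b ^ i * c ^ i := fun i => by
    have h1 : Commute a b := commute_outerHom_leviHom j hj hσ _ _
    have h2 : Commute a c := commute_outerHom_innerHom j hj _ _
    have h3 : Commute b c := commute_leviHom_innerHom j hj hσ _ _
    rw [(h2.mul_left h3).mul_pow, h1.mul_pow]
  have : CharP k p := (RingHom.charP_iff j j.injective p).mpr inferInstance
  have h := hB (a * b * c) (by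
    rw [hpow, ha, hb, hc, ← map_pow, ← map_pow, ← map_pow, ← slY_natCast_mul, ← slY_natCast_mul,
      ← slX_natCast_mul, CharP.cast_eq_zero, CharP.cast_eq_zero, zero_mul, zero_mul, zero_mul,
      slY_zero, slY_zero, slX_zero, map_one, map_one, map_one, one_mul, one_mul])
  rw [← h]
  refine Finset.sum_congr rfl fun i _ => ?_
  rw [hpow, ha, hb, hc, ← map_pow, ← map_pow, ← map_pow, ← slY_natCast_mul, ← slY_natCast_mul,
      ← slX_natCast_mul, map_mul, map_mul]

lemma leviCoeff_eq_zero (j : k →+* F) (hj : ∀ a, iterateFrobenius F p m (j a) = j a) (hp : 5 ≤ p)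
    (hB : ∀ g : isoU p m κ, g ^ p = 1 → ∑ i ∈ Finset.range p, π (g ^ i) = 0) {n : ℕ}
    (hn : p - 1 ≤ digitSum p n) :
    familyCoeff ι (fun c => π (leviHom p m κ hσ (slY c))) n = 0 := by
  have h := coeff_mul_mul_eq_zero j hj hσ ι π hp hB (n₁ := 0) (n₂ := n) (n₃ := 0)
    (by omega)
  rwa [familyCoeff_zero, familyCoeff_zero, slY_zero, slX_zero, map_one, map_one, map_one, map_one,
    one_mul, mul_one] at h

lemma outerCoeff_eq_zero
    (hσ : ∀ a : F, iterateFrobenius F p m (iterateFrobenius F p m a) = a) (hp : 5 ≤ p)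
    (hB : ∀ g : isoU p m κ, g ^ p = 1 → ∑ i ∈ Finset.range p, π (g ^ i) = 0) {n : ℕ}
    (hn : p - 1 ≤ digitSum p n) :
    familyCoeff (ι.comp j) (fun c => π (outerHom p m κ j hj (slY c))) n = 0 := by
  have h := coeff_mul_mul_eq_zero j hj hσ ι π hp hB (n₁ := n) (n₂ := 0) (n₃ := 0)
    (by omega)
  rwa [familyCoeff_zero, familyCoeff_zero, slY_zero, slX_zero, map_one, map_one, map_one, map_one,
    mul_one, mul_one] at h

lemma outerCoeff_mul_leviHom (n : ℕ) :
    familyCoeff (ι.comp j) (fun c => π (outerHom p m κ j hj (slY c))) n * π (leviHom p m κ hσ slW) =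
    π (leviHom p m κ hσ slW) *
      familyCoeff (ι.comp j) (fun c => π (innerHom p m κ j hj (slY c))) n := by
  have h1 := map_familyCoeff (ι.comp j) (LinearMap.mulRight K (π (leviHom p m κ hσ slW)))
    (fun c => π (outerHom p m κ j hj (slY c))) n
  have h2 := map_familyCoeff (ι.comp j) (LinearMap.mulLeft K (π (leviHom p m κ hσ slW)))
    (fun c => π (innerHom p m κ j hj (slY c))) n
  rw [LinearMap.mulRight_apply] at h1
  rw [LinearMap.mulLeft_apply] at h2
  rw [h1, h2]
  congr 1
  funext c
  rw [LinearMap.mulRight_apply, LinearMap.mulLeft_apply, ← map_mul, ← map_mul,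
    leviHom_slW_mul_innerHom]

lemma innerCoeff_eq_zero
    (hσ : ∀ a : F, iterateFrobenius F p m (iterateFrobenius F p m a) = a) (hp : 5 ≤ p)
    (hB : ∀ g : isoU p m κ, g ^ p = 1 → ∑ i ∈ Finset.range p, π (g ^ i) = 0) {n : ℕ}
    (hn : p - 1 ≤ digitSum p n) :
    familyCoeff (ι.comp j) (fun c => π (innerHom p m κ j hj (slY c))) n = 0 := by
  have h := outerCoeff_mul_leviHom j hj hσ ι π n
  rw [outerCoeff_eq_zero j hj ι π hσ hp hB hn, zero_mul] at h
  have h1 : π (leviHom p m κ hσ slW)⁻¹ * π (leviHom p m κ hσ slW) = 1 := by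
    rw [← map_mul, inv_mul_cancel, map_one]
  rw [← one_mul (familyCoeff _ _ _), ← h1, mul_assoc, ← h, mul_zero]

end HighestWeight

section DigitSumBounds

lemma le_digitSum_pow_sub_one {p : ℕ} (hp : 1 < p) {f : ℕ} (hf : f ≠ 0) :
    p - 1 ≤ digitSum p (p ^ f - 1) := by
  rw [digitSum_pow_sub_one hp]
  exact Nat.le_mul_of_pos_left _ (Nat.pos_of_ne_zero hf)

/-- The numerical bound on the weight of the reflected vector. -/
lemma add_lt_of_digitSum_lt {p m A B : ℕ} (hp : 5 ≤ p) (hm : m ≠ 0)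
    (hA : A < (p ^ m) ^ 2) (hB' : B < p ^ m)
    (h : digitSum p A + 2 * digitSum p B < p - 1) :
    p ^ m * B + (A + B) < (p ^ m) ^ 2 - 1 := by
  obtain ⟨n, rfl⟩ := Nat.exists_eq_succ_of_ne_zero hm
  have h1 := le_digitSum_mul (p := p) (by omega) n B hB'
  have h2 := le_digitSum_mul (p := p) (by omega) (2 * n + 1) A (by
    rw [← pow_mul] at hA; exact hA.trans_eq (by congr 1; omega))
  set a := digitSum p A
  set b := digitSum p B
  have hP : 1 ≤ p ^ n := Nat.one_le_pow _ _ (by omega)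
  have e1 : p ^ (2 * n + 1) = p ^ n * p ^ n * p := by ring
  have e2 : p ^ (n + 1) = p ^ n * p := by ring
  rw [e1] at h2
  rw [Nat.succ_eq_add_one, e2]
  set P := p ^ n
  have h3 : P * p * B + (A + B) ≤ (a + 2 * b) * (P * P * p) := by
    have h4 : P * p * B ≤ P * p * (b * P) := Nat.mul_le_mul_left _ h1
    have h5 : b * P ≤ b * (P * P * p) :=
      Nat.mul_le_mul_left _ (by nlinarith)
    nlinarith
  have h6 : (a + 2 * b) * (P * P * p) ≤ (p - 2) * (P * P * p) :=
    Nat.mul_le_mul_right _ (by omega)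
  have h7 : (P * p) ^ 2 = (p - 2) * (P * P * p) + 2 * (P * P * p) := by
    rw [← add_mul, Nat.sub_add_cancel (by omega)]; ring
  have h8 : 1 ≤ P * P * p := Nat.one_le_iff_ne_zero.mpr (by positivity)
  omega

end DigitSumBounds

section MiddleVector

variable {p m : ℕ} [Fact p.Prime] {F : Type*} [Field F] [Fintype F] [CharP F p] {κ : F}
  {k : Type*} [Field k] [Fintype k] {j : k →+* F}
  {hj : ∀ a, iterateFrobenius F p m (j a) = j a}
  {hσ : ∀ a : F, iterateFrobenius F p m (iterateFrobenius F p m a) = a}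
  {K V : Type*} [Field K] [CharP K p] [AddCommGroup V] [Module K V]
  {ι : F →+* K} {π : isoU p m κ →* Module.End K V} {hp : 5 ≤ p} {v : V} {A B : ℕ}

lemma familyCoeff_apply {k : Type*} [Field k] [Fintype k] (ι : k →+* K) (y : k → Module.End K V)
    (n : ℕ) (v : V) : familyCoeff ι y n v = familyCoeff ι (fun c => y c v) n :=
  map_familyCoeff ι (LinearMap.applyₗ v : Module.End K V →ₗ[K] V) y n

lemma IsHighestWeight.innerCoeff
    (hB : ∀ g : isoU p m κ, g ^ p = 1 → ∑ i ∈ Finset.range p, π (g ^ i) = 0)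
    (hk : Fintype.card k = p ^ m) (hm : m ≠ 0)
    (hv : IsHighestWeight j hj hσ ι π hp v A B) :
    familyCoeff (ι.comp j) (fun c => π (innerHom p m κ j hj (slY c))) B v =
      π (innerHom p m κ j hj slW) v :=
  rankOne_highest (ι.comp j) (π.comp (innerHom p m κ j hj)) v B hv.lt_inner
    (innerCoeff_eq_zero j hj ι π hσ hp hB (by
      rw [hk]; exact le_digitSum_pow_sub_one (by omega) hm))
    (fun a => hv.uni _ (innerHom_slX_mem j hj hp a)) hv.inner

lemma leviCoeff_eq
    (hB : ∀ g : isoU p m κ, g ^ p = 1 → ∑ i ∈ Finset.range p, π (g ^ i) = 0)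
    (hF : Fintype.card F = (p ^ m) ^ 2) (hm : m ≠ 0) {u : V} {C : ℕ} (hp : 5 ≤ p) (hj : ∀ a, iterateFrobenius F p m (j a) = j a)
    (hC : C < Fintype.card F - 1)
    (hu : ∀ a, π (leviHom p m κ hσ (slX a)) u = u)
    (hh : ∀ t : Fˣ, π (leviHom p m κ hσ (slH t)) u = ι t ^ C • u) :
    familyCoeff ι (fun c => π (leviHom p m κ hσ (slY c))) C u = π (leviHom p m κ hσ slW) u :=
  rankOne_highest ι (π.comp (leviHom p m κ hσ)) u C hC
    (leviCoeff_eq_zero hσ ι π j hj hp hB (by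
      rw [hF, ← pow_mul]; exact le_digitSum_pow_sub_one (by omega) (by omega))) hu hh

/-- The digit sums of a highest weight are small. -/
lemma IsHighestWeight.digitSum_lt
    (hB : ∀ g : isoU p m κ, g ^ p = 1 → ∑ i ∈ Finset.range p, π (g ^ i) = 0)
    (hk : Fintype.card k = p ^ m) (hF : Fintype.card F = (p ^ m) ^ 2) (hm : m ≠ 0)
    (hv : IsHighestWeight j hj hσ ι π hp v A B) :
    digitSum p A + 2 * digitSum p B < p - 1 := by
  by_contra hcon
  have h := coeff_mul_mul_eq_zero j hj hσ ι π hp hB (n₁ := B) (n₂ := A) (n₃ := B) (by omega)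
  have hE : familyCoeff (ι.comp j) (fun c => π (innerHom p m κ j hj (slX c))) B
      (π (innerHom p m κ j hj slW) v) = v := by
    have h1 : (fun c => π (innerHom p m κ j hj (slX c)) (π (innerHom p m κ j hj slW) v)) =
        fun c => π (innerHom p m κ j hj slW) (π (innerHom p m κ j hj (slY (-1 * c))) v) := by
      funext c
      rw [← apply_mul, ← apply_mul, ← map_mul, ← map_mul, slX_mul_slW, neg_one_mul]
    rw [familyCoeff_apply, h1, ← map_familyCoeff,
      familyCoeff_scale (ι.comp j) (fun c => π (innerHom p m κ j hj (slY c)) v),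
      ← familyCoeff_apply, hv.innerCoeff hB hk hm, map_smul, ← apply_mul, ← map_mul, slW_mul_slW,
      hv.inner, smul_smul, RingHom.comp_apply, Units.val_neg, Units.val_one, ← mul_pow, ← map_mul,
      ← map_mul, neg_mul_neg, one_mul, map_one, map_one, one_pow, one_smul]
  have hFA := leviCoeff_eq hB hF hm hp hj hv.lt_levi
    (fun a => hv.uni _ (leviHom_slX_mem hσ hp a)) hv.levi
  have h2 := LinearMap.congr_fun h (π (innerHom p m κ j hj slW) v)
  rw [Module.End.mul_apply, Module.End.mul_apply, hE, hFA, ← Module.End.mul_apply,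
    outerCoeff_mul_leviHom, Module.End.mul_apply, hv.innerCoeff hB hk hm] at h2
  exact apply_ne_zero π _ (apply_ne_zero π _ hv.ne_zero) h2

/-- The coefficient vector annihilated by the inner torus. -/
lemma IsHighestWeight.exists_middle
    (hB : ∀ g : isoU p m κ, g ^ p = 1 → ∑ i ∈ Finset.range p, π (g ^ i) = 0)
    (hk : Fintype.card k = p ^ m) (hF : Fintype.card F = (p ^ m) ^ 2) (hm : m ≠ 0)
    (hsurj : ∀ a, iterateFrobenius F p m a = a → ∃ b, j b = a)
    (hv : IsHighestWeight j hj hσ ι π hp v A B) :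
    ∃ w, w ≠ 0 ∧ (∀ t : kˣ, π (innerHom p m κ j hj (slH t)) w = w) ∧
      ∀ t : kˣ, π (outerHom p m κ j hj (slH t)) w = ι (j t) ^ A • w := by
  have hds := hv.digitSum_lt hB hk hF hm
  have hA := hv.lt_levi
  have hB' := hv.lt_inner
  rw [hF] at hA
  rw [hk] at hB'
  have hlt := add_lt_of_digitSum_lt (A := A) (B := B) hp hm (by omega) (by omega) hds
  set u := π (innerHom p m κ j hj slW) v with hu
  have hu0 : u ≠ 0 := apply_ne_zero π _ hv.ne_zero
  have hσq : ∀ a : F, iterateFrobenius F p m a = a ^ p ^ m := fun a => iterateFrobenius_def p m a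
  have hux : ∀ a, π (leviHom p m κ hσ (slX a)) u = u := fun a => by
    have h := hv.uni _ (conj_leviHom_slX_mem j hj hσ hp a)
    rw [apply_mul] at h
    rw [hu]
    nth_rw 2 [← h]
    rw [← apply_mul, ← apply_mul, mul_inv_cancel, map_one, Module.End.one_apply]
  have huh : ∀ t : Fˣ, π (leviHom p m κ hσ (slH t)) u = ι t ^ (p ^ m * B + (A + B)) • u := by
    intro t
    obtain ⟨n, hn⟩ := hsurj (t * iterateFrobenius F p m t) (by rw [map_mul, hσ, mul_comm])
    have hn0 : n ≠ 0 := fun h => by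
      rw [h, map_zero, eq_comm, mul_eq_zero, map_eq_zero] at hn
      simp at hn
    rw [hu, ← apply_mul, leviHom_slH_mul_innerHom_slW j hj hσ t (Units.mk0 n hn0) hn, apply_mul,
      apply_mul, hv.inner, map_smul, hv.levi, map_smul, map_smul, smul_smul, Units.val_mk0, hn,
      hσq, map_mul, map_pow]
    congr 1
    ring
  have hFu := leviCoeff_eq hB hF hm hp hj (by rw [hF]; exact hlt) hux huh
  have hmul := familyCoeff_mul ι (fun c => π (leviHom p m κ hσ (slY c)))
    (fun c d => by rw [slY_add, map_mul, map_mul]) (A + B) (p ^ m * B)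
  have hqB : digitSum p (p ^ m * B) = digitSum p B := digitSum_pow_mul (by omega) m B
  have hAB := digitSum_add_le (p := p) A B
  have hch : ((A + B + p ^ m * B).choose (A + B) : K) ≠ 0 := by
    rw [Ne, CharP.cast_eq_zero_iff K p]
    refine not_dvd_choose_of_digitSum_lt _ _ ?_
    omega
  rw [add_comm (A + B)] at hmul hch
  refine ⟨familyCoeff ι (fun c => π (leviHom p m κ hσ (slY c))) (p ^ m * B) u, ?_, ?_, ?_⟩
  · intro h
    have h1 := LinearMap.congr_fun hmul u
    rw [Module.End.mul_apply, h, map_zero, LinearMap.smul_apply, hFu] at h1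
    exact smul_ne_zero hch (apply_ne_zero π _ hu0) h1.symm
  · intro t
    have htu : π (innerHom p m κ j hj (slH t)) u = ι (j (t⁻¹ : kˣ)) ^ B • u := by
      rw [hu, ← apply_mul, ← map_mul, slH_mul_slW, map_mul, apply_mul, hv.inner, map_smul]
    rw [familyCoeff_apply, map_familyCoeff]
    have h1 : (fun c => π (innerHom p m κ j hj (slH t)) (π (leviHom p m κ hσ (slY c)) u)) =
        fun c => LinearMap.lsmul K V (ι (j (t⁻¹ : kˣ)) ^ B)
          (π (leviHom p m κ hσ (slY (j t * c))) u) := by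
      funext c
      rw [← apply_mul, innerHom_slH_mul_leviHom, apply_mul, htu, map_smul, LinearMap.lsmul_apply]
    rw [h1, familyCoeff_scale ι (fun c => LinearMap.lsmul K V (ι (j (t⁻¹ : kˣ)) ^ B)
      (π (leviHom p m κ hσ (slY c)) u)) (j t), ← map_familyCoeff, LinearMap.lsmul_apply, smul_smul,
      pow_mul, ← map_pow ι, ← hσq, hj, ← mul_pow, ← map_mul, ← map_mul, Units.mul_inv, map_one,
      map_one, one_pow, one_smul]
  · intro t
    have htu : π (outerHom p m κ j hj (slH t)) u = ι (j t) ^ (A + B) • u := by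
      rw [hu, ← apply_mul, (commute_outerHom_innerHom j hj _ _).eq, apply_mul,
        outerHom_slH_eq j hj hσ, apply_mul, hv.inner, map_smul, hv.levi, map_smul, map_smul,
        smul_smul]
      congr 1
      rw [Units.coe_map, MonoidHom.coe_coe]
      ring
    have h1 : (fun c => π (outerHom p m κ j hj (slH t)) (π (leviHom p m κ hσ (slY (j t * c))) u)) =
        fun c => LinearMap.lsmul K V (ι (j t) ^ (A + B)) (π (leviHom p m κ hσ (slY c)) u) := by
      funext c
      rw [← apply_mul, outerHom_slH_mul_leviHom, apply_mul, htu, map_smul, LinearMap.lsmul_apply]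
    have h2 := congrArg (fun y => familyCoeff ι y (p ^ m * B)) h1
    rw [familyCoeff_scale ι (fun c => π (outerHom p m κ j hj (slH t))
      (π (leviHom p m κ hσ (slY c)) u)), ← map_familyCoeff, ← map_familyCoeff,
      ← familyCoeff_apply, LinearMap.lsmul_apply] at h2
    have h3 : ι (j t) ^ (p ^ m * B) = ι (j t) ^ B := by
      rw [pow_mul, ← map_pow ι, ← hσq, hj]
    have h4 : ι (j t) ^ B ≠ 0 := pow_ne_zero _ (by simp)
    rw [h3, pow_add, mul_comm (ι (j t) ^ A), mul_smul] at h2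
    exact smul_right_injective V h4 h2

end MiddleVector

/-- If the two opposite root subgroups of `SL₂` have proportional images, then the torus acts
trivially. -/
lemma map_slH_eq_one {p : ℕ} (hp : Odd p) {k M : Type*} [Field k] [CharP k p] [Monoid M]
    (τ : SpecialLinearGroup (Fin 2) k →* M) (μ : k) (h : ∀ c, τ (slX c) = τ (slY (μ * c)))
    (t : kˣ) : τ (slH t) = 1 := by
  have key : ∀ t : kˣ, τ (slW * slH t) = 1 := by
    intro t
    have h4 : (slW * slH t) ^ 4 = 1 := by
      have h2 : (slW * slH t) ^ 2 = slH (-1) := by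
        rw [pow_two, mul_assoc, ← mul_assoc (slH t), slH_mul_slW, mul_assoc, ← slH_mul,
          inv_mul_cancel, slH_one, mul_one, slW_mul_slW]
      rw [show 4 = 2 * 2 from rfl, pow_mul, h2, pow_two, ← slH_mul, neg_mul_neg, one_mul, slH_one]
    have hpp : ∃ b, p * p = 4 * b + 1 := by
      obtain ⟨l, rfl⟩ := hp
      exact ⟨l * l + l, by ring⟩
    obtain ⟨b, hb⟩ := hpp
    have h1 : (slW * slH t) ^ (p * p) = slW * slH t := by
      rw [hb, pow_succ, pow_mul, h4, one_pow, one_mul]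
    rw [← h1, map_pow, ← slX_mul_slY_mul_slX, map_mul, map_mul, h, ← map_mul, ← map_mul,
      ← slY_add, ← slY_add, ← map_pow, ← slY_natCast_mul, Nat.cast_mul, CharP.cast_eq_zero,
      zero_mul, zero_mul, slY_zero, map_one]
  have h1 := key 1
  have h2 := key t
  rw [slH_one, mul_one] at h1
  rwa [map_mul, h1, one_mul] at h2

section OneModFour

variable {p m : ℕ} [Fact p.Prime] {F : Type*} [Field F] [CharP F p] {κ : F}
  {k : Type*} [Field k] {j : k →+* F}
  {hj : ∀ a, iterateFrobenius F p m (j a) = j a}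

lemma exists_twist (hκ0 : κ ≠ 0) (hκ : iterateFrobenius F p m κ = -κ) :
    ∃ g : isoU p m κ, isoMat g =
      !![0, 0, 0, κ; 0, κ, 0, 0; 0, 0, -κ⁻¹, 0; κ⁻¹, 0, 0, 0] := by
  refine ⟨isoMk !![0, 0, 0, κ; 0, κ, 0, 0; 0, 0, -κ⁻¹, 0; κ⁻¹, 0, 0, 0] ?_ ?_, rfl⟩
  · simp [Matrix.det_succ_row_zero, Fin.sum_univ_succ, Fin.succAbove]
    field_simp
  · ext i l; fin_cases i <;> fin_cases l <;>
      simp [gramJ, Matrix.mul_apply, Fin.sum_univ_four, hκ, hκ0, map_inv₀]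

lemma twist_mul_self {g : isoU p m κ} (hκ0 : κ ≠ 0) {μ : kˣ} (hμ : j μ = κ * κ)
    (hg : isoMat g = !![0, 0, 0, κ; 0, κ, 0, 0; 0, 0, -κ⁻¹, 0; κ⁻¹, 0, 0, 0]) :
    g * g = innerHom p m κ j hj (slH μ) := by
  refine isoMat_injective ?_
  rw [isoMat_mul, isoMat_innerHom_slH, hμ, hg]
  ext i l; fin_cases i <;> fin_cases l <;>
    simp [Matrix.mul_apply, Fin.sum_univ_four, hκ0]

lemma twist_mul_outerHom {g : isoU p m κ} (hκ0 : κ ≠ 0) {μ : kˣ} (hμ : j μ = κ * κ)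
    (hg : isoMat g = !![0, 0, 0, κ; 0, κ, 0, 0; 0, 0, -κ⁻¹, 0; κ⁻¹, 0, 0, 0]) (c : k) :
    g * outerHom p m κ j hj (slX c) = outerHom p m κ j hj (slY ((μ : k)⁻¹ * c)) * g := by
  refine isoMat_injective ?_
  rw [isoMat_mul, isoMat_mul, mat_outerHom, mat_outerHom, hg, coe_slX, coe_slY]
  ext i l; fin_cases i <;> fin_cases l <;>
    simp [outerMat, Matrix.mul_apply, Fin.sum_univ_four, hμ]
  field_simp

lemma not_orderRestricted_twist {g : isoU p m κ} (hκ0 : κ ≠ 0) (hp : Odd p) (hm : m ≠ 0)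
    (hq : p ^ m % 4 = 1) (hκN : ∀ N, κ ^ N = 1 → 2 * (p ^ m - 1) ∣ N)
    (hg : isoMat g = !![0, 0, 0, κ; 0, κ, 0, 0; 0, 0, -κ⁻¹, 0; κ⁻¹, 0, 0, 0]) :
    ¬ OrderRestricted g := by
  rintro ⟨N, c, hN0, hN, hdvd⟩
  have hsq : isoMat g ^ 2 = diagonal ![1, κ ^ 2, (κ ^ 2)⁻¹, 1] := by
    rw [pow_two, hg]
    ext i l; fin_cases i <;> fin_cases l <;>
      simp [Matrix.mul_apply, Fin.sum_univ_four, hκ0, pow_two]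
  have hκ1 : κ ^ N = 1 := by
    obtain ⟨l, rfl | rfl⟩ := Nat.even_or_odd' N
    · rw [pow_mul, hsq, diagonal_pow] at hN
      have h0 := congrFun (congrFun hN 0) 0
      have h1 := congrFun (congrFun hN 1) 1
      simp at h0 h1
      rw [pow_mul, h1, ← h0]
    · rw [pow_succ, pow_mul, hsq, diagonal_pow, hg] at hN
      have h0 := congrFun (congrFun hN 0) 3
      simp [Matrix.mul_apply, Fin.sum_univ_four] at h0
      exact absurd h0 hκ0
  have h1 := hκN N hκ1
  have hp2 : p ^ 2 % 4 = 1 := by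
    obtain ⟨l, rfl⟩ := hp
    rw [show (2 * l + 1) ^ 2 = 4 * (l * l + l) + 1 by ring]
    omega
  have hqgt : 1 < p ^ m := Nat.one_lt_pow hm (Fact.out : p.Prime).one_lt
  set q := p ^ m
  obtain ⟨b, hb⟩ : ∃ b, p ^ 2 = 4 * b + 1 := ⟨p ^ 2 / 4, by omega⟩
  obtain ⟨a, ha⟩ : ∃ a, q = 4 * a + 1 := ⟨q / 4, by omega⟩
  rw [if_pos hq, hb, ha] at hdvd
  rw [ha] at h1
  rcases hdvd with h | h
  · have h2 := h1.trans h
    have h3 : 8 ∣ (4 * a + 1 + 1) * (4 * b + 1) := (Dvd.intro a (by omega)).trans h2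
    have h4 : (4 * a + 1 + 1) * (4 * b + 1) = 4 * (4 * a * b + a + 2 * b) + 2 := by ring
    omega
  · have h2 := h1.trans h
    have h3 : ((4 * a + 1) ^ 2 - 1) / 2 * (4 * b + 1) =
        (4 * a) * (2 * (4 * a * b + a + 2 * b) + 1) := by
      have : (4 * a + 1) ^ 2 - 1 = 2 * (4 * a * (2 * a + 1)) := by
        rw [show (4 * a + 1) ^ 2 = 2 * (4 * a * (2 * a + 1)) + 1 by ring, Nat.add_sub_cancel]
      rw [this, Nat.mul_div_cancel_left _ (by norm_num)]
      ring
    rw [h3, show 2 * (4 * a + 1 - 1) = 4 * a * 2 by omega] at h2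
    have h5 := Nat.dvd_of_mul_dvd_mul_left (by omega) h2
    omega

variable [Fintype F] [Fintype k]
  {hσ : ∀ a : F, iterateFrobenius F p m (iterateFrobenius F p m a) = a}
  {K V : Type*} [Field K] [CharP K p] [AddCommGroup V] [Module K V]
  {ι : F →+* K} {π : isoU p m κ →* Module.End K V} {hp : 5 ≤ p} {v : V} {A B : ℕ}

/-- In the case `q ≡ 1 mod 4`, the outer torus fixes every vector fixed by the inner torus. -/
lemma outerHom_slH_apply_eq_self (hp : Odd p) (hm : m ≠ 0) (hq : p ^ m % 4 = 1) (hκ0 : κ ≠ 0)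
    (hκ : iterateFrobenius F p m κ = -κ) (hκN : ∀ N, κ ^ N = 1 → 2 * (p ^ m - 1) ∣ N)
    (hsurj : ∀ a, iterateFrobenius F p m a = a → ∃ b, j b = a)
    (hfix : ∀ g w, w ≠ 0 → π g w = w → OrderRestricted g) {w : V}
    (hw : ∀ t : kˣ, π (innerHom p m κ j hj (slH t)) w = w) (t : kˣ) :
    π (outerHom p m κ j hj (slH t)) w = w := by
  obtain ⟨g, hg⟩ := exists_twist (p := p) (m := m) hκ0 hκ
  obtain ⟨μ', hμ'⟩ := hsurj (κ * κ) (by rw [map_mul, hκ, neg_mul_neg])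
  have hμ0 : μ' ≠ 0 := fun h => by
    rw [h, map_zero, eq_comm, mul_self_eq_zero] at hμ'
    exact hκ0 hμ'
  let μ : kˣ := Units.mk0 μ' hμ0
  have hμ : j μ = κ * κ := hμ'
  have hgg := twist_mul_self (hj := hj) hκ0 hμ hg
  let X : Submodule K V := LinearMap.ker (π (innerHom p m κ j hj (slH μ)) - 1)
  have hX : ∀ w, w ∈ X ↔ π (innerHom p m κ j hj (slH μ)) w = w := fun w => by
    rw [LinearMap.mem_ker, LinearMap.sub_apply, Module.End.one_apply, sub_eq_zero]
  have hst : ∀ s, ∀ w ∈ X, (π.comp (outerHom p m κ j hj)) s w ∈ X := by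
    intro s w hw
    rw [hX] at hw ⊢
    rw [MonoidHom.comp_apply, ← apply_mul, ← (commute_outerHom_innerHom j hj _ _).eq, apply_mul, hw]
  have hneg : ∀ w ∈ X, π g w = -w := by
    intro w hw
    rw [hX, ← hgg, apply_mul] at hw
    by_contra hne
    refine not_orderRestricted_twist hκ0 hp hm hq hκN hg (hfix g (w + π g w) ?_ ?_)
    · intro h
      exact hne (eq_neg_of_add_eq_zero_right h)
    · rw [map_add, hw, add_comm]
  have : CharP k p := (RingHom.charP_iff j j.injective p).mpr inferInstance
  have h := map_slH_eq_one hp (restrictRep (π.comp (outerHom p m κ j hj)) X hst) (μ : k)⁻¹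
    (fun c => by
      refine LinearMap.ext fun x => Subtype.ext ?_
      change π (outerHom p m κ j hj (slX c)) x = π (outerHom p m κ j hj (slY ((μ : k)⁻¹ * c))) x
      have h1 := congrArg (fun y => π y (x : V)) (twist_mul_outerHom (hj := hj) hκ0 hμ hg c)
      simp only [apply_mul] at h1
      rw [hneg x x.2, show π g (π (outerHom p m κ j hj (slX c)) x) = _ from
        hneg _ (hst (slX c) x x.2), map_neg] at h1
      exact neg_injective h1) t
  exact congrArg Subtype.val (LinearMap.congr_fun h ⟨w, (hX w).mpr (hw μ)⟩)

lemma IsHighestWeight.levi_ne_zero (hv : IsHighestWeight j hj hσ ι π hp v A B)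
    (hB : ∀ g : isoU p m κ, g ^ p = 1 → ∑ i ∈ Finset.range p, π (g ^ i) = 0)
    (hF : Fintype.card F = (p ^ m) ^ 2) (hm : m ≠ 0)
    (hfix : ∀ g w, w ≠ 0 → π g w = w → OrderRestricted g) : A ≠ 0 := by
  rintro rfl
  have hodd : Odd p := (Fact.out : p.Prime).odd_of_ne_two (by omega)
  have hx : ∀ a, π (leviHom p m κ hσ (slX a)) v = v :=
    fun a => hv.uni _ (leviHom_slX_mem hσ hp a)
  have hQ : Fintype.card F = p ^ (m * 2) := by rw [hF, pow_mul]
  have hds : digitSum p (Fintype.card F - 1) = m * 2 * (p - 1) := by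
    rw [hQ, digitSum_pow_sub_one (by omega)]
  have hlast := leviCoeff_eq_zero hσ ι π j hj hp hB (n := Fintype.card F - 1) (by
    rw [hds]; exact Nat.le_mul_of_pos_left _ (by omega))
  have hzero : ∀ n, 0 < n → n < Fintype.card F →
      familyCoeff ι (fun c => π (leviHom p m κ hσ (slY c))) n v = 0 := by
    intro n hn0 hn
    rcases eq_or_ne n (Fintype.card F - 1) with rfl | hne
    · rw [hlast, LinearMap.zero_apply]
    by_cases hsmall : p - 1 ≤ digitSum p n
    · rw [leviCoeff_eq_zero hσ ι π j hj hp hB hsmall, LinearMap.zero_apply]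
    have h := rankOne_reflection ι (π.comp (leviHom p m κ hσ)) v 0 hv.lt_levi hlast hx hv.levi
      (n := n) (by omega)
    rw [show revExp (Fintype.card F) 0 n = Fintype.card F - 1 - n by
      rw [revExp, if_neg (by omega), zero_add]] at h
    have h2 := digitSum_add_le (p := p) n (Fintype.card F - 1 - n)
    rw [show n + (Fintype.card F - 1 - n) = Fintype.card F - 1 by omega, hds] at h2
    have h3 : 2 * (p - 1) ≤ m * 2 * (p - 1) := Nat.mul_le_mul_right _ (by omega)
    have h4 := leviCoeff_eq_zero hσ ι π j hj hp hB (n := Fintype.card F - 1 - n) (by omega)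
    refine h.trans ?_
    rw [show familyCoeff ι (fun c => (π.comp (leviHom p m κ hσ)) (slY c))
      (Fintype.card F - 1 - n) = 0 from h4, LinearMap.zero_apply, map_zero, smul_zero]
  have hy : ∀ c, π (leviHom p m κ hσ (slY c)) v = v := by
    intro c
    have h := sum_familyCoeff ι (fun c => π (leviHom p m κ hσ (slY c)) v) c
    rw [Finset.sum_eq_single 0] at h
    · rw [← h, pow_zero, one_smul, familyCoeff_zero, slY_zero, map_one, map_one,
        Module.End.one_apply]
    · intro n hn hn0
      rw [← familyCoeff_apply, hzero n (by omega) (Finset.mem_range.mp hn), smul_zero]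
    · intro h0
      exact absurd (Finset.mem_range.mpr Fintype.card_pos) h0
  let S : Submonoid (SpecialLinearGroup (Fin 2) F) :=
    { carrier := {g | π (leviHom p m κ hσ g) v = v}
      one_mem' := by
        change π (leviHom p m κ hσ 1) v = v
        rw [map_one, map_one, Module.End.one_apply]
      mul_mem' := fun {a b} ha hb => by
        change π (leviHom p m κ hσ (a * b)) v = v
        rw [map_mul, apply_mul, hb, ha] }
  obtain ⟨r, hr, hrq, hr2⟩ := exists_odd_prime_dvd_sq_add_one (hodd.pow (n := m))
    (Nat.one_lt_pow hm (by omega))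
  obtain ⟨t, ht, ht1, -⟩ := exists_regular (F := F) hr hr2 (by rwa [hF]) hodd
  exact not_orderRestricted_levi hodd hσ hr hr2 hrq ht ht1 hm
    (hfix _ v hv.ne_zero (sl_mem_of_slX_slY (S := S) hx hy t))

lemma eq_zero_of_forall_pow_eq_one {p m A : ℕ} {k : Type*} [Field k] [Fintype k] (hp : 1 < p)
    (hk : Fintype.card k = p ^ m) (hds : digitSum p A < p - 1) (h : ∀ t : kˣ, t ^ A = 1) :
    A = 0 := by
  classical
  obtain ⟨g, hg⟩ := IsCyclic.exists_generator (α := kˣ)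
  have h1 : p ^ m - 1 ∣ A := by
    rw [← hk, ← Fintype.card_units, ← Nat.card_eq_fintype_card,
      ← orderOf_eq_card_of_forall_mem_zpowers hg]
    exact orderOf_dvd_of_pow_eq_one (h g)
  have h2 : p - 1 ∣ A := (by simpa using Nat.sub_dvd_pow_sub_pow p 1 m : p - 1 ∣ p ^ m - 1).trans h1
  have h3 := digitSum_modEq hp A
  have h4 : p - 1 ∣ digitSum p A := (Nat.modEq_zero_iff_dvd.mp
    (h3.symm.trans (Nat.modEq_zero_iff_dvd.mpr h2)))
  have h5 := Nat.eq_zero_of_dvd_of_lt h4 hds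
  by_contra hA
  exact absurd h5 (digitSum_pos hp (Nat.pos_of_ne_zero hA)).ne'

lemma false_of_one_mod_four [Nontrivial V] (hp : 5 ≤ p) (ι : F →+* K)
    (hj : ∀ a, iterateFrobenius F p m (j a) = j a)
    (hσ : ∀ a : F, iterateFrobenius F p m (iterateFrobenius F p m a) = a)
    (hsurj : ∀ a, iterateFrobenius F p m a = a → ∃ b, j b = a)
    (hk : Fintype.card k = p ^ m) (hF : Fintype.card F = (p ^ m) ^ 2) (hm : m ≠ 0)
    (hq : p ^ m % 4 = 1) (hκ0 : κ ≠ 0)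
    (hκ : iterateFrobenius F p m κ = -κ) (hκN : ∀ N, κ ^ N = 1 → 2 * (p ^ m - 1) ∣ N)
    (hfix : ∀ g w, w ≠ 0 → π g w = w → OrderRestricted g)
    (hB : ∀ g : isoU p m κ, g ^ p = 1 → ∑ i ∈ Finset.range p, π (g ^ i) = 0) : False := by
  obtain ⟨v, A, B, hv⟩ := exists_isHighestWeight j hj hσ ι π hp
  obtain ⟨w, hw0, hwi, hwo⟩ := hv.exists_middle hB hk hF hm hsurj
  have hds := hv.digitSum_lt hB hk hF hm
  refine hv.levi_ne_zero hB hF hm hfix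
    (eq_zero_of_forall_pow_eq_one (by omega) hk (by omega) fun t => ?_)
  have h1 := outerHom_slH_apply_eq_self ((Fact.out : p.Prime).odd_of_ne_two (by omega)) hm hq hκ0
    hκ hκN hsurj hfix hwi t
  rw [hwo, ← sub_eq_zero, ← one_smul K w, smul_smul, ← sub_smul, smul_eq_zero,
    or_iff_left hw0, mul_one, sub_eq_zero] at h1
  refine Units.ext (j.injective (ι.injective ?_))
  rw [Units.val_pow_eq_pow_val, map_pow, map_pow, h1, Units.val_one, map_one, map_one]

end OneModFour

section RotationGroup

variable {k : Type*} [Field k]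

/-- The rotation subgroup of `SL₂`: the centralizer of the Weyl element. -/
def rotGroup (k : Type*) [Field k] : Subgroup (SpecialLinearGroup (Fin 2) k) where
  carrier := {g | (g : Matrix (Fin 2) (Fin 2) k) 1 1 = (g : Matrix (Fin 2) (Fin 2) k) 0 0 ∧
    (g : Matrix (Fin 2) (Fin 2) k) 0 1 = -(g : Matrix (Fin 2) (Fin 2) k) 1 0}
  one_mem' := by simp
  mul_mem' := by
    rintro a b ⟨a1, a2⟩ ⟨b1, b2⟩
    simp only [Matrix.SpecialLinearGroup.coe_mul, Matrix.mul_apply, Fin.sum_univ_two, a1, a2, b1,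
      b2, Set.mem_ofPred_eq]
    constructor <;> ring
  inv_mem' := by
    rintro a ⟨a1, a2⟩
    simp [Matrix.SpecialLinearGroup.coe_inv, Matrix.adjugate_fin_two, a1, a2]

lemma mem_rotGroup {g : SpecialLinearGroup (Fin 2) k} : g ∈ rotGroup k ↔
    (g : Matrix (Fin 2) (Fin 2) k) 1 1 = (g : Matrix (Fin 2) (Fin 2) k) 0 0 ∧
    (g : Matrix (Fin 2) (Fin 2) k) 0 1 = -(g : Matrix (Fin 2) (Fin 2) k) 1 0 := Iff.rfl

/-- The rotation with given first column. -/
def rotMk (α β : k) (h : α ^ 2 + β ^ 2 = 1) : SpecialLinearGroup (Fin 2) k :=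
  ⟨!![α, -β; β, α], by rw [Matrix.det_fin_two_of, ← h]; ring⟩

lemma coe_rotMk (α β : k) (h : α ^ 2 + β ^ 2 = 1) :
    (rotMk α β h : Matrix (Fin 2) (Fin 2) k) = !![α, -β; β, α] := rfl

lemma rotMk_mem (α β : k) (h : α ^ 2 + β ^ 2 = 1) : rotMk α β h ∈ rotGroup k := by
  simp [mem_rotGroup, coe_rotMk]

lemma exists_eq_rotMk {g : SpecialLinearGroup (Fin 2) k} (hg : g ∈ rotGroup k) :
    ∃ α β h, g = rotMk α β h := by
  rw [mem_rotGroup] at hg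
  have hd := g.det_coe
  rw [Matrix.det_fin_two, hg.1, hg.2] at hd
  refine ⟨(g : Matrix (Fin 2) (Fin 2) k) 0 0, (g : Matrix (Fin 2) (Fin 2) k) 1 0,
    by linear_combination hd, coe_sl_injective ?_⟩
  ext i l
  fin_cases i <;> fin_cases l <;> simp [coe_rotMk, hg.1, hg.2]

lemma rotMk_eq_of_ne_zero (α β : k) (h : α ^ 2 + β ^ 2 = 1) (hα : α ≠ 0) :
    rotMk α β h = slY (β / α) * slH (Units.mk0 α hα) * slX (-(β / α)) := by
  refine coe_sl_injective ?_
  simp [coe_rotMk, coe_slY, coe_slH, coe_slX]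
  refine ⟨by field_simp, by field_simp, ?_⟩
  field_simp
  linear_combination h

lemma rotMk_eq_of_eq_zero (β : kˣ) (h : (0 : k) ^ 2 + (β : k) ^ 2 = 1) :
    rotMk 0 (β : k) h = slW * slH β := by
  refine coe_sl_injective ?_
  simp [coe_rotMk, coe_slH, coe_slW]
  field_simp
  linear_combination h

/-- A power sum over the rotation group. -/
lemma sum_rotGroup_pow_ne_zero {p : ℕ} [Fact p.Prime] (hp : Odd p) {a : ℕ} (ha0 : 0 < a)
    (ha : a < p - 1) (hae : Even a) [Fintype (rotGroup (ZMod p))] :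
    ∑ t : rotGroup (ZMod p),
      ((t : SpecialLinearGroup (Fin 2) (ZMod p)) : Matrix (Fin 2) (Fin 2) (ZMod p)) 0 0 ^ a ≠
        0 := by
  classical
  have hp2 : ringChar (ZMod p) ≠ 2 := by
    rw [ZMod.ringChar_zmod_n]
    rintro rfl
    exact absurd hp (by decide)
  have hcard : Fintype.card (ZMod p) = p := ZMod.card p
  obtain ⟨h, hh⟩ := hp
  obtain ⟨b, hb⟩ := hae
  have hfib : ∀ α : ZMod p, ((Finset.univ.filter fun t : rotGroup (ZMod p) =>
      ((t : SpecialLinearGroup (Fin 2) (ZMod p)) : Matrix (Fin 2) (Fin 2) (ZMod p)) 0 0 = α).card :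
        ZMod p) = (1 - α ^ 2) ^ h + 1 := by
    intro α
    have h1 := congrArg (Int.cast : ℤ → ZMod p) (quadraticChar_card_sqrts hp2 (1 - α ^ 2))
    rw [Int.cast_natCast, Int.cast_add, quadraticChar_eq_pow_of_char_ne_two' hp2, hcard,
      Int.cast_one, show p / 2 = h by omega] at h1
    rw [← h1]
    congr 1
    refine Finset.card_bij (fun t _ => ((t : SpecialLinearGroup (Fin 2) (ZMod p)) :
      Matrix (Fin 2) (Fin 2) (ZMod p)) 1 0) ?_ ?_ ?_
    · rintro ⟨t, ht⟩ hα
      obtain ⟨α', β, hαβ, rfl⟩ := exists_eq_rotMk ht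
      simp [coe_rotMk] at hα ⊢
      subst hα
      linear_combination hαβ
    · rintro ⟨t, ht⟩ hα ⟨s, hs⟩ hα' hst
      obtain ⟨α₁, β₁, h₁, rfl⟩ := exists_eq_rotMk ht
      obtain ⟨α₂, β₂, h₂, rfl⟩ := exists_eq_rotMk hs
      simp [coe_rotMk] at hα hα' hst
      subst hα hα' hst
      rfl
    · intro β hβ
      simp at hβ
      exact ⟨⟨rotMk α β (by rw [hβ]; ring), rotMk_mem _ _ _⟩, by simp [coe_rotMk], by
        simp [coe_rotMk]⟩
  have hsum : ∑ t : rotGroup (ZMod p),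
      ((t : SpecialLinearGroup (Fin 2) (ZMod p)) : Matrix (Fin 2) (Fin 2) (ZMod p)) 0 0 ^ a =
      ∑ α : ZMod p, ((1 - α ^ 2) ^ h + 1) * α ^ a := by
    rw [← Finset.sum_fiberwise Finset.univ (fun t : rotGroup (ZMod p) =>
      ((t : SpecialLinearGroup (Fin 2) (ZMod p)) : Matrix (Fin 2) (Fin 2) (ZMod p)) 0 0)]
    refine Finset.sum_congr rfl fun α _ => ?_
    rw [← hfib, ← nsmul_eq_mul, ← Finset.sum_const]
    refine Finset.sum_congr rfl fun t ht => ?_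
    rw [(Finset.mem_filter.mp ht).2]
  have hpow : ∀ i, 0 < i → ∑ α : ZMod p, α ^ i = if p - 1 ∣ i then -1 else 0 := by
    intro i hi
    have h1 := FiniteField.sum_pow_units (ZMod p) i
    rw [hcard] at h1
    rw [← h1, ← Finset.sum_subset (Finset.subset_univ (Finset.univ.filter fun α : ZMod p => α ≠ 0))]
    · symm
      exact Finset.sum_bij (fun t _ => (t : ZMod p)) (by simp) (by simp [Units.ext_iff])
        (fun α hα => ⟨Units.mk0 α (Finset.mem_filter.mp hα).2, by simp, rfl⟩) (by simp)
    · intro α _ hα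
      simp at hα
      rw [hα, zero_pow hi.ne']
  rw [hsum]
  simp only [add_mul, one_mul, Finset.sum_add_distrib]
  rw [hpow a ha0, if_neg (Nat.not_dvd_of_pos_of_lt ha0 ha), add_zero]
  have hexp : ∀ α : ZMod p, (1 - α ^ 2) ^ h * α ^ a =
      ∑ i ∈ Finset.range (h + 1), ((-1) ^ i * (h.choose i : ZMod p)) * α ^ (a + 2 * i) := by
    intro α
    rw [sub_eq_neg_add, add_pow, Finset.sum_mul]
    refine Finset.sum_congr rfl fun i _ => ?_
    rw [neg_pow, one_pow, pow_add, pow_mul]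
    ring
  simp only [hexp]
  rw [Finset.sum_comm]
  simp only [← Finset.mul_sum]
  rw [Finset.sum_eq_single (h - b)]
  · rw [hpow _ (by omega), if_pos ⟨1, by omega⟩]
    refine mul_ne_zero (mul_ne_zero (pow_ne_zero _ (by simp)) ?_) (by simp)
    rw [Ne, CharP.cast_eq_zero_iff (ZMod p) p]
    intro hd
    have h2 : p ∣ h.factorial := by
      rw [← Nat.choose_mul_factorial_mul_factorial (show h - b ≤ h by omega), mul_assoc]
      exact hd.mul_right _
    rw [(Fact.out : p.Prime).dvd_factorial] at h2
    omega
  · intro i hi hne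
    rw [Finset.mem_range] at hi
    rw [hpow _ (by omega), if_neg, mul_zero]
    rintro ⟨c, hc⟩
    have hc2 : c < 2 := by
      by_contra hc2
      have : (p - 1) * 2 ≤ (p - 1) * c := Nat.mul_le_mul_left _ (by omega)
      omega
    interval_cases c <;> omega
  · intro hn
    exact absurd (Finset.mem_range.mpr (by omega)) hn

end RotationGroup

/-- A representation of `SL₂(p)` in characteristic `p`, trivial on the centre and without Jordan
blocks of size `p`, has a nonzero vector fixed by the rotation group. -/
lemma exists_rotGroup_fixed {p : ℕ} [Fact p.Prime] (hp : Odd p) {K X : Type*} [Field K] [CharP K p]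
    [AddCommGroup X] [Module K X] [Nontrivial X]
    (τ : SpecialLinearGroup (Fin 2) (ZMod p) →* Module.End K X) (hneg : τ (slH (-1)) = 1)
    (hB : ∀ g, g ^ p = 1 → ∑ i ∈ Finset.range p, τ (g ^ i) = 0) :
    ∃ w, w ≠ 0 ∧ ∀ g ∈ rotGroup (ZMod p), τ g w = w := by
  classical
  have hp2 : 2 < p := by
    have := (Fact.out : p.Prime).two_le
    obtain ⟨l, rfl⟩ := hp
    omega
  have hcard : Fintype.card (ZMod p) = p := ZMod.card p
  let ι : ZMod p →+* K := ZMod.castHom dvd_rfl K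
  have hy : ∀ c d, τ (slY (c + d)) = τ (slY c) * τ (slY d) := fun c d => by rw [slY_add, map_mul]
  have hlast : familyCoeff ι (fun c => τ (slY c)) (Fintype.card (ZMod p) - 1) = 0 := by
    have h := familyCoeff_mul_mul_eq_zero ι ι ι (p := p) (y₁ := fun c => τ (slY c))
      (y₂ := fun _ => 1) (y₃ := fun _ => 1) hp2 hy (by simp) (by simp)
      (fun _ _ => Commute.one_left _) (fun c _ _ => by
        have h1 := hB (slY c) (by
          rw [← slY_natCast_mul, CharP.cast_eq_zero, zero_mul, slY_zero])
        rw [← h1]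
        exact Finset.sum_congr rfl fun i _ => by rw [mul_one, mul_one, slY_natCast_mul])
      (p - 1) 0 0 (by rw [digitSum_of_lt (by omega)]; omega)
    rw [familyCoeff_zero, mul_one, mul_one] at h
    rw [hcard, h]
  obtain ⟨v₀, hv₀, hv₀x⟩ := exists_fixed_of_isPGroup (p := p) (U := Multiplicative (ZMod p))
    (IsPGroup.of_card (n := 1) (by simp)) (V := X)
    { toFun := fun c => τ (slX c.toAdd)
      map_one' := by rw [toAdd_one, slX_zero, map_one]
      map_mul' := fun c d => by rw [toAdd_mul, slX_add, map_mul] }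
  let Y : Submodule K X :=
    { carrier := {v | ∀ c, τ (slX c) v = v}
      zero_mem' := fun c => map_zero _
      add_mem' := fun ha hb c => by rw [map_add, ha c, hb c]
      smul_mem' := fun r a ha c => by rw [map_smul, ha c] }
  obtain ⟨a, ha, v, hv, hv0, hva⟩ := exists_weight ι (τ.comp (slHHom (ZMod p))) Y
    (fun t v hv c => by
      have h := slH_mul_slX t ((t : ZMod p)⁻¹ * (t : ZMod p)⁻¹ * c)
      rw [show (t : ZMod p) * t * ((t : ZMod p)⁻¹ * (t : ZMod p)⁻¹ * c) = c by field_simp] at h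
      change τ (slX c) (τ (slH t) v) = τ (slH t) v
      rw [← Module.End.mul_apply, ← map_mul, ← h, map_mul, Module.End.mul_apply, hv])
    (v := v₀) (fun c => hv₀x (Multiplicative.ofAdd c)) hv₀
  change ∀ t : (ZMod p)ˣ, τ (slH t) v = _ at hva
  rw [hcard] at ha
  have hae : Even a := by
    have h := hva (-1)
    rw [hneg, Module.End.one_apply, Units.val_neg, Units.val_one, map_neg, map_one] at h
    by_contra hodd
    rw [Nat.not_even_iff_odd] at hodd
    rw [hodd.neg_one_pow, neg_one_smul, eq_neg_iff_add_eq_zero, ← two_smul K, smul_eq_zero] at h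
    rcases h with h | h
    · have h2 : ((2 : ℕ) : K) = 0 := by exact_mod_cast h
      rw [CharP.cast_eq_zero_iff K p] at h2
      exact absurd (Nat.le_of_dvd two_pos h2) (by omega)
    · exact hv0 h
  have hw := rankOne_highest ι τ v a (by rw [hcard]; exact ha) hlast hv hva
  rcases Nat.eq_zero_or_pos a with rfl | ha0
  · rw [familyCoeff_zero, slY_zero, map_one, Module.End.one_apply] at hw
    refine ⟨v, hv0, fun g _ => ?_⟩
    let S : Submonoid (SpecialLinearGroup (Fin 2) (ZMod p)) :=
      { carrier := {g | τ g v = v}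
        one_mem' := by
          change τ 1 v = v
          rw [map_one, Module.End.one_apply]
        mul_mem' := fun {a b} ha hb => by
          change τ (a * b) v = v
          rw [map_mul, Module.End.mul_apply, hb, ha] }
    refine sl_mem_of_slX_slY (S := S) hv (fun c => ?_) g
    change τ (slY c) v = v
    conv_lhs => rw [hw]
    rw [← Module.End.mul_apply, ← map_mul, show slY c * slW = slW * slX (-c) by
      rw [slW_mul_slX, neg_neg], map_mul, Module.End.mul_apply, hv, ← hw]
  have hNa : familyCoeff ι (fun c => τ (slY c)) a v ≠ 0 := by
    rw [hw]
    intro h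
    have h1 : τ (slW⁻¹ * slW) v = 0 := by rw [map_mul, Module.End.mul_apply, h, map_zero]
    rw [inv_mul_cancel, map_one, Module.End.one_apply] at h1
    exact hv0 h1
  let N := Nat.findGreatest (fun n => familyCoeff ι (fun c => τ (slY c)) n v ≠ 0) p
  have hN : familyCoeff ι (fun c => τ (slY c)) N v ≠ 0 :=
    Nat.findGreatest_spec (P := fun n => familyCoeff ι (fun c => τ (slY c)) n v ≠ 0)
      (show a ≤ p by omega) hNa
  have hN0 : 0 < N := ha0.trans_le (Nat.le_findGreatest (by omega) hNa)
  have hgt : ∀ n, N < n → familyCoeff ι (fun c => τ (slY c)) n v = 0 := by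
    intro n hn
    rcases lt_or_ge n p with hnp | hnp
    · by_contra hne
      exact Nat.findGreatest_is_greatest hn hnp.le hne
    · rw [familyCoeff_of_le ι _ (by rwa [hcard]), LinearMap.zero_apply]
  set f := familyCoeff ι (fun c => τ (slY c)) N with hf
  have hfy : ∀ d, f (τ (slY d) v) = f v := by
    intro d
    have h1 := sum_familyCoeff ι (fun c => τ (slY c) v) d
    rw [← h1, map_sum, Finset.sum_eq_single 0]
    · rw [pow_zero, one_smul, familyCoeff_zero, slY_zero, map_one, Module.End.one_apply]
    · intro n _ hn
      rw [map_smul, ← familyCoeff_apply, ← Module.End.mul_apply, hf, familyCoeff_mul ι _ hy,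
        LinearMap.smul_apply, hgt _ (by omega), smul_zero, smul_zero]
    · intro h0
      exact absurd (Finset.mem_range.mpr Fintype.card_pos) h0
  have hfw : f (τ slW v) = 0 := by
    have h1 : (fun c => τ (slY c) (τ slW v)) = fun c => τ (slY (0 * c)) (τ slW v) := by
      funext c
      rw [zero_mul, slY_zero, map_one, Module.End.one_apply, ← Module.End.mul_apply, ← map_mul,
        show slY c * slW = slW * slX (-c) by rw [slW_mul_slX, neg_neg], map_mul,
        Module.End.mul_apply, hv]
    rw [hf, familyCoeff_apply, h1, familyCoeff_scale ι (fun c => τ (slY c) (τ slW v)), map_zero,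
      zero_pow hN0.ne', zero_smul]
  have hrot : ∀ t : rotGroup (ZMod p), f (τ t v) =
      ι (((t : SpecialLinearGroup (Fin 2) (ZMod p)) : Matrix (Fin 2) (Fin 2) (ZMod p)) 0 0) ^ a •
        f v := by
    rintro ⟨t, ht⟩
    obtain ⟨α, β, h, rfl⟩ := exists_eq_rotMk ht
    rw [Subtype.coe_mk, coe_rotMk]
    by_cases hα : α = 0
    · subst hα
      have hβ : β ≠ 0 := by
        rintro rfl
        simp at h
      have h1 : rotMk 0 β h = slW * slH (Units.mk0 β hβ) := rotMk_eq_of_eq_zero (Units.mk0 β hβ) h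
      rw [h1, map_mul, Module.End.mul_apply, hva, map_smul, map_smul, hfw, smul_zero]
      simp [ha0.ne']
    · rw [rotMk_eq_of_ne_zero α β h hα, map_mul, map_mul, Module.End.mul_apply,
        Module.End.mul_apply, hv, hva, map_smul, map_smul, hfy]
      simp
  refine ⟨∑ t : rotGroup (ZMod p), τ t v, fun h => ?_, fun g hg => ?_⟩
  · have h1 := congrArg f h
    rw [map_sum, map_zero, Finset.sum_congr rfl fun t _ => hrot t, ← Finset.sum_smul,
      smul_eq_zero, or_iff_left hN] at h1
    refine sum_rotGroup_pow_ne_zero hp ha0 ha hae (ι.injective ?_)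
    rw [map_sum, map_zero, ← h1]
    exact Finset.sum_congr rfl fun t _ => map_pow _ _ _
  · rw [map_sum]
    refine Fintype.sum_equiv (Equiv.mulLeft (⟨g, hg⟩ : rotGroup (ZMod p))) _ _ fun t => ?_
    rw [Equiv.coe_mulLeft, Subgroup.coe_mul, map_mul, Module.End.mul_apply]

lemma exists_eq_of_pow_card_eq {k F : Type*} [Field k] [Fintype k] [Field F] (j : k →+* F) {a : F}
    (ha : a ^ Fintype.card k = a) : ∃ b, j b = a := by
  classical
  have hne := FiniteField.X_pow_card_sub_X_ne_zero F (Fintype.one_lt_card (α := k))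
  have hsub : Finset.univ.image j ⊆
      (Polynomial.X ^ Fintype.card k - Polynomial.X : Polynomial F).roots.toFinset := by
    intro x hx
    obtain ⟨b, -, rfl⟩ := Finset.mem_image.mp hx
    rw [Multiset.mem_toFinset, Polynomial.mem_roots hne, Polynomial.IsRoot, Polynomial.eval_sub,
      Polynomial.eval_pow, Polynomial.eval_X, ← map_pow, FiniteField.pow_card, sub_self]
  have heq := Finset.eq_of_subset_of_card_le hsub (by
    refine (Multiset.toFinset_card_le _).trans ((Polynomial.card_roots' _).trans ?_)
    rw [FiniteField.X_pow_card_sub_X_natDegree_eq F Fintype.one_lt_card,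
      Finset.card_image_of_injective _ j.injective, Finset.card_univ])
  have hmem : a ∈ Finset.univ.image j := by
    rw [heq, Multiset.mem_toFinset, Polynomial.mem_roots hne, Polynomial.IsRoot,
      Polynomial.eval_sub, Polynomial.eval_pow, Polynomial.eval_X, ha, sub_self]
  obtain ⟨b, -, hb⟩ := Finset.mem_image.mp hmem
  exact ⟨b, hb⟩

/-- The rotation group of a field of `p ≡ 3 mod 4` elements contains an element of order divisible
by `p + 1`. -/
lemma exists_rotGroup_generator {p m : ℕ} [Fact p.Prime] (hp4 : p % 4 = 3) {F : Type*} [Field F]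
    [Fintype F] [CharP F p] (hF : Fintype.card F = (p ^ m) ^ 2) :
    ∃ g ∈ rotGroup (ZMod p), ∀ N, g ^ N = 1 → p + 1 ∣ N := by
  classical
  have h2 : (2 : F) ≠ 0 := by
    intro h
    have h' : ((2 : ℕ) : F) = 0 := by exact_mod_cast h
    rw [CharP.cast_eq_zero_iff F p] at h'
    have := Nat.le_of_dvd two_pos h'
    omega
  obtain ⟨i, hi⟩ : IsSquare (-1 : F) := by
    rw [FiniteField.isSquare_neg_one_iff, hF]
    obtain ⟨l, hl⟩ : Odd (p ^ m) := Odd.pow (Nat.odd_iff.mpr (by omega))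
    rw [hl, show (2 * l + 1) ^ 2 = 4 * (l * l + l) + 1 by ring]
    omega
  have hi0 : i ≠ 0 := by
    rintro rfl
    simp at hi
  obtain ⟨γ, hγ⟩ := IsCyclic.exists_generator (α := Fˣ)
  have hdvd : p + 1 ∣ Fintype.card F - 1 := by
    have h1 : p ^ 2 - 1 ∣ Fintype.card F - 1 := by
      rw [hF, ← pow_mul, mul_comm, pow_mul]
      simpa using Nat.sub_dvd_pow_sub_pow (p ^ 2) 1 m
    exact (Dvd.intro (p - 1) (by rw [← Nat.sq_sub_sq, one_pow])).trans h1
  obtain ⟨d, hd⟩ := hdvd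
  have hF1 : 0 < Fintype.card F - 1 := Nat.sub_pos_of_lt Fintype.one_lt_card
  have hd0 : d ≠ 0 := by
    rintro rfl
    omega
  have hγo : orderOf γ = (p + 1) * d := by
    rw [orderOf_eq_card_of_forall_mem_zpowers hγ, Nat.card_eq_fintype_card, Fintype.card_units, hd]
  have hζo : orderOf (γ ^ d) = p + 1 := by
    rw [orderOf_pow_of_dvd hd0 (by rw [hγo]; exact Dvd.intro_left _ rfl), hγo,
      Nat.mul_div_cancel _ (Nat.pos_of_ne_zero hd0)]
  set ζ : F := ((γ ^ d : Fˣ) : F) with hζ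
  have hζ0 : ζ ≠ 0 := Units.ne_zero _
  have hζp : ζ ^ p = ζ⁻¹ := by
    refine eq_inv_of_mul_eq_one_left ?_
    rw [← pow_succ, hζ, ← Units.val_pow_eq_pow_val, ← hζo, pow_orderOf_eq_one, Units.val_one]
  have hip : i ^ p = -i := by
    have h4 : i ^ 4 = 1 := by rw [show i ^ 4 = (i * i) * (i * i) by ring, ← hi]; ring
    rw [show p = 4 * (p / 4) + 3 by omega, pow_add, pow_mul, h4, one_pow, one_mul,
      show i ^ 3 = (i * i) * i by ring, ← hi, neg_one_mul]
  let j : ZMod p →+* F := ZMod.castHom dvd_rfl F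
  have hcast : ∀ a : F, frobenius F p a = a → ∃ b, j b = a := fun a ha =>
    exists_eq_of_pow_card_eq j (by rw [ZMod.card]; exact ha)
  have hfζ : frobenius F p ζ = ζ⁻¹ := hζp
  have hfi : frobenius F p i = -i := hip
  obtain ⟨α, hα⟩ := hcast ((ζ + ζ⁻¹) / 2) (by
    rw [map_div₀, map_add, map_inv₀, hfζ, inv_inv, map_ofNat, add_comm])
  obtain ⟨β, hβ⟩ := hcast ((ζ - ζ⁻¹) / (2 * i)) (by
    rw [map_div₀, map_mul, map_sub, map_inv₀, hfζ, hfi, inv_inv, map_ofNat]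
    field_simp
    ring)
  have hαβ : α ^ 2 + β ^ 2 = 1 := by
    refine j.injective ?_
    rw [map_add, map_pow, map_pow, hα, hβ, map_one]
    field_simp
    have hi2 : i ^ 2 = -1 := by rw [pow_two, ← hi]
    rw [hi2]
    ring
  have hsum : j α + i * j β = ζ := by
    rw [hα, hβ]
    field_simp
    ring
  refine ⟨rotMk α β hαβ, rotMk_mem _ _ _, fun N hN => ?_⟩
  have hvec : ((rotMk α β hαβ : Matrix (Fin 2) (Fin 2) (ZMod p)).map j) *ᵥ ![1, -i] =
      ζ • ![1, -i] := by
    rw [← hsum, coe_rotMk]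
    ext l
    fin_cases l
    · simp [Matrix.mulVec, dotProduct, Fin.sum_univ_two]; ring
    · simp [Matrix.mulVec, dotProduct, Fin.sum_univ_two]
      linear_combination (-(j β)) * hi
  have hpow : ∀ n : ℕ, (((rotMk α β hαβ ^ n : SpecialLinearGroup (Fin 2) (ZMod p)) :
      Matrix (Fin 2) (Fin 2) (ZMod p)).map j) *ᵥ ![1, -i] = ζ ^ n • ![1, -i] := by
    intro n
    induction n with
    | zero => simp [Matrix.map_one]
    | succ n ih =>
      rw [pow_succ, Matrix.SpecialLinearGroup.coe_mul, Matrix.map_mul, ← Matrix.mulVec_mulVec, hvec,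
        Matrix.mulVec_smul, ih, smul_smul, pow_succ']
  have h1 := congrFun (hpow N) 0
  rw [hN] at h1
  simp [Matrix.map_one] at h1
  rw [← hζo]
  refine orderOf_dvd_of_pow_eq_one (Units.ext ?_)
  rw [Units.val_pow_eq_pow_val, ← hζ, ← h1, Units.val_one]

lemma not_dvd_of_three_mod_four {p m r N : ℕ} (hp : p.Prime) (hq : p ^ m % 4 = 3) (hpm : p % 4 = 3)
    (hr : r.Prime) (hr2 : r ≠ 2) (hrq : r ∣ p ^ m - 1) (hrN : r ∣ N) (hpN : p + 1 ∣ N) :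
    ¬ (N ∣ (p ^ m + 1) * p ^ 2 ∨
      N ∣ (((p ^ m) ^ 2 - 1) / (if p ^ m % 4 = 1 then 2 else 4)) * p ^ 2) := by
  have hm0 : m ≠ 0 := by
    rintro rfl
    simp at hq
  rintro (h | h)
  · rcases (hr.dvd_mul).mp (hrN.trans h) with h1 | h1
    · have h2 : r ∣ 2 := by
        have := Nat.dvd_sub h1 hrq
        rwa [show p ^ m + 1 - (p ^ m - 1) = 2 by omega] at this
      exact hr2 ((Nat.prime_dvd_prime_iff_eq hr Nat.prime_two).mp h2)
    · have h2 := (Nat.prime_dvd_prime_iff_eq hr hp).mp (hr.dvd_of_dvd_pow h1)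
      subst h2
      have h3 := Nat.dvd_sub (dvd_pow_self r hm0) hrq
      rw [show r ^ m - (r ^ m - 1) = 1 by omega] at h3
      exact hr.one_lt.ne' (Nat.dvd_one.mp h3)
  · rw [if_neg (by omega)] at h
    have hcop : (p + 1).Coprime (p ^ 2) := Nat.Coprime.pow_right 2 (by simp)
    have h1 := hcop.dvd_of_dvd_mul_right (hpN.trans h)
    have hmo : Odd m := by
      by_contra hme
      obtain ⟨l, hl⟩ := Nat.not_odd_iff_even.mp hme
      have : p ^ m % 4 = 1 := by
        rw [hl, ← two_mul, pow_mul, Nat.pow_mod, Nat.pow_mod p, hpm]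
        simp
      omega
    obtain ⟨e, he⟩ := hmo
    obtain ⟨s, hs⟩ : ∃ s, p = 4 * s + 3 := ⟨p / 4, by omega⟩
    have hmod : p ^ m ≡ p [MOD 2 * (p + 1)] := by
      have h2 : p ^ 2 ≡ 1 [MOD 2 * (p + 1)] := by
        refine ((Nat.modEq_iff_dvd' (Nat.one_le_pow _ _ hp.pos)).mpr ⟨2 * s + 1, ?_⟩).symm
        rw [Nat.sub_eq_iff_eq_add (Nat.one_le_pow _ _ hp.pos), hs]
        ring
      rw [he, pow_succ, pow_mul]
      simpa using (h2.pow e).mul_right p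
    obtain ⟨u, hu⟩ := (Nat.modEq_iff_dvd' (Nat.le_self_pow hm0 p)).mp hmod.symm
    have hle := Nat.le_self_pow hm0 p
    have hquot : ((p ^ m) ^ 2 - 1) / 4 = (2 * s + 2) * (2 * u + 1) * ((p ^ m - 1) / 2) := by
      obtain ⟨b, hb⟩ : ∃ b, p ^ m = 4 * b + 3 := ⟨p ^ m / 4, by omega⟩
      have h3 : 2 * b + 2 = (2 * s + 2) * (2 * u + 1) := by
        have : 4 * b + 3 = p + 2 * (p + 1) * u := by omega
        rw [hs] at this
        nlinarith
      rw [hb, ← h3]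
      refine Nat.div_eq_of_eq_mul_right (by norm_num) ?_
      rw [show (4 * b + 3 - 1) / 2 = 2 * b + 1 by omega,
        Nat.sub_eq_iff_eq_add (Nat.one_le_pow _ _ (by omega))]
      ring
    obtain ⟨d, hd⟩ : ∃ d, (p ^ m - 1) / 2 = 2 * d + 1 := ⟨(p ^ m - 1) / 4, by omega⟩
    rw [hquot, hd, hs, show 4 * s + 3 + 1 = (2 * s + 2) * 2 by ring, mul_assoc] at h1
    have h4 := Nat.dvd_of_mul_dvd_mul_left (by omega) h1
    have h5 : Odd ((2 * u + 1) * (2 * d + 1)) := (odd_two_mul_add_one u).mul (odd_two_mul_add_one d)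
    exact (Nat.not_even_iff_odd.mpr h5) (even_iff_two_dvd.mpr h4)

section ThreeModFour

variable {p m : ℕ} [Fact p.Prime] {F : Type*} [Field F] [CharP F p] {κ : F}
  {k : Type*} [Field k] {j : k →+* F}
  {hj : ∀ a, iterateFrobenius F p m (j a) = j a}

lemma not_orderRestricted_innerHom_mul_outerHom (hp4 : p ^ m % 4 = 3) (hpm : p % 4 = 3) {r : ℕ}
    (hr : r.Prime) (hr2 : r ≠ 2) (hrq : r ∣ p ^ m - 1) {μ : kˣ} (hμ : orderOf μ = r)
    {g : SpecialLinearGroup (Fin 2) k} (hg : ∀ N, g ^ N = 1 → p + 1 ∣ N) :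
    ¬ OrderRestricted (innerHom p m κ j hj (slH μ) * outerHom p m κ j hj g) := by
  rintro ⟨N, c, hN0, hN, hdvd⟩
  rw [← isoMat_pow, (commute_outerHom_innerHom j hj g (slH μ)).symm.mul_pow, ← map_pow, ← map_pow,
    isoMat_mul, mat_outerHom, show slH μ ^ N = slH (μ ^ N) from (map_pow (slHHom k) μ N).symm,
    isoMat_innerHom_slH] at hN
  have h11 := congrFun (congrFun hN 1) 1
  have h22 := congrFun (congrFun hN 2) 2
  have h00 := congrFun (congrFun hN 0) 0
  have h03 := congrFun (congrFun hN 0) 3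
  have h30 := congrFun (congrFun hN 3) 0
  have h33 := congrFun (congrFun hN 3) 3
  simp [outerMat] at h11 h22 h00 h03 h30 h33
  have hc0 : c ≠ 0 := by
    rw [← h11]
    exact pow_ne_zero _ ((map_ne_zero j).mpr μ.ne_zero)
  have hc2 : c ^ 2 = 1 := by
    rw [h11] at h22
    rw [pow_two]
    nth_rewrite 1 [← h22]
    exact inv_mul_cancel₀ hc0
  have hcr : c ^ r = 1 := by
    rw [← h11, ← pow_mul, mul_comm, pow_mul, ← map_pow, ← Units.val_pow_eq_pow_val, ← hμ,
      pow_orderOf_eq_one, Units.val_one, map_one, one_pow]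
  obtain ⟨l, hl⟩ := hr.odd_of_ne_two hr2
  rw [hl, pow_succ, pow_mul, hc2, one_pow, one_mul] at hcr
  subst hcr
  refine not_dvd_of_three_mod_four Fact.out hp4 hpm hr hr2 hrq ?_ (hg N ?_) hdvd
  · rw [← hμ]
    refine orderOf_dvd_of_pow_eq_one (Units.ext (j.injective ?_))
    rw [Units.val_pow_eq_pow_val, map_pow, h11, Units.val_one, map_one]
  · refine Subtype.ext (Matrix.ext fun a b => ?_)
    have e0 : (((g : Matrix (Fin 2) (Fin 2) k) ^ N) 0 0) = 1 := j.injective (by rw [h00, map_one])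
    have e1 : (((g : Matrix (Fin 2) (Fin 2) k) ^ N) 1 1) = 1 := j.injective (by rw [h33, map_one])
    rw [Matrix.SpecialLinearGroup.coe_pow, Matrix.SpecialLinearGroup.coe_one]
    fin_cases a <;> fin_cases b <;> simp [h03, h30, e0, e1]

end ThreeModFour

section ThreeModFour

variable {p m : ℕ} [Fact p.Prime] {F : Type*} [Field F] [Fintype F] [CharP F p] {κ : F}
  {k : Type*} [Field k] [Fintype k] {j : k →+* F} {K V : Type*} [Field K] [CharP K p]
  [AddCommGroup V] [Module K V] {π : isoU p m κ →* Module.End K V}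

lemma false_of_three_mod_four [Nontrivial V] (hp : 5 ≤ p) (ι : F →+* K)
    (hj : ∀ a, iterateFrobenius F p m (j a) = j a)
    (hσ : ∀ a : F, iterateFrobenius F p m (iterateFrobenius F p m a) = a)
    (hsurj : ∀ a, iterateFrobenius F p m a = a → ∃ b, j b = a)
    (hk : Fintype.card k = p ^ m) (hF : Fintype.card F = (p ^ m) ^ 2) (hm : m ≠ 0)
    (hq : p ^ m % 4 = 3)
    (hscal : ∀ g (c : F), isoMat g = c • 1 → π g = 1)
    (hfix : ∀ g w, w ≠ 0 → π g w = w → OrderRestricted g)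
    (hB : ∀ g : isoU p m κ, g ^ p = 1 → ∑ i ∈ Finset.range p, π (g ^ i) = 0) : False := by
  classical
  have hodd : Odd p := (Fact.out : p.Prime).odd_of_ne_two (by omega)
  have hp4 : p % 4 = 3 := by
    by_contra h
    have h1 : p % 4 = 1 := by
      have := Nat.odd_iff.mp hodd
      omega
    rw [Nat.pow_mod, h1] at hq
    simp at hq
  have hkp : CharP k p := (RingHom.charP_iff j j.injective p).mpr inferInstance
  obtain ⟨v, A, B, hv⟩ := exists_isHighestWeight j hj hσ ι π hp
  obtain ⟨w, hw0, hwi, -⟩ := hv.exists_middle hB hk hF hm hsurj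
  let X : Submodule K V :=
    { carrier := {v | ∀ t : kˣ, π (innerHom p m κ j hj (slH t)) v = v}
      zero_mem' := fun _ => map_zero _
      add_mem' := fun ha hb t => by rw [map_add, ha t, hb t]
      smul_mem' := fun c a ha t => by rw [map_smul, ha t] }
  let c : SpecialLinearGroup (Fin 2) (ZMod p) →* SpecialLinearGroup (Fin 2) k :=
    Matrix.SpecialLinearGroup.map (ZMod.castHom dvd_rfl k)
  let τ₀ := (π.comp (outerHom p m κ j hj)).comp c
  have hX : ∀ s, ∀ v ∈ X, τ₀ s v ∈ X := by
    intro s v hv t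
    change π (innerHom p m κ j hj (slH t)) (π (outerHom p m κ j hj (c s)) v) =
      π (outerHom p m κ j hj (c s)) v
    rw [← apply_mul, ← (commute_outerHom_innerHom j hj _ _).eq, apply_mul, hv t]
  have hXn : Nontrivial X := ⟨⟨w, hwi⟩, 0, fun h => hw0 (congrArg Subtype.val h)⟩
  have hneg : ∀ (l : Type _) [Field l], (slH (-1) : SpecialLinearGroup (Fin 2) l) = -1 := by
    intro l _
    refine Subtype.ext ?_
    ext a b
    fin_cases a <;> fin_cases b <;> simp [coe_slH]
  have hcneg : c (slH (-1)) = -1 := by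
    refine Subtype.ext ?_
    ext a b
    fin_cases a <;> fin_cases b <;> simp [c, coe_slH]
  obtain ⟨w₁, hw₁0, hw₁⟩ := exists_rotGroup_fixed hodd (restrictRep τ₀ X hX) (by
      ext x
      rw [coe_restrictRep, Module.End.one_apply]
      change π (outerHom p m κ j hj (c (slH (-1)))) x = x
      have h1 := x.2 (-1)
      rw [hneg] at h1
      rw [hcneg, ← h1, ← apply_mul, hscal _ _ (outerHom_mul_innerHom_neg_one j hj), h1,
        Module.End.one_apply])
    (fun g hg => by
      ext x
      have h1 := hB (outerHom p m κ j hj (c g)) (by rw [← map_pow, ← map_pow, hg, map_one, map_one])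
      have h2 := LinearMap.congr_fun h1 x
      rw [LinearMap.sum_apply] at h2
      rw [LinearMap.sum_apply, AddSubmonoidClass.coe_finsetSum, LinearMap.zero_apply,
        ZeroMemClass.coe_zero]
      refine (Finset.sum_congr rfl fun i _ => ?_).trans h2
      rw [coe_restrictRep, ← map_pow, ← map_pow]
      rfl)
  obtain ⟨g, hg, hgN⟩ := exists_rotGroup_generator (m := m) hp4 hF
  have hq7 : 7 ≤ p ^ m := by
    have := Nat.le_self_pow hm p
    omega
  obtain ⟨r, hr, hrd⟩ := Nat.exists_prime_and_dvd (n := (p ^ m - 1) / 2) (by omega)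
  have hr2 : r ≠ 2 := by
    rintro rfl
    omega
  have hrq : r ∣ p ^ m - 1 := hrd.trans (Nat.div_dvd_of_dvd (by omega))
  have : Fact r.Prime := ⟨hr⟩
  obtain ⟨μ, hμ⟩ := exists_prime_orderOf_dvd_card (G := kˣ) r (by rwa [Fintype.card_units, hk])
  have hcinj : Function.Injective c := by
    intro a b hab
    refine Subtype.ext (Matrix.map_injective (ZMod.castHom dvd_rfl k).injective ?_)
    exact congrArg Subtype.val hab
  refine not_orderRestricted_innerHom_mul_outerHom (κ := κ) (hj := hj) hq hp4 hr hr2 hrq hμ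
    (g := c g) (fun N hN => hgN N (hcinj (by rw [map_pow, hN, map_one])))
    (hfix _ (w₁ : V) (fun h => hw₁0 (Subtype.ext h)) ?_)
  have h1 : π (outerHom p m κ j hj (c g)) w₁ = w₁ := congrArg Subtype.val (hw₁ g hg)
  rw [apply_mul, h1, w₁.2 μ]

end ThreeModFour

/-- A finite field with `q²` elements contains an element `κ` of order `2 (q - 1)` with
`κ ^ q = -κ` and an element `ε` of norm `-1`. -/
lemma exists_twisting_elements {p m : ℕ} [Fact p.Prime] (hp : Odd p) {F : Type*} [Field F]
    [Fintype F] [CharP F p] (hF : Fintype.card F = (p ^ m) ^ 2) :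
    ∃ κ ε : F, κ ≠ 0 ∧ iterateFrobenius F p m κ = -κ ∧ iterateFrobenius F p m ε * ε = -1 ∧
      ∀ N, κ ^ N = 1 → 2 * (p ^ m - 1) ∣ N := by
  classical
  obtain ⟨γ, hγ⟩ := IsCyclic.exists_generator (α := Fˣ)
  have hF1 := Fintype.one_lt_card (α := F)
  obtain ⟨l, hl⟩ : Odd (p ^ m) := hp.pow
  have hl0 : l ≠ 0 := by
    rintro rfl
    rw [hF, hl] at hF1
    simp at hF1
  have hγo : orderOf γ = (l + 1) * (4 * l) := by
    rw [orderOf_eq_card_of_forall_mem_zpowers hγ, Nat.card_eq_fintype_card, Fintype.card_units, hF,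
      hl, Nat.sub_eq_iff_eq_add (Nat.one_le_pow _ _ (by omega))]
    ring
  have hhalf : (γ : F) ^ ((l + 1) * (2 * l)) = -1 := by
    have h1 : ((γ : F) ^ ((l + 1) * (2 * l))) ^ 2 = 1 := by
      rw [← pow_mul, show (l + 1) * (2 * l) * 2 = (l + 1) * (4 * l) by ring, ← hγo,
        ← Units.val_pow_eq_pow_val, pow_orderOf_eq_one, Units.val_one]
    refine (eq_or_eq_neg_of_sq_eq_sq _ 1 (by rw [h1, one_pow])).resolve_left fun h => ?_
    have h2 : orderOf γ ∣ (l + 1) * (2 * l) := by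
      refine orderOf_dvd_of_pow_eq_one (Units.ext ?_)
      rw [Units.val_pow_eq_pow_val, h, Units.val_one]
    have h3 := Nat.le_of_dvd (by positivity) h2
    rw [hγo] at h3
    have h4 := Nat.le_of_mul_le_mul_left h3 (by omega)
    omega
  refine ⟨(γ : F) ^ (l + 1), (γ : F) ^ l, pow_ne_zero _ γ.ne_zero, ?_, ?_, fun N hN => ?_⟩
  · rw [iterateFrobenius_def, hl, pow_succ, ← pow_mul, hhalf, neg_one_mul]
  · rw [iterateFrobenius_def, hl, ← pow_succ, ← pow_mul,
      show l * (2 * l + 1 + 1) = (l + 1) * (2 * l) by ring, hhalf]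
  · rw [← pow_mul] at hN
    have h1 : orderOf γ ∣ (l + 1) * N := by
      refine orderOf_dvd_of_pow_eq_one (Units.ext ?_)
      rw [Units.val_pow_eq_pow_val, hN, Units.val_one]
    rw [hγo] at h1
    have h2 := Nat.dvd_of_mul_dvd_mul_left (by omega) h1
    rwa [hl, show 2 * (2 * l + 1 - 1) = 4 * l by omega]

/-- The field of `q²` elements contains a field of `q` elements. -/
lemma exists_fixed_subfield {p m : ℕ} [Fact p.Prime] (hm : m ≠ 0) {F : Type*} [Field F] [Fintype F]
    [CharP F p] (hF : Fintype.card F = (p ^ m) ^ 2) :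
    ∃ (k : Type) (_ : Field k) (_ : Fintype k) (j : k →+* F), Fintype.card k = p ^ m ∧
      (∀ a, iterateFrobenius F p m (j a) = j a) ∧
      ∀ a, iterateFrobenius F p m a = a → ∃ b, j b = a := by
  classical
  let : Algebra (ZMod p) F := ZMod.algebra F p
  let : Fintype (GaloisField p m) := Fintype.ofFinite _
  have hk : Fintype.card (GaloisField p m) = p ^ m := by
    rw [← Nat.card_eq_fintype_card, GaloisField.card p m hm]
  have hfr : Module.finrank (ZMod p) F = m * 2 := by
    have h := Module.card_eq_pow_finrank (K := ZMod p) (V := F)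
    rw [ZMod.card, hF, ← pow_mul] at h
    exact (Nat.pow_right_injective (Fact.out : p.Prime).two_le h).symm
  obtain ⟨f⟩ := FiniteField.nonempty_algHom_of_finrank_dvd (F := ZMod p) (K := GaloisField p m)
    (L := F) (by rw [GaloisField.finrank p hm, hfr]; exact dvd_mul_right _ _)
  refine ⟨GaloisField p m, inferInstance, inferInstance, f.toRingHom, hk, fun a => ?_,
    fun a ha => ?_⟩
  · rw [iterateFrobenius_def, ← map_pow, ← hk, FiniteField.pow_card]
  · rw [iterateFrobenius_def, ← hk] at ha
    exact exists_eq_of_pow_card_eq _ ha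

section BaseChange

open TensorProduct

variable {p m : ℕ} [Fact p.Prime] {F : Type*} [Field F] [Fintype F] [CharP F p] {κ : F}
  {K V : Type*} [Field K] [CharP K p]
  [AddCommGroup V] [Module K V] {π : isoU p m κ →* Module.End K V}

lemma false_of_five_le [Nontrivial V] (hp : 5 ≤ p)
    (hσ : ∀ a : F, iterateFrobenius F p m (iterateFrobenius F p m a) = a)
    (hF : Fintype.card F = (p ^ m) ^ 2) (hm : m ≠ 0) (hκ0 : κ ≠ 0)
    (hκ : iterateFrobenius F p m κ = -κ) (hκN : ∀ N, κ ^ N = 1 → 2 * (p ^ m - 1) ∣ N)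
    (hscal : ∀ g (c : F), isoMat g = c • 1 → π g = 1)
    (hfix : ∀ g w, w ≠ 0 → π g w = w → OrderRestricted g)
    (hB : ∀ g : isoU p m κ, g ^ p = 1 → ∑ i ∈ Finset.range p, π (g ^ i) = 0) : False := by
  obtain ⟨k, _, _, j, hk, hj, hsurj⟩ := exists_fixed_subfield hm hF
  have : CharP (AlgebraicClosure K) p :=
    charP_of_injective_algebraMap (algebraMap K (AlgebraicClosure K)).injective p
  let : Algebra (ZMod p) F := ZMod.algebra F p
  let : Algebra (ZMod p) (AlgebraicClosure K) := ZMod.algebra _ p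
  let ι : F →+* AlgebraicClosure K :=
    (IsAlgClosed.lift (R := ZMod p) (S := F) (M := AlgebraicClosure K)).toRingHom
  let β := Module.End.baseChangeHom K (AlgebraicClosure K) V
  let π' : isoU p m κ →* Module.End (AlgebraicClosure K) (AlgebraicClosure K ⊗[K] V) :=
    (β : Module.End K V →* _).comp π
  have hβ : ∀ f, β f = f.baseChange (AlgebraicClosure K) := fun f => rfl
  have hscal' : ∀ g (c : F), isoMat g = c • 1 → π' g = 1 := fun g c h => by
    change β (π g) = 1
    rw [hscal g c h, map_one]
  have hfix' : ∀ g w, w ≠ 0 → π' g w = w → OrderRestricted g := by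
    intro g w hw hgw
    by_contra hg
    have hinj : Function.Injective (π g - 1 : Module.End K V) := by
      rw [injective_iff_map_eq_zero]
      intro v hv
      by_contra hv0
      exact hg (hfix g v hv0 (sub_eq_zero.mp hv))
    have hinj' : Function.Injective (β (π g - 1)) :=
      Module.Flat.lTensor_preserves_injective_linearMap (M := AlgebraicClosure K) _ hinj
    refine hw (hinj' ?_)
    rw [map_sub, map_one, LinearMap.sub_apply, map_zero, Module.End.one_apply]
    exact sub_eq_zero.mpr hgw
  have hB' : ∀ g : isoU p m κ, g ^ p = 1 → ∑ i ∈ Finset.range p, π' (g ^ i) = 0 := by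
    intro g hg
    change ∑ i ∈ Finset.range p, β (π (g ^ i)) = 0
    rw [← map_sum, hB g hg, map_zero]
  have hodd : Odd (p ^ m) := ((Fact.out : p.Prime).odd_of_ne_two (by omega)).pow
  rcases Nat.odd_mod_four_iff.mp (Nat.odd_iff.mp hodd) with hq | hq
  · exact false_of_one_mod_four hp ι hj hσ hsurj hk hF hm hq hκ0 hκ hκN hfix' hB'
  · exact false_of_three_mod_four hp ι hj hσ hsurj hk hF hm hq hscal' hfix' hB'

end BaseChange

/-- If `L = PSU₄(q)`, `q` odd, acts by linear automorphisms on a nonzero vector space `W`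
over a field of characteristic `p`, then `ω(W ⋊ L) ≠ ω(L)`. -/
theorem spectrum_ne_of_psu4_semidirect
    (p m : ℕ) [Fact p.Prime] (hp : Odd p)
    (F : Type) [Field F] [Fintype F] [CharP F p] (hF : Fintype.card F = (p ^ m) ^ 2)
    (K : Type) [Field K] [CharP K p]
    (W : Type) [AddCommGroup W] [Module K W] [Nontrivial W]
    (ρ : ((SU4 p m F hF : Subgroup (SpecialLinearGroup (Fin 4) F)) ⧸
        Subgroup.center (SU4 p m F hF)) →* (W ≃ₗ[K] W)) :
    elementOrders (SemidirectProduct (Multiplicative W)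
        ((SU4 p m F hF : Subgroup (SpecialLinearGroup (Fin 4) F)) ⧸
          Subgroup.center (SU4 p m F hF))
        (linToMulAut.comp ρ)) ≠
      elementOrders ((SU4 p m F hF : Subgroup (SpecialLinearGroup (Fin 4) F)) ⧸
        Subgroup.center (SU4 p m F hF)) := by
  classical
  intro hω
  have hσ : ∀ a : F, iterateFrobenius F p m (iterateFrobenius F p m a) = a := fun a => by
    rw [iterateFrobenius_def, iterateFrobenius_def, ← pow_mul, ← pow_two, ← hF,
      FiniteField.pow_card]
  have hm : m ≠ 0 := by
    rintro rfl
    have h1 := Fintype.one_lt_card (α := F)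
    rw [hF] at h1
    simp at h1
  have hp3 : 3 ≤ p := by
    have := (Fact.out : p.Prime).two_le
    obtain ⟨l, rfl⟩ := hp
    omega
  have h2 : (2 : F) ≠ 0 := by
    intro h
    have h' : ((2 : ℕ) : F) = 0 := by exact_mod_cast h
    rw [CharP.cast_eq_zero_iff F p] at h'
    have := Nat.le_of_dvd two_pos h'
    omega
  obtain ⟨κ, ε, hκ0, hκ, hε, hκN⟩ := exists_twisting_elements hp hF
  obtain ⟨k, _, _, j, -, hj, -⟩ := exists_fixed_subfield hm hF
  let L := (SU4 p m F hF : Subgroup (SpecialLinearGroup (Fin 4) F)) ⧸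
    Subgroup.center (SU4 p m F hF)
  let Ψ : isoU p m κ →* L :=
    (QuotientGroup.mk' (Subgroup.center (SU4 p m F hF))).comp (toSU4 hF h2 hκ0 hκ hε)
  have hΨ : ∀ g, Ψ g = 1 ↔ ∃ c : F, isoMat g = c • 1 :=
    mk_toSU4_eq_one_iff hF j h2 hκ0 hκ hε hj hσ
  let ρ' : L →* Module.End K W :=
    { toFun := fun y => (ρ y : W →ₗ[K] W)
      map_one' := by rw [map_one]; rfl
      map_mul' := fun x y => by rw [map_mul]; rfl }
  let π : isoU p m κ →* Module.End K W := ρ'.comp Ψ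
  have hscal : ∀ g (c : F), isoMat g = c • 1 → π g = 1 := fun g c h => by
    change ρ' (Ψ g) = 1
    rw [(hΨ g).mpr ⟨c, h⟩, map_one]
  have hLfin : Finite L := Finite.of_surjective _ (QuotientGroup.mk_surjective)
  have hfix : ∀ g w, w ≠ 0 → π g w = w → OrderRestricted g := by
    intro g w hw hg
    obtain ⟨y, hy⟩ := exists_orderOf_eq_lcm hω (p := p) hw (x := Ψ g) hg
    have hdvd := orderOf_dvd_of_dvd hp y (hy ▸ Nat.dvd_lcm_left _ _)
    have hgy : orderOf (Ψ g) ∣ orderOf y := hy ▸ Nat.dvd_lcm_right _ _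
    obtain ⟨c, hc⟩ := (hΨ (g ^ orderOf (Ψ g))).mp (by rw [map_pow, pow_orderOf_eq_one])
    exact ⟨orderOf (Ψ g), c, orderOf_pos _, by rw [← isoMat_pow, hc],
      hdvd.imp hgy.trans hgy.trans⟩
  rcases eq_or_lt_of_le hp3 with rfl | hp3
  · have hC : ∀ x s w, x ^ 3 = 1 → (∃ c : F, isoMat (s * s) = c • 1) →
        (¬ ∃ c : F, isoMat s = c • 1) → Commute x s → π s w = w →
        w + π x w + π x (π x w) = 0 := by
      intro x s w hx hs2 hs1 hc hw
      have h := sum_range_three_eq_zero hω (orderOf_ne_eighteen rfl) (x := Ψ x) (j := Ψ s)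
        (by rw [← map_pow, hx, map_one]) (by rw [pow_two, ← map_mul]; exact (hΨ _).mpr hs2)
        (fun h => hs1 ((hΨ s).mp h)) (hc.map Ψ) hw
      rw [← h, Finset.sum_range_succ, Finset.sum_range_succ, Finset.sum_range_one, pow_zero,
        pow_one, pow_two, map_one, map_mul]
      rfl
    obtain ⟨w, hw⟩ := exists_ne (0 : W)
    let X : Submodule K W := Submodule.span K (Set.range fun y : L => ρ' y w)
    have hX : ∀ g, ∀ v ∈ X, π g v ∈ X := by
      intro g v hv
      refine Submodule.span_induction ?_ ?_ ?_ ?_ hv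
      · rintro _ ⟨y, rfl⟩
        refine Submodule.subset_span ⟨Ψ g * y, ?_⟩
        exact LinearMap.congr_fun (map_mul ρ' (Ψ g) y) w
      · rw [map_zero]; exact X.zero_mem
      · intro a b _ _ ha hb
        rw [map_add]; exact X.add_mem ha hb
      · intro c a _ ha
        rw [map_smul]; exact X.smul_mem c ha
    have hwX : w ∈ X := Submodule.subset_span ⟨1, by simp⟩
    have : Nontrivial X := ⟨⟨w, hwX⟩, 0, fun h => hw (congrArg Subtype.val h)⟩
    have : FiniteDimensional K X := FiniteDimensional.span_of_finite K (Set.finite_range _)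
    refine false_of_char_three hF hm hσ (restrictRep π X hX) (fun g c h => ?_)
      (fun g v hv h => hfix g v (fun h0 => hv (Subtype.ext h0)) (congrArg Subtype.val h))
      (fun x s v hx h1 h2 hc hv => Subtype.ext (hC x s v hx h1 h2 hc (congrArg Subtype.val hv)))
    ext v
    rw [coe_restrictRep, hscal g c h]
    rfl
  · have hp5 : 5 ≤ p := by
      obtain ⟨l, rfl⟩ := hp
      omega
    refine false_of_five_le hp5 hσ hF hm hκ0 hκ hκN hscal hfix fun g hg => ?_
    ext w
    rw [LinearMap.sum_apply]
    have h := sum_range_eq_zero hω (fun y hy => not_sq_dvd_orderOf hp5 y hy.symm.dvd)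
      (x := Ψ g) (by rw [← map_pow, hg, map_one]) w
    refine (Finset.sum_congr rfl fun i _ => ?_).trans h
    rw [← map_pow]
    rfl
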